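/- Let q ≥ 2 be an integer, K ⊆ ℚ̄ a field, and α ∈ K with 0 < |α| < 1. If elements ξ_1, …, ξ_r of M_{q,α,K} are linearly dependent over ℚ̄, then they are linearly dependent over K. Equivalently, the K-algebras M_{q,α,K} and ℚ̄ are linearly disjoint over K, and M_{q,α} = M_{q,α,K} ⊗_K ℚ̄. -/

import Mathlib

noncomputable section

/-- The derivative `d/dz` of a formal power series over `ℂ`. -/
def psD (f : PowerSeries ℂ) : PowerSeries ℂ :=
  PowerSeries.mk fun n => ((n : ℂ) + 1) * PowerSeries.coeff (n + 1) f

/-- The Mahler operator `σ_q : f(z) ↦ f(z^q)` on formal power series over `ℂ`. -/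
def psSigma (q : ℕ) (f : PowerSeries ℂ) : PowerSeries ℂ :=
  PowerSeries.mk fun n => if q ∣ n then PowerSeries.coeff (n / q) f else 0

/-- The canonical embedding of polynomials into power series. -/
def polyPS : Polynomial ℂ →+* PowerSeries ℂ := Polynomial.coeToPowerSeries.ringHom

/-- The power series `∑ (a n / n!) zⁿ` attached to a sequence `a` of coefficients. -/
def ePS (a : ℕ → ℂ) : PowerSeries ℂ := PowerSeries.mk fun n => a n / (n.factorial : ℂ)

/-- `IsE a` : the power series `∑ (a n / n!) zⁿ` is an E-function: its coefficients are
algebraic, it satisfies a nonzero linear differential equation over `ℚ̄[z]`, and the size of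
the conjugates of the `a n` as well as their common denominators grow at most geometrically. -/
def IsE (a : ℕ → ℂ) : Prop :=
  (∀ n, IsAlgebraic ℚ (a n)) ∧
  (∃ (m : ℕ) (p : ℕ → Polynomial ℂ),
      (∀ i k, IsAlgebraic ℚ ((p i).coeff k)) ∧ (∃ i, i ≤ m ∧ p i ≠ 0) ∧
      ∑ i ∈ Finset.range (m + 1), polyPS (p i) * psD^[i] (ePS a) = 0) ∧
  (∃ C : ℝ, 0 < C ∧ ∃ d : ℕ → ℕ, ∀ n : ℕ, 1 ≤ n →
      1 ≤ d n ∧ (d n : ℝ) ≤ C ^ n ∧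
      (∀ σ : (integralClosure ℚ ℂ) →+* ℂ, ∀ h : a n ∈ integralClosure ℚ ℂ,
        ‖σ ⟨a n, h⟩‖ ≤ C ^ n) ∧
      (∀ i, 1 ≤ i → i ≤ n → IsIntegral ℤ ((d n : ℂ) * a i)))

/-- The value at `α` of the E-function with coefficient sequence `a`
(E-functions are entire, so this series converges for all `α`). -/
def evalE (a : ℕ → ℂ) (α : ℂ) : ℂ := ∑' n : ℕ, a n / (n.factorial : ℂ) * α ^ n

/-- `IsM q f` : the formal power series `f` is an M_q-function, i.e. it has algebraic
coefficients and satisfies a linear `σ_q`-difference equation over `ℚ̄[z]` with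
not-all-zero polynomial coefficients. -/
def IsM (q : ℕ) (f : PowerSeries ℂ) : Prop :=
  (∀ n, IsAlgebraic ℚ (PowerSeries.coeff n f)) ∧
  ∃ (m : ℕ) (p : ℕ → Polynomial ℂ),
    (∀ i k, IsAlgebraic ℚ ((p i).coeff k)) ∧ (∃ i, i ≤ m ∧ p i ≠ 0) ∧
    ∑ i ∈ Finset.range (m + 1), polyPS (p i) * (psSigma q)^[i] f = 0

/-- `MahlerValue f α v` : the meromorphic extension of (the sum of) the power series `f`
to the open unit disk has no pole at `α` and takes the value `v` there. -/
def MahlerValue (f : PowerSeries ℂ) (α v : ℂ) : Prop :=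
  ∃ F : ℂ → ℂ, MeromorphicOn F (Metric.ball (0 : ℂ) 1) ∧
    (∀ᶠ z in nhds (0 : ℂ), HasSum (fun n => PowerSeries.coeff n f * z ^ n) (F z)) ∧
    AnalyticAt ℂ F α ∧ F α = v

/-- The power series `f` converges (hence defines an analytic function) on the open
disk `D(0,R)`. -/
def AnOnBall (f : PowerSeries ℂ) (R : ℝ) : Prop :=
  ∀ z : ℂ, ‖z‖ < R → Summable fun n => PowerSeries.coeff n f * z ^ n

/-- The value at `z` of (the sum of) the power series `f`. -/
def psEval (f : PowerSeries ℂ) (z : ℂ) : ℂ := ∑' n : ℕ, PowerSeries.coeff n f * z ^ n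

/-- `Banal fv α P` : the homogeneous algebraic relation `P` among the values at `α` of the
power series `fv 1, …, fv r` is banal: it is the specialization at `z = α` of some
`Q ∈ ℚ̄[z, X₁, …, X_r]`, homogeneous in `X₁, …, X_r`, with `Q(z, fv 1, …, fv r) = 0`. -/
def Banal {r : ℕ} (fv : Fin r → PowerSeries ℂ) (α : ℂ) (P : MvPolynomial (Fin r) ℂ) : Prop :=
  ∃ Q : MvPolynomial (Fin r) (Polynomial ℂ),
    (∀ v k, IsAlgebraic ℚ ((MvPolynomial.coeff v Q).coeff k)) ∧
    (∃ e, Q.IsHomogeneous e) ∧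
    MvPolynomial.eval₂ polyPS fv Q = 0 ∧
    MvPolynomial.map (Polynomial.evalRingHom α) Q = P

/-- `Eset S` : the set of values at `z = 1` of all E-functions with coefficients in `S`. -/
def Eset (S : Set ℂ) : Set ℂ :=
  {x | ∃ a : ℕ → ℂ, IsE a ∧ (∀ n, a n ∈ S) ∧ x = evalE a 1}

/-- `Mset q α S` : the set of values at `α` of all M_q-functions with coefficients in `S`
having no pole at `α`. -/
def Mset (q : ℕ) (α : ℂ) (S : Set ℂ) : Set ℂ :=
  {x | ∃ f : PowerSeries ℂ, IsM q f ∧ (∀ n, PowerSeries.coeff n f ∈ S) ∧ MahlerValue f α x}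

namespace Mahler
open PowerSeries Finset

section Sigma
variable {k : Type*} [Field k]

/-- The Mahler operator `f(z) ↦ f(z^q)`. -/
abbrev sig (q : ℕ) [NeZero q] : k⟦X⟧ →ₐ[k] k⟦X⟧ := PowerSeries.expand q (NeZero.ne q)

theorem poly_smul_eq (p : Polynomial k) (f : k⟦X⟧) : p • f = (p : k⟦X⟧) * f := by
  rw [Algebra.smul_def]; rfl

theorem sig_coe (q : ℕ) [NeZero q] (p : Polynomial k) :
    sig q (p : k⟦X⟧) = (Polynomial.expand k q p : Polynomial k) := by
  ext n
  rw [coeff_expand, Polynomial.coeff_coe, Polynomial.coeff_coe,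
    Polynomial.coeff_expand (Nat.pos_of_ne_zero (NeZero.ne q))]

theorem sig_smul (q : ℕ) [NeZero q] (p : Polynomial k) (f : k⟦X⟧) :
    sig q (p • f) = Polynomial.expand k q p • sig q f := by
  rw [poly_smul_eq, poly_smul_eq, map_mul, sig_coe]

theorem coeff_sig_iterate (q : ℕ) [NeZero q] (N : ℕ) (f : k⟦X⟧) (n : ℕ) :
    coeff n ((sig q)^[N] f) = if q ^ N ∣ n then coeff (n / q ^ N) f else 0 := by
  have hq : q ≠ 0 := NeZero.ne q
  have : (sig q)^[N] f = PowerSeries.expand (q ^ N) (pow_ne_zero _ hq) f := by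
    induction N with
    | zero => simp
    | succ N ih =>
      rw [Function.iterate_succ_apply', ih, ← PowerSeries.expand_mul]
      congr 1
      congr 1
      ring
  rw [this, coeff_expand]

/-- The Cartier operator extracting the coefficients with index congruent to `s`. -/
def cartier (q s : ℕ) : k⟦X⟧ →+ k⟦X⟧ where
  toFun h := PowerSeries.mk fun n => coeff (q * n + s) h
  map_zero' := by ext; simp
  map_add' := by intros; ext; simp

theorem cartier_mul_sig (q s : ℕ) [NeZero q] (hs : s < q) (h g : k⟦X⟧) :
    cartier q s (h * sig q g) = cartier q s h * g := by
  have hq : 0 < q := Nat.pos_of_ne_zero (NeZero.ne q)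
  ext n
  simp only [cartier, AddMonoidHom.coe_mk, ZeroHom.coe_mk, coeff_mk, coeff_mul]
  symm
  refine Finset.sum_of_injOn (fun x => (q * x.1 + s, q * x.2)) ?_ ?_ ?_ ?_
  · rintro ⟨a, b⟩ - ⟨a', b'⟩ - h
    simp only [Prod.mk.injEq, add_left_inj, mul_eq_mul_left_iff] at h
    ext <;> simp <;> omega
  · rintro ⟨a, b⟩ hx
    simp only [mem_coe, HasAntidiagonal.mem_antidiagonal] at hx ⊢
    rw [← hx]; ring
  · rintro ⟨a, b⟩ hx hne
    rw [HasAntidiagonal.mem_antidiagonal] at hx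
    dsimp only at hx ⊢
    rw [coeff_expand_of_not_dvd, mul_zero]
    rintro ⟨b', rfl⟩
    apply hne
    have hb : b' ≤ n := by
      by_contra hc
      have : q * (n + 1) ≤ q * b' := Nat.mul_le_mul_left _ (by omega)
      rw [mul_add] at this
      omega
    refine ⟨(n - b', b'), ?_, ?_⟩
    · simp [Nat.sub_add_cancel hb]
    · obtain ⟨c, rfl⟩ := Nat.exists_eq_add_of_le hb
      simp only [Nat.add_sub_cancel_left, Prod.mk.injEq, and_true]
      rw [mul_add] at hx
      omega
  · rintro ⟨a, b⟩ hx
    simp only [coeff_expand_mul]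

theorem cartier_coe (q s : ℕ) [NeZero q] (p : Polynomial k) :
    ∃ p' : Polynomial k, (p' : k⟦X⟧) = cartier q s (p : k⟦X⟧) := by
  refine ⟨trunc (p.natDegree + 1) (cartier q s (p : k⟦X⟧)), ?_⟩
  ext n
  rw [Polynomial.coeff_coe, coeff_trunc]
  split_ifs with h
  · rfl
  · simp only [cartier, AddMonoidHom.coe_mk, ZeroHom.coe_mk, coeff_mk, Polynomial.coeff_coe]
    rw [Polynomial.coeff_eq_zero_of_natDegree_lt]
    have : 1 * n ≤ q * n := Nat.mul_le_mul_right _ (Nat.pos_of_ne_zero (NeZero.ne q))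
    omega

theorem linearIndependent_sig (q : ℕ) [NeZero q] {n : ℕ} {g : Fin n → k⟦X⟧}
    (hg : LinearIndependent (Polynomial k) g) :
    LinearIndependent (Polynomial k) (fun j => sig q (g j)) := by
  rw [Fintype.linearIndependent_iff] at hg ⊢
  intro p hp j
  have hq : 0 < q := Nat.pos_of_ne_zero (NeZero.ne q)
  choose c hc using fun s j => cartier_coe q s (p j)
  have key : ∀ s < q, ∀ j, c s j = 0 := by
    intro s hs
    apply hg
    have := congrArg (cartier q s) hp
    rw [map_sum, map_zero] at this
    rw [← this]
    refine Finset.sum_congr rfl fun j _ => ?_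
    rw [poly_smul_eq, poly_smul_eq, cartier_mul_sig _ _ hs, hc]
  ext m
  have h1 := hc (m % q) j
  rw [key _ (Nat.mod_lt _ hq)] at h1
  have h2 := congrArg (coeff (m / q)) h1
  simp only [cartier, AddMonoidHom.coe_mk, ZeroHom.coe_mk, coeff_mk, Polynomial.coeff_coe,
    Nat.div_add_mod] at h2
  simp [← h2]

theorem det_ne_zero_of_linearIndependent {R V : Type*} [CommRing R] [IsDomain R] [AddCommGroup V]
    [Module R V] {n : ℕ} {u w : Fin n → V} (hu : LinearIndependent R u) {δ : R} (hδ : δ ≠ 0)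
    {A : Matrix (Fin n) (Fin n) R} (h : ∀ i, δ • u i = ∑ j, A i j • w j) : A.det ≠ 0 := by
  intro h0
  obtain ⟨v, hv, hvA⟩ := Matrix.exists_vecMul_eq_zero_iff.mpr h0
  rw [Fintype.linearIndependent_iff] at hu
  apply hv
  funext i
  have := hu (fun i => v i * δ) (by
    simp only [mul_smul, h, Finset.smul_sum]
    rw [Finset.sum_comm]
    refine Finset.sum_eq_zero fun j _ => ?_
    simp only [← mul_smul, ← Finset.sum_smul]
    have := congrFun hvA j
    simp only [Matrix.vecMul, dotProduct, Pi.zero_apply] at this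
    rw [this, zero_smul]) i
  simpa [hδ] using this

theorem adjugate_smul_eq {R V : Type*} [CommRing R] [AddCommGroup V]
    [Module R V] {n : ℕ} {u w : Fin n → V} {δ : R}
    {A : Matrix (Fin n) (Fin n) R} (h : ∀ i, δ • u i = ∑ j, A i j • w j) (l : Fin n) :
    A.det • w l = ∑ i, (A.adjugate l i * δ) • u i := by
  simp only [mul_smul, h, Finset.smul_sum]
  rw [Finset.sum_comm]
  simp only [← mul_smul, ← Finset.sum_smul]
  have : ∀ j, ∑ i, A.adjugate l i * A i j = if l = j then A.det else 0 := by
    intro j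
    have := congrFun (congrFun A.adjugate_mul l) j
    rw [Matrix.mul_apply] at this
    rw [this, Matrix.smul_apply, Matrix.one_apply]
    simp
  simp [this]

/-- Elements having a nonzero multiple in a submodule. -/
def satur {R V : Type*} [CommRing R] [IsDomain R] [AddCommGroup V] [Module R V]
    (W : Submodule R V) : Submodule R V where
  carrier := {v | ∃ d : R, d ≠ 0 ∧ d • v ∈ W}
  zero_mem' := ⟨1, one_ne_zero, by simp⟩
  add_mem' := by
    rintro a b ⟨d, hd, h⟩ ⟨d', hd', h'⟩
    refine ⟨d * d', mul_ne_zero hd hd', ?_⟩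
    rw [smul_add]
    refine W.add_mem ?_ ?_
    · rw [mul_comm, mul_smul]; exact W.smul_mem _ h
    · rw [mul_smul]; exact W.smul_mem _ h'
  smul_mem' := by
    rintro c a ⟨d, hd, h⟩
    exact ⟨d, hd, by rw [smul_comm]; exact W.smul_mem _ h⟩

theorem exists_common_denominator {R V : Type*} [CommRing R] [IsDomain R] [AddCommGroup V]
    [Module R V] {n m : ℕ} {u : Fin n → V} {v : Fin m → V}
    (h : ∀ i, v i ∈ satur (Submodule.span R (Set.range u))) :
    ∃ δ : R, δ ≠ 0 ∧ ∃ A : Matrix (Fin m) (Fin n) R, ∀ i, δ • v i = ∑ j, A i j • u j := by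
  choose d hd h using h
  simp only [Submodule.mem_span_range_iff_exists_fun] at h
  choose c hc using h
  refine ⟨∏ i, d i, Finset.prod_ne_zero_iff.mpr fun i _ => hd i,
    fun i j => (∏ l ∈ univ.erase i, d l) * c i j, fun i => ?_⟩
  rw [← Finset.prod_erase_mul _ _ (Finset.mem_univ i), mul_smul, ← hc, Finset.smul_sum]
  simp only [mul_smul]

theorem exists_inverse_system {R V : Type*} [CommRing R] [IsDomain R] [AddCommGroup V]
    [Module R V] {n : ℕ} {u g : Fin n → V} (hu : LinearIndependent R u)
    (h : ∀ i, u i ∈ satur (Submodule.span R (Set.range g))) :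
    ∃ δ : R, δ ≠ 0 ∧ ∃ A : Matrix (Fin n) (Fin n) R, ∀ i, δ • g i = ∑ j, A i j • u j := by
  obtain ⟨δ', hδ', A', hA'⟩ := exists_common_denominator h
  exact ⟨A'.det, det_ne_zero_of_linearIndependent hu hδ' hA',
    Matrix.of fun i j => A'.adjugate i j * δ', adjugate_smul_eq hA'⟩

theorem exists_saturating_family (q : ℕ) [NeZero q] {r : ℕ} (f : Fin r → k⟦X⟧)
    (hf : ∀ i, ∃ (m : ℕ) (p : ℕ → Polynomial k), p m ≠ 0 ∧
      ∑ l ∈ range (m + 1), p l • (sig q)^[l] (f i) = 0) :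
    ∃ (n : ℕ) (g : Fin n → k⟦X⟧), LinearIndependent (Polynomial k) g ∧
      (∀ j, ∃ i l, g j = (sig q)^[l] (f i)) ∧
      (∀ i, f i ∈ satur (Submodule.span (Polynomial k) (Set.range g))) ∧
      (∀ j, sig q (g j) ∈ satur (Submodule.span (Polynomial k) (Set.range g))) := by
  choose M p hp hsum using hf
  let v : (Σ i, Fin (M i)) → k⟦X⟧ := fun x => (sig q)^[(x.2 : ℕ)] (f x.1)
  obtain ⟨s, hs, hmax⟩ := exists_maximal_linearIndepOn (Polynomial k) v
  obtain ⟨n, ⟨e⟩⟩ : ∃ n, Nonempty (Fin n ≃ s) := by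
    classical
    exact ⟨_, ⟨(Fintype.equivFin s).symm⟩⟩
  have hvW : ∀ x, v x ∈ satur (Submodule.span (Polynomial k) (v '' s)) := by
    intro x
    by_cases hx : x ∈ s
    · exact ⟨1, one_ne_zero, by
        rw [one_smul]; exact Submodule.subset_span ⟨x, hx, rfl⟩⟩
    · exact hmax x hx
  generalize hWdef : satur (Submodule.span (Polynomial k) (v '' s)) = W at hvW
  have hWle : ∀ i, ∀ l ≤ M i, (sig q)^[l] (f i) ∈ W := by
    intro i l hl
    rcases hl.lt_or_eq with hl | rfl
    · exact hvW ⟨i, l, hl⟩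
    · have h := hsum i
      rw [Finset.sum_range_succ] at h
      have hmem : p i (M i) • (sig q)^[M i] (f i) ∈ W := by
        rw [eq_neg_of_add_eq_zero_right h]
        refine W.neg_mem (W.sum_mem fun l hl => W.smul_mem _ ?_)
        exact hvW ⟨i, l, Finset.mem_range.mp hl⟩
      rw [← hWdef] at hmem ⊢
      obtain ⟨d, hd, h'⟩ := hmem
      exact ⟨d * p i (M i), mul_ne_zero hd (hp i), by rwa [mul_smul]⟩
  have hrange : Set.range (fun j => v (e j)) = v '' s := by
    ext x
    simp only [Set.mem_range, Set.mem_image]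
    constructor
    · rintro ⟨y, rfl⟩; exact ⟨e y, (e y).2, rfl⟩
    · rintro ⟨y, hy, rfl⟩; exact ⟨e.symm ⟨y, hy⟩, by simp⟩
  refine ⟨n, fun j => v (e j), ?_, fun j => ⟨_, _, rfl⟩, ?_, ?_⟩
  · have : LinearIndependent (Polynomial k) (fun x : s => v x) := hs
    exact this.comp e e.injective
  · rw [hrange, hWdef]
    exact fun i => hWle i 0 (Nat.zero_le _)
  · rw [hrange, hWdef]
    intro j
    rw [← Function.iterate_succ_apply' (sig q)]
    exact hWle _ _ (e j : Σ i, Fin (M i)).2.2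

theorem satur_span_sig_iterate (q : ℕ) [NeZero q] {n : ℕ} {g : Fin n → k⟦X⟧}
    {δ : Polynomial k} (hδ : δ ≠ 0) {A : Matrix (Fin n) (Fin n) (Polynomial k)}
    (hA : ∀ i, δ • g i = ∑ j, A i j • sig q (g j)) (N : ℕ) :
    satur (Submodule.span (Polynomial k) (Set.range g)) ≤
      satur (Submodule.span (Polynomial k) (Set.range fun j => (sig q)^[N] (g j))) := by
  have hle : ∀ N j, (sig q)^[N] (g j) ∈
      satur (Submodule.span (Polynomial k) (Set.range fun j => (sig q)^[N + 1] (g j))) := by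
    intro N j
    refine ⟨(Polynomial.expand k q)^[N] δ, ?_, ?_⟩
    · clear hA
      induction N with
      | zero => exact hδ
      | succ N ih =>
        rw [Function.iterate_succ_apply']
        exact (Polynomial.expand_ne_zero (Nat.pos_of_ne_zero (NeZero.ne q))).mpr ih
    · have : ∀ N, (Polynomial.expand k q)^[N] δ • (sig q)^[N] (g j) =
        ∑ i, (Polynomial.expand k q)^[N] (A j i) • (sig q)^[N + 1] (g i) := by
        intro N
        induction N with
        | zero => exact hA j
        | succ N ih =>
          have := congrArg (sig q) ih
          rw [map_sum, sig_smul] at this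
          simp only [sig_smul, ← Function.iterate_succ_apply' (sig q),
            ← Function.iterate_succ_apply' (Polynomial.expand k q)] at this
          exact this
      rw [this]
      exact Submodule.sum_mem _ fun i _ => Submodule.smul_mem _ _ (Submodule.subset_span ⟨i, rfl⟩)
  induction N with
  | zero => exact le_rfl
  | succ N ih =>
    refine ih.trans ?_
    rintro x ⟨d, hd, hx⟩
    have hx' := (Submodule.span_le (p := satur (Submodule.span (Polynomial k)
      (Set.range fun j => (sig q)^[N + 1] (g j))))).mpr
      (by rintro _ ⟨j, rfl⟩; exact hle N j) hx
    obtain ⟨d', hd', hx'⟩ := hx'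
    exact ⟨d' * d, mul_ne_zero hd' hd, by rwa [mul_smul]⟩

theorem exists_system (q : ℕ) [NeZero q] {r : ℕ} (f : Fin r → k⟦X⟧)
    (hf : ∀ i, ∃ (m : ℕ) (p : ℕ → Polynomial k), p m ≠ 0 ∧
      ∑ l ∈ range (m + 1), p l • (sig q)^[l] (f i) = 0) :
    ∃ (n : ℕ) (g : Fin n → k⟦X⟧), LinearIndependent (Polynomial k) g ∧
      (∀ j, ∃ i l, g j = (sig q)^[l] (f i)) ∧
      (∃ δ : Polynomial k, δ ≠ 0 ∧ ∃ A : Matrix (Fin n) (Fin n) (Polynomial k),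
        ∀ i, δ • g i = ∑ j, A i j • sig q (g j)) ∧
      (∀ N, ∀ i, ∃ d : Polynomial k, d ≠ 0 ∧ ∃ B : Fin n → Polynomial k,
        d • f i = ∑ j, B j • (sig q)^[N] (g j)) := by
  obtain ⟨n, g, hg, hform, hfW, hsg⟩ := exists_saturating_family q f hf
  have hl := linearIndependent_sig q hg
  obtain ⟨δ, hdet, A, hA⟩ := exists_inverse_system (u := fun j => sig q (g j)) (g := g) hl hsg
  refine ⟨n, g, hg, hform, ⟨δ, hdet, A, hA⟩, ?_⟩
  intro N i
  obtain ⟨d, hd, hx⟩ := satur_span_sig_iterate q hdet hA N (hfW i)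
  rw [Submodule.mem_span_range_iff_exists_fun] at hx
  obtain ⟨B, hB⟩ := hx
  exact ⟨d, hd, B, hB.symm⟩

end Sigma
end Mahler

namespace Mahler
open PowerSeries Finset
open scoped Polynomial

section IntDeg

/-- `w` satisfies a monic equation over `ℂ[X]` with coefficient degrees bounded linearly. -/
def IntDeg {E : Type*} [CommRing E] [Algebra ℂ[X] E] (D : ℕ) (w : E) : Prop :=
  ∃ (m : ℕ) (a : ℕ → ℂ[X]), (∀ i < m, (a i).natDegree ≤ D * (m - i)) ∧
    w ^ m + ∑ i ∈ range m, algebraMap ℂ[X] E (a i) * w ^ i = 0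

theorem exists_intDeg_of_isIntegral {E : Type*} [CommRing E] [Algebra ℂ[X] E] {w : E}
    (hw : IsIntegral ℂ[X] w) : ∃ D, IntDeg D w := by
  obtain ⟨p, hp, h⟩ := hw
  refine ⟨∑ i ∈ range p.natDegree, (p.coeff i).natDegree, p.natDegree, p.coeff, ?_, ?_⟩
  · intro i hi
    calc (p.coeff i).natDegree ≤ ∑ i ∈ range p.natDegree, (p.coeff i).natDegree :=
          Finset.single_le_sum (f := fun i => (p.coeff i).natDegree) (fun _ _ => Nat.zero_le _)
            (Finset.mem_range.mpr hi)
      _ ≤ _ := Nat.le_mul_of_pos_right _ (by omega)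
  · rw [Polynomial.eval₂_eq_sum_range, Finset.sum_range_succ, hp.coeff_natDegree, map_one,
      one_mul, add_comm] at h
    exact h

theorem isIntegral_of_monic_relation {R E : Type*} [CommRing R] [CommRing E] [Algebra R E] {w : E}
    (m : ℕ) (a : ℕ → R) (h : w ^ m + ∑ i ∈ range m, algebraMap R E (a i) * w ^ i = 0) :
    IsIntegral R w := by
  refine ⟨Polynomial.X ^ m + ∑ i ∈ range m, Polynomial.C (a i) * Polynomial.X ^ i, ?_, ?_⟩
  · apply Polynomial.monic_X_pow_add
    refine (Polynomial.degree_sum_le _ _).trans_lt ((Finset.sup_lt_iff (WithBot.bot_lt_coe m)).mpr ?_)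
    intro i hi
    refine (Polynomial.degree_C_mul_X_pow_le _ _).trans_lt ?_
    exact WithBot.coe_lt_coe.mpr (Finset.mem_range.mp hi)
  · simpa [Polynomial.eval₂_finsetSum] using h

theorem IntDeg.isIntegral {E : Type*} [CommRing E] [Algebra ℂ[X] E] {D : ℕ} {w : E}
    (hw : IntDeg D w) : IsIntegral ℂ[X] w := by
  obtain ⟨m, a, -, h⟩ := hw
  exact isIntegral_of_monic_relation m a h

open Classical in
/-- Rational functions of nonpositive degree. -/
abbrev inftyRing : Subring (RatFunc ℂ) := (RatFunc.inftyValuation ℂ).integer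

open Classical in
theorem mem_inftyRing {p : ℂ[X]} {e : ℕ} :
    (RatFunc.X ^ e)⁻¹ * algebraMap ℂ[X] (RatFunc ℂ) p ∈ inftyRing ↔ p.natDegree ≤ e := by
  rw [Valuation.mem_integer_iff]
  by_cases hp : p = 0
  · simp [hp]
  rw [map_mul, map_inv₀, map_pow, RatFunc.inftyValuation.X]
  rw [show (RatFunc.inftyValuation ℂ) (algebraMap ℂ[X] (RatFunc ℂ) p) =
    WithZero.exp (p.natDegree : ℤ) from RatFunc.inftyValuation.polynomial ℂ hp]
  rw [← WithZero.exp_nsmul, ← WithZero.exp_neg, ← WithZero.exp_add, ← WithZero.exp_zero,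
    WithZero.exp_le_exp]
  simp only [nsmul_eq_mul]
  omega

theorem IntDeg.isIntegral_infty {E : Type*} [Field E] [Algebra ℂ[X] E] [Algebra (RatFunc ℂ) E]
    [IsScalarTower ℂ[X] (RatFunc ℂ) E] {D : ℕ} {w : E}
    (hw : IntDeg D w) : IsIntegral inftyRing (algebraMap (RatFunc ℂ) E (RatFunc.X ^ D)⁻¹ * w) := by
  obtain ⟨m, a, ha, h⟩ := hw
  set x : E := algebraMap (RatFunc ℂ) E RatFunc.X with hx
  have hx0 : x ≠ 0 := by
    rw [hx, Ne, _root_.map_eq_zero]; exact RatFunc.X_ne_zero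
  refine isIntegral_of_monic_relation m (fun i => if hi : i < m then
    ⟨(RatFunc.X ^ (D * (m - i)))⁻¹ * algebraMap ℂ[X] (RatFunc ℂ) (a i),
      mem_inftyRing.mpr (ha i hi)⟩ else 0) ?_
  have h2 : (x ^ (D * m))⁻¹ * (w ^ m + ∑ i ∈ range m, algebraMap ℂ[X] E (a i) * w ^ i) = 0 := by
    rw [h, mul_zero]
  rw [← h2, mul_add, Finset.mul_sum, map_inv₀, map_pow, ← hx]
  congr 1
  · rw [mul_pow, inv_pow, ← pow_mul]
  · refine Finset.sum_congr rfl fun i hi => ?_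
    rw [Finset.mem_range] at hi
    rw [dif_pos hi]
    have : algebraMap inftyRing E ⟨(RatFunc.X ^ (D * (m - i)))⁻¹ * algebraMap ℂ[X] (RatFunc ℂ) (a i),
      mem_inftyRing.mpr (ha i hi)⟩ = (x ^ (D * (m - i)))⁻¹ * algebraMap ℂ[X] E (a i) := by
      change algebraMap (RatFunc ℂ) E ((RatFunc.X ^ (D * (m - i)))⁻¹ *
        algebraMap ℂ[X] (RatFunc ℂ) (a i)) = _
      rw [map_mul, map_inv₀, map_pow, ← IsScalarTower.algebraMap_apply]
    rw [this, mul_pow, inv_pow, ← pow_mul]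
    obtain ⟨j, rfl⟩ := Nat.exists_eq_add_of_le hi.le
    rw [Nat.add_sub_cancel_left, Nat.mul_add, pow_add, mul_inv]
    ring

theorem IntDeg.exists_trace_mul {E : Type*} [Field E] [Algebra ℂ[X] E] [Algebra (RatFunc ℂ) E]
    [IsScalarTower ℂ[X] (RatFunc ℂ) E] [FiniteDimensional (RatFunc ℂ) E] {D D' : ℕ} {s t : E}
    (hs : IntDeg D s) (ht : IntDeg D' t) :
    ∃ p : ℂ[X], p.natDegree ≤ D + D' ∧
      algebraMap ℂ[X] (RatFunc ℂ) p = Algebra.trace (RatFunc ℂ) E (s * t) := by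
  have h1 : IsIntegral ℂ[X] (Algebra.trace (RatFunc ℂ) E (s * t)) :=
    Algebra.isIntegral_trace (hs.isIntegral.mul ht.isIntegral)
  obtain ⟨p, hp⟩ := IsIntegrallyClosed.isIntegral_iff.mp h1
  refine ⟨p, ?_, hp⟩
  have h2 := (hs.isIntegral_infty).mul (ht.isIntegral_infty)
  have h3 : IsIntegral inftyRing ((RatFunc.X ^ (D + D'))⁻¹ * algebraMap ℂ[X] (RatFunc ℂ) p) := by
    rw [hp, ← smul_eq_mul (a := ((RatFunc.X : RatFunc ℂ) ^ (D + D'))⁻¹), ← map_smul]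
    apply Algebra.isIntegral_trace
    have : ((RatFunc.X : RatFunc ℂ) ^ (D + D'))⁻¹ • (s * t) = algebraMap (RatFunc ℂ) E (RatFunc.X ^ D)⁻¹ * s *
        (algebraMap (RatFunc ℂ) E (RatFunc.X ^ D')⁻¹ * t) := by
      rw [Algebra.smul_def, pow_add, mul_inv, map_mul]
      ring
    rw [this]
    exact h2
  classical
  exact mem_inftyRing.mp
    (Valuation.Integers.mem_of_integral (Valuation.integer.integers (RatFunc.inftyValuation ℂ)) h3)

end IntDeg
end Mahler

namespace Mahler
open PowerSeries Finset
open scoped Polynomial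

section Rotation
variable {P : Type*} [Field P] [Algebra ℂ⟦X⟧ P] [IsFractionRing ℂ⟦X⟧ P] [Algebra ℂ[X] P]
  [IsScalarTower ℂ[X] ℂ⟦X⟧ P] [Algebra (RatFunc ℂ) P] [IsScalarTower ℂ[X] (RatFunc ℂ) P]
  [Algebra ℂ P] [IsScalarTower ℂ ℂ⟦X⟧ P]

theorem rescale_injective (ζ : ℂˣ) : Function.Injective (rescale (ζ : ℂ)) := by
  intro f g h
  ext n
  have := congrArg (coeff n) h
  simpa [coeff_rescale] using this

/-- The automorphism `z ↦ ζ z` of the field of Laurent series. -/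
def rot (ζ : ℂˣ) : P →+* P :=
  IsFractionRing.map (A := ℂ⟦X⟧) (B := ℂ⟦X⟧) (j := rescale (ζ : ℂ)) (rescale_injective ζ)

theorem rot_algebraMap (ζ : ℂˣ) (f : ℂ⟦X⟧) :
    rot ζ (algebraMap ℂ⟦X⟧ P f) = algebraMap ℂ⟦X⟧ P (rescale (ζ : ℂ) f) := by
  simp [rot, IsFractionRing.map]

theorem rescale_coe (ζ : ℂ) (p : ℂ[X]) :
    rescale ζ (p : ℂ⟦X⟧) = (p.comp (Polynomial.C ζ * Polynomial.X) : ℂ[X]) := by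
  ext n
  rw [coeff_rescale, Polynomial.coeff_coe, Polynomial.coeff_coe, Polynomial.comp_C_mul_X_coeff,
    mul_comm]

theorem algebraMap_poly (p : ℂ[X]) : algebraMap ℂ[X] P p = algebraMap ℂ⟦X⟧ P (p : ℂ⟦X⟧) :=
  IsScalarTower.algebraMap_apply ℂ[X] ℂ⟦X⟧ P p

theorem rot_poly (ζ : ℂˣ) (p : ℂ[X]) : rot ζ (algebraMap ℂ[X] P p) =
    algebraMap ℂ[X] P (p.comp (Polynomial.C (ζ : ℂ) * Polynomial.X)) := by
  rw [algebraMap_poly, rot_algebraMap, rescale_coe, algebraMap_poly]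

theorem IntDeg.rot {D : ℕ} {w : P} (hw : IntDeg D w) (ζ : ℂˣ) : IntDeg D (rot ζ w) := by
  obtain ⟨m, a, ha, h⟩ := hw
  refine ⟨m, fun i => (a i).comp (Polynomial.C (ζ : ℂ) * Polynomial.X), fun i hi => ?_, ?_⟩
  · refine Polynomial.natDegree_comp_le.trans ?_
    calc (a i).natDegree * (Polynomial.C (ζ : ℂ) * Polynomial.X).natDegree
        ≤ (a i).natDegree * 1 := Nat.mul_le_mul_left _ (by
          simp)
      _ ≤ _ := by rw [mul_one]; exact ha i hi
  · have := congrArg (Mahler.rot ζ) h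
    rw [map_zero, map_add, map_sum, map_pow] at this
    simpa only [map_mul, map_pow, rot_poly] using this

theorem finite_support_of_finiteDimensional (U : Submodule ℂ ℂ⟦X⟧) [FiniteDimensional ℂ U]
    (u : ℂ⟦X⟧) (Z : Set ℂˣ) (hZ : Z.Infinite) (h : ∀ ζ ∈ Z, rescale (ζ : ℂ) u ∈ U) :
    ∃ p : ℂ[X], (p : ℂ⟦X⟧) = u := by
  let c : {m // coeff m u ≠ 0} → Module.Dual ℂ U := fun m => (coeff (m : ℕ)).comp U.subtype
  have hc : LinearIndependent ℂ c := by
    rw [linearIndependent_iff']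
    intro s l hl i hi
    let Q : ℂ[X] := ∑ m ∈ s, Polynomial.C (l m * coeff (m : ℕ) u) * Polynomial.X ^ (m : ℕ)
    have hQ : Q = 0 := by
      apply Polynomial.eq_zero_of_infinite_isRoot
      refine (hZ.image (f := fun ζ : ℂˣ => (ζ : ℂ)) (Units.val_injective.injOn)).mono ?_
      rintro _ ⟨ζ, hζ, rfl⟩
      have := congrArg (fun φ : Module.Dual ℂ U => φ ⟨_, h ζ hζ⟩) hl
      simp only [c, LinearMap.sum_apply, LinearMap.smul_apply, LinearMap.comp_apply,
        Submodule.subtype_apply, coeff_rescale, LinearMap.zero_apply, smul_eq_mul] at this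
      simp only [Q, Set.mem_ofPred_eq, Polynomial.IsRoot, Polynomial.eval_finsetSum,
        Polynomial.eval_mul, Polynomial.eval_C, Polynomial.eval_pow, Polynomial.eval_X]
      refine Eq.trans ?_ this
      exact Finset.sum_congr rfl fun m _ => by ring
    have hco := congrArg (fun Q : ℂ[X] => Q.coeff (i : ℕ)) hQ
    simp only [Q, Polynomial.finsetSum_coeff, Polynomial.coeff_C_mul_X_pow,
      Polynomial.coeff_zero] at hco
    rw [Finset.sum_eq_single i] at hco
    · simpa [i.2] using hco
    · intro b _ hb
      rw [if_neg]
      exact fun h => hb (Subtype.ext h.symm)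
    · exact fun h => absurd hi h
  have hfin : Set.Finite {m | coeff m u ≠ 0} := hc.finite
  obtain ⟨N, hN⟩ := hfin.bddAbove
  refine ⟨trunc (N + 1) u, ?_⟩
  ext m
  rw [Polynomial.coeff_coe, coeff_trunc]
  split_ifs with hm
  · rfl
  · by_contra hne
    have : m ≤ N := hN (fun h => hne h.symm)
    omega

theorem exists_mul_intDeg {E : Type*} [Field E] [Algebra ℂ[X] E] [Algebra (RatFunc ℂ) E]
    [IsScalarTower ℂ[X] (RatFunc ℂ) E] {w : E} (hw : IsAlgebraic (RatFunc ℂ) w) :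
    ∃ b : ℂ[X], b ≠ 0 ∧ ∃ D, IntDeg D (algebraMap ℂ[X] E b * w) := by
  have hw' : IsAlgebraic ℂ[X] w := (IsFractionRing.isAlgebraic_iff ℂ[X] (RatFunc ℂ) E).mpr hw
  obtain ⟨b, hb, hInt⟩ := hw'.exists_integral_multiple
  rw [Algebra.smul_def] at hInt
  exact ⟨b, hb, exists_intDeg_of_isIntegral hInt⟩

theorem exists_finiteDimensional_of_intDeg (E : IntermediateField (RatFunc ℂ) P)
    [FiniteDimensional (RatFunc ℂ) E] (D : ℕ) :
    ∃ U : Submodule ℂ P, FiniteDimensional ℂ U ∧ ∀ w ∈ E, IntDeg D w → w ∈ U := by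
  classical
  let e := Module.finBasis (RatFunc ℂ) E
  choose c hc D' hD' using fun i => exists_mul_intDeg (Algebra.IsAlgebraic.isAlgebraic (R := RatFunc ℂ) (e i))
  let F : (Σ i, Fin (D + D' i + 1)) → P := fun x => algebraMap (RatFunc ℂ) P
    ((algebraMap ℂ[X] (RatFunc ℂ) (c x.1))⁻¹ * RatFunc.X ^ (x.2 : ℕ)) * (e.traceDual x.1 : P)
  refine ⟨Submodule.span ℂ (Set.range F), FiniteDimensional.span_of_finite ℂ (Set.finite_range F), ?_⟩
  intro w hwE hw
  have hwI : IntDeg D (⟨w, hwE⟩ : E) := by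
    obtain ⟨m, a, ha, h⟩ := hw
    refine ⟨m, a, ha, ?_⟩
    apply (algebraMap E P).injective
    rw [map_zero, ← h, map_add, map_sum, map_pow]
    rfl
  have hexp : (⟨w, hwE⟩ : E) = ∑ i, Algebra.trace (RatFunc ℂ) E (⟨w, hwE⟩ * e i) • e.traceDual i := by
    conv_lhs => rw [← e.traceDual.sum_repr ⟨w, hwE⟩]
    simp only [Module.Basis.traceDual_repr_apply, Algebra.traceForm_apply]
  have hw2 : w = ∑ i, algebraMap (RatFunc ℂ) P (Algebra.trace (RatFunc ℂ) E (⟨w, hwE⟩ * e i)) *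
      (e.traceDual i : P) := by
    have := congrArg (algebraMap E P) hexp
    rw [map_sum] at this
    simp only [Algebra.smul_def, map_mul, ← IsScalarTower.algebraMap_apply] at this
    exact this
  rw [hw2]
  refine Submodule.sum_mem _ fun i _ => ?_
  obtain ⟨p, hp, hpt⟩ := hwI.exists_trace_mul (hD' i)
  have hc0 : algebraMap ℂ[X] (RatFunc ℂ) (c i) ≠ 0 := by
    simpa using hc i
  have htr : Algebra.trace (RatFunc ℂ) E (⟨w, hwE⟩ * e i) =
      (algebraMap ℂ[X] (RatFunc ℂ) (c i))⁻¹ * algebraMap ℂ[X] (RatFunc ℂ) p := by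
    rw [hpt, IsScalarTower.algebraMap_apply ℂ[X] (RatFunc ℂ) E, mul_left_comm,
      ← Algebra.smul_def, map_smul, smul_eq_mul, inv_mul_cancel_left₀ hc0]
  rw [htr, Polynomial.as_sum_range_C_mul_X_pow' p (show p.natDegree < D + D' i + 1 by omega), map_sum,
    Finset.mul_sum, map_sum, Finset.sum_mul]
  refine Submodule.sum_mem _ fun m hm => ?_
  have hCc : ∀ z : ℂ, algebraMap (RatFunc ℂ) P (algebraMap ℂ[X] (RatFunc ℂ) (Polynomial.C z)) =
      algebraMap ℂ P z := by
    intro z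
    rw [← IsScalarTower.algebraMap_apply, algebraMap_poly, IsScalarTower.algebraMap_apply ℂ ℂ⟦X⟧ P,
      Polynomial.coe_C]
    rfl
  have : algebraMap (RatFunc ℂ) P ((algebraMap ℂ[X] (RatFunc ℂ) (c i))⁻¹ *
      algebraMap ℂ[X] (RatFunc ℂ) (Polynomial.C (p.coeff m) * Polynomial.X ^ m)) *
      (e.traceDual i : P) = p.coeff m • F ⟨i, ⟨m, Finset.mem_range.mp hm⟩⟩ := by
    simp only [F, Algebra.smul_def, map_mul, map_pow, RatFunc.algebraMap_X, hCc]
    ring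
  rw [this]
  exact Submodule.smul_mem _ _ (Submodule.subset_span ⟨_, rfl⟩)

theorem rational_of_rot_mem (E : IntermediateField (RatFunc ℂ) P) [FiniteDimensional (RatFunc ℂ) E]
    (f : P) (hf : IsAlgebraic (RatFunc ℂ) f) (Z : Set ℂˣ) (hZ : Z.Infinite)
    (h : ∀ ζ ∈ Z, rot ζ f ∈ E) : ∃ x : RatFunc ℂ, algebraMap (RatFunc ℂ) P x = f := by
  obtain ⟨b, hb, D, hD⟩ := exists_mul_intDeg hf
  obtain ⟨u, hu⟩ : ∃ u : ℂ⟦X⟧, algebraMap ℂ⟦X⟧ P u = algebraMap ℂ[X] P b * f :=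
    IsIntegrallyClosed.isIntegral_iff.mp (hD.isIntegral.tower_top)
  obtain ⟨U, hU, hmem⟩ := exists_finiteDimensional_of_intDeg E D
  let φ : ℂ⟦X⟧ →ₗ[ℂ] P := (IsScalarTower.toAlgHom ℂ ℂ⟦X⟧ P).toLinearMap
  have hφ : ∀ x, φ x = algebraMap ℂ⟦X⟧ P x := fun x => rfl
  have : FiniteDimensional ℂ (U.comap φ) := by
    let ψ : U.comap φ →ₗ[ℂ] U := (φ.comp (U.comap φ).subtype).codRestrict U (fun x => x.2)
    refine FiniteDimensional.of_injective ψ ?_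
    intro x y hxy
    have h1 : algebraMap ℂ⟦X⟧ P x = algebraMap ℂ⟦X⟧ P y := congrArg Subtype.val hxy
    exact Subtype.ext (IsFractionRing.injective ℂ⟦X⟧ P h1)
  obtain ⟨p, hp⟩ := finite_support_of_finiteDimensional (U.comap φ) u Z hZ (by
    intro ζ hζ
    rw [Submodule.mem_comap, hφ, ← rot_algebraMap]
    refine hmem _ ?_ ?_
    · rw [hu, map_mul, rot_poly, IsScalarTower.algebraMap_apply ℂ[X] (RatFunc ℂ) P]
      exact E.mul_mem (E.algebraMap_mem _) (h ζ hζ)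
    · rw [hu]
      exact hD.rot ζ)
  have hb0 : algebraMap (RatFunc ℂ) P (algebraMap ℂ[X] (RatFunc ℂ) b) ≠ 0 := by
    simpa using hb
  refine ⟨algebraMap ℂ[X] (RatFunc ℂ) p / algebraMap ℂ[X] (RatFunc ℂ) b, ?_⟩
  rw [map_div₀, div_eq_iff hb0, ← IsScalarTower.algebraMap_apply, ← IsScalarTower.algebraMap_apply,
    algebraMap_poly, hp, hu, mul_comm]

end Rotation
end Mahler

namespace Mahler
open PowerSeries Finset
open scoped Polynomial

theorem map_coordinates_mem {P F ι κ : Type*} [Field P] [Field F] [Algebra F P] [Fintype ι]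
    [Fintype κ] [DecidableEq κ] {E Q : IntermediateField F P} (hEQ : E ≤ Q) (ρ : P →+* P)
    {g : ι → P} {a : κ → ι} {m : ι → κ → P} {C : ι → ι → P}
    (hu : ∀ v : κ → P, (∀ s, v s ∈ Q) → ∑ s, v s * g (a s) = 0 → v = 0)
    (hρu : ∀ v : κ → P, (∀ s, v s ∈ Q) → ∑ s, v s * ρ (g (a s)) = 0 → v = 0)
    (hm : ∀ i s, m i s ∈ E) (hC : ∀ i j, C i j ∈ E) (hρm : ∀ i s, ρ (m i s) ∈ Q)
    (hg : ∀ i, g i = ∑ s, m i s * g (a s)) (hρg : ∀ i, ρ (g i) = ∑ j, C i j * g j) (i : ι) (s : κ) :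
    ρ (m i s) ∈ E := by
  let x : ι → κ → E := fun i s => ⟨∑ j, C i j * m j s,
    sum_mem fun j _ => mul_mem (hC i j) (hm j s)⟩
  have hx : ∀ i, ρ (g i) = ∑ s, (x i s : P) * g (a s) := by
    intro i
    rw [hρg]
    simp only [x, Finset.sum_mul]
    rw [Finset.sum_comm]
    refine Finset.sum_congr rfl fun j _ => ?_
    conv_lhs => rw [hg j]
    rw [Finset.mul_sum]
    exact Finset.sum_congr rfl fun s _ => by ring
  let Y : Matrix κ κ E := Matrix.of fun s t => x (a s) t
  have hY : Y.det ≠ 0 := by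
    intro h0
    obtain ⟨v, hv, hvY⟩ := Matrix.exists_vecMul_eq_zero_iff.mpr h0
    apply hv
    have := hρu (fun s => (v s : P)) (fun s => hEQ (v s).2) (by
      simp only [hx, Finset.mul_sum]
      rw [Finset.sum_comm]
      refine Finset.sum_eq_zero fun t _ => ?_
      have := congrArg (fun e : E => (e : P)) (congrFun hvY t)
      simp only [Matrix.vecMul, dotProduct, Y, Matrix.of_apply, Pi.zero_apply,
        ZeroMemClass.coe_zero, AddSubmonoidClass.coe_finsetSum, MulMemClass.coe_mul] at this
      rw [← zero_mul (g (a t)), ← this, Finset.sum_mul]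
      exact Finset.sum_congr rfl fun s _ => by ring)
    funext s
    exact Subtype.ext (congrFun this s)
  have hrel : ∀ t, ∑ s, ρ (m i s) * (Y s t : P) = x i t := by
    intro t
    have := hu (fun t => ∑ s, ρ (m i s) * (Y s t : P) - x i t)
      (fun t => sub_mem (sum_mem fun s _ => mul_mem (hρm i s) (hEQ (Y s t).2)) (hEQ (x i t).2)) (by
        simp only [sub_mul, Finset.sum_sub_distrib, ← hx]
        conv_lhs => rw [hg i]
        rw [map_sum, sub_eq_zero]
        simp only [map_mul, hx, Finset.mul_sum, Finset.sum_mul]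
        rw [Finset.sum_comm]
        refine Finset.sum_congr rfl fun s _ => Finset.sum_congr rfl fun t _ => ?_
        simp only [Y, Matrix.of_apply]; ring)
    exact sub_eq_zero.mp (congrFun this t)
  have hinv : Y * Y⁻¹ = 1 := Matrix.mul_nonsing_inv _ (isUnit_iff_ne_zero.mpr hY)
  have : ρ (m i s) = ∑ t, (x i t : P) * (Y⁻¹ t s : E) := by
    simp only [← hrel, Finset.sum_mul]
    rw [Finset.sum_comm, Finset.sum_eq_single s]
    · have := congrArg (fun e : E => (e : P)) (congrFun (congrFun hinv s) s)
      simp only [Matrix.mul_apply, Matrix.one_apply_eq, AddSubmonoidClass.coe_finsetSum,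
        MulMemClass.coe_mul, OneMemClass.coe_one] at this
      rw [← mul_one (ρ (m i s))]
      conv_lhs => rw [← this]
      rw [Finset.mul_sum]
      exact Finset.sum_congr rfl fun t _ => by ring
    · intro s' _ hs'
      have := congrArg (fun e : E => (e : P)) (congrFun (congrFun hinv s') s)
      simp only [Matrix.mul_apply, Matrix.one_apply_ne hs', AddSubmonoidClass.coe_finsetSum,
        MulMemClass.coe_mul, ZeroMemClass.coe_zero] at this
      simp only [mul_assoc]
      rw [← Finset.mul_sum, this, mul_zero]
    · simp
  rw [this]
  exact sum_mem fun t _ => mul_mem (x i t).2 (Y⁻¹ t s).2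

section Rotation
variable {P : Type*} [Field P] [Algebra ℂ⟦X⟧ P] [IsFractionRing ℂ⟦X⟧ P] [Algebra ℂ[X] P]
  [IsScalarTower ℂ[X] ℂ⟦X⟧ P] [Algebra (RatFunc ℂ) P] [IsScalarTower ℂ[X] (RatFunc ℂ) P]
  [Algebra ℂ P] [IsScalarTower ℂ ℂ⟦X⟧ P]

theorem isAlgebraic_rot {x : P} (hx : IsAlgebraic (RatFunc ℂ) x) (ζ : ℂˣ) :
    IsAlgebraic (RatFunc ℂ) (rot ζ x) := by
  rw [← IsFractionRing.isAlgebraic_iff ℂ[X] (RatFunc ℂ) P] at hx ⊢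
  refine hx.ringHom_of_comp_eq
    (Polynomial.compRingHom (Polynomial.C (ζ : ℂ) * Polynomial.X)) (rot ζ) ?_ ?_
  · intro p p' h
    ext n
    have := congrArg (fun p : ℂ[X] => p.coeff n) h
    simpa [Polynomial.comp_C_mul_X_coeff] using this
  · ext p
    · simp [rot_poly]
    · simp [rot_poly]

theorem rot_inv_rot (ζ : ℂˣ) (x : P) : rot ζ⁻¹ (rot ζ x) = x := by
  obtain ⟨a, b, _, rfl⟩ := IsFractionRing.div_surjective (A := ℂ⟦X⟧) x
  have : ∀ f : ℂ⟦X⟧, rescale ((ζ⁻¹ : ℂˣ) : ℂ) (rescale (ζ : ℂ) f) = f := fun f => by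
    ext n; simp [coeff_rescale]
  rw [map_div₀, map_div₀]
  simp only [rot_algebraMap, this]

theorem rescale_sig_iterate (q : ℕ) [NeZero q] (N : ℕ) {ζ : ℂ} (hζ : ζ ^ q ^ N = 1) (f : ℂ⟦X⟧) :
    rescale ζ ((sig q)^[N] f) = (sig q)^[N] f := by
  ext n
  rw [coeff_rescale, coeff_sig_iterate]
  split_ifs with h
  · obtain ⟨d, rfl⟩ := h
    rw [pow_mul, hζ, one_pow, one_mul]
  · simp

theorem exists_rot_eq (q : ℕ) [NeZero q] {n : ℕ} {g : Fin n → ℂ⟦X⟧}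
    (hg : LinearIndependent ℂ[X] g) {δ : ℂ[X]} (hδ : δ ≠ 0) {A : Matrix (Fin n) (Fin n) ℂ[X]}
    (hA : ∀ i, δ • g i = ∑ j, A i j • sig q (g j)) (N : ℕ) {ζ : ℂˣ} (hζ : (ζ : ℂ) ^ q ^ N = 1)
    (i : Fin n) : ∃ C : Fin n → RatFunc ℂ,
      rot ζ (algebraMap ℂ⟦X⟧ P (g i)) =
        ∑ j, algebraMap (RatFunc ℂ) P (C j) * algebraMap ℂ⟦X⟧ P (g j) := by
  have hsat : ∀ i, g i ∈ satur (Submodule.span ℂ[X] (Set.range fun j => (sig q)^[N] (g j))) :=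
    fun i => satur_span_sig_iterate q hδ hA N
      ⟨1, one_ne_zero, by rw [one_smul]; exact Submodule.subset_span ⟨i, rfl⟩⟩
  obtain ⟨d, hd, U, hU⟩ := exists_common_denominator hsat
  obtain ⟨e, he, V, hV⟩ := exists_inverse_system (u := g) (g := fun j => (sig q)^[N] (g j)) hg hsat
  let r : ℂ[X] → ℂ[X] := fun p => p.comp (Polynomial.C (ζ : ℂ) * Polynomial.X)
  let ι := algebraMap ℂ⟦X⟧ P
  have hinj : Function.Injective ι := IsFractionRing.injective _ _
  have hr0 : ι (r d : ℂ⟦X⟧) ≠ 0 := by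
    have h1 : ι (r d : ℂ⟦X⟧) = rot ζ (ι (d : ℂ⟦X⟧)) := by
      simp only [ι, rot_algebraMap, rescale_coe, r]
    rw [h1]
    simpa [map_eq_zero_iff ι hinj] using hd
  have he0 : ι (e : ℂ⟦X⟧) ≠ 0 := by simpa [map_eq_zero_iff ι hinj] using he
  have hU' : ι (r d : ℂ⟦X⟧) * rot ζ (ι (g i)) =
      ∑ l, ι (r (U i l) : ℂ⟦X⟧) * ι ((sig q)^[N] (g l)) := by
    have := congrArg (fun f => ι (rescale (ζ : ℂ) f)) (hU i)
    simp only [poly_smul_eq, map_sum, map_mul, rescale_coe, rescale_sig_iterate q N hζ] at this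
    rw [rot_algebraMap]
    exact this
  have hV' : ∀ l, ι (e : ℂ⟦X⟧) * ι ((sig q)^[N] (g l)) = ∑ j, ι (V l j : ℂ⟦X⟧) * ι (g j) := by
    intro l
    have := congrArg ι (hV l)
    simpa only [poly_smul_eq, map_sum, map_mul] using this
  have hal : ∀ p : ℂ[X], algebraMap (RatFunc ℂ) P (algebraMap ℂ[X] (RatFunc ℂ) p) =
      ι (p : ℂ⟦X⟧) := fun p => by
    rw [← IsScalarTower.algebraMap_apply, algebraMap_poly]
  refine ⟨fun j => (∑ l, algebraMap ℂ[X] (RatFunc ℂ) (r (U i l) * V l j)) /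
    algebraMap ℂ[X] (RatFunc ℂ) (r d * e), ?_⟩
  simp only [map_div₀, map_sum, hal, map_mul]
  rw [← mul_right_inj' (mul_ne_zero hr0 he0), Finset.mul_sum]
  calc ι (r d : ℂ⟦X⟧) * ι (e : ℂ⟦X⟧) * rot ζ (ι (g i))
      = ∑ l, ι (r (U i l) : ℂ⟦X⟧) * (ι (e : ℂ⟦X⟧) * ι ((sig q)^[N] (g l))) := by
        rw [mul_right_comm, hU', Finset.sum_mul]
        exact Finset.sum_congr rfl fun l _ => by ring
    _ = _ := by
        simp only [hV', Finset.mul_sum]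
        rw [Finset.sum_comm]
        refine Finset.sum_congr rfl fun j _ => ?_
        field_simp
        exact (Finset.sum_mul _ _ _).symm

theorem infinite_roots_of_unity (q : ℕ) (hq : 2 ≤ q) :
    {ζ : ℂˣ | ∃ N : ℕ, (ζ : ℂ) ^ q ^ N = 1}.Infinite := by
  have h : ∀ N : ℕ, ∃ ζ : ℂˣ, IsPrimitiveRoot ζ (q ^ N) := fun N => by
    have hp := Complex.isPrimitiveRoot_exp (q ^ N) (by positivity)
    exact ⟨(hp.isUnit (by positivity)).unit, hp.isUnit_unit (by positivity)⟩
  choose z hz using h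
  refine Set.infinite_of_injective_forall_mem (f := z) (fun a b hab => ?_) (fun N => ⟨N, ?_⟩)
  · have := (hz a).unique (hab ▸ hz b)
    exact Nat.pow_right_injective hq this
  · have := (hz N).pow_eq_one
    rw [← Units.val_pow_eq_pow_val, this, Units.val_one]

/-- Solutions of a Mahler system that are linearly independent over polynomials remain so over
algebraic functions. -/
theorem eq_zero_of_algebraic_relation (q : ℕ) [NeZero q] (hq : 2 ≤ q) {n : ℕ} {g : Fin n → ℂ⟦X⟧}
    (hg : LinearIndependent ℂ[X] g) {δ : ℂ[X]} (hδ : δ ≠ 0) {A : Matrix (Fin n) (Fin n) ℂ[X]}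
    (hA : ∀ i, δ • g i = ∑ j, A i j • sig q (g j)) (z : Fin n → P)
    (hz : ∀ j, IsAlgebraic (RatFunc ℂ) (z j))
    (h : ∑ j, z j * algebraMap ℂ⟦X⟧ P (g j) = 0) : z = 0 := by
  classical
  let Q : IntermediateField (RatFunc ℂ) P := algebraicClosure (RatFunc ℂ) P
  have hQ : ∀ x, x ∈ Q ↔ IsAlgebraic (RatFunc ℂ) x := fun x => mem_algebraicClosure_iff
  let u : Fin n → P := fun j => algebraMap ℂ⟦X⟧ P (g j)
  obtain ⟨κ, a, ha, hspan, hind⟩ := exists_linearIndependent' Q u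
  have : Finite κ := Finite.of_injective a ha
  have := Fintype.ofFinite κ
  have hu : ∀ v : κ → P, (∀ s, v s ∈ Q) → ∑ s, v s * u (a s) = 0 → v = 0 := by
    intro v hv h0
    have := Fintype.linearIndependent_iff.mp hind (fun s => ⟨v s, hv s⟩) h0
    funext s
    exact congrArg Subtype.val (this s)
  have hm : ∀ i, ∃ m : κ → Q, ∑ s, m s • u (a s) = u i := fun i =>
    (Submodule.mem_span_range_iff_exists_fun Q).mp (by
      have : u i ∈ Submodule.span Q (Set.range u) := Submodule.subset_span ⟨i, rfl⟩
      rwa [← hspan] at this)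
  choose m hm using hm
  let E : IntermediateField (RatFunc ℂ) P :=
    IntermediateField.adjoin (RatFunc ℂ) (Set.range fun x : Fin n × κ => (m x.1 x.2 : P))
  have hmE : ∀ i s, (m i s : P) ∈ E := fun i s =>
    IntermediateField.subset_adjoin _ _ ⟨(i, s), rfl⟩
  have hEfin : FiniteDimensional (RatFunc ℂ) E := by
    apply IntermediateField.finiteDimensional_adjoin
    rintro _ ⟨x, rfl⟩
    exact ((hQ _).mp (m x.1 x.2).2).isIntegral
  have hEQ : E ≤ Q := by
    rw [IntermediateField.adjoin_le_iff]
    rintro _ ⟨x, rfl⟩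
    exact (m x.1 x.2).2
  have hrat : ∀ i s, ∃ x, algebraMap (RatFunc ℂ) P x = m i s := by
    intro i s
    refine rational_of_rot_mem E (m i s : P) ((hQ _).mp (m i s).2) _
      (infinite_roots_of_unity q hq) ?_
    rintro ζ ⟨N, hζ⟩
    choose C hC using exists_rot_eq (P := P) q hg hδ hA N hζ
    refine map_coordinates_mem (g := u) (a := a) (m := fun i s => (m i s : P)) hEQ (rot ζ) hu ?_
      hmE (C := fun i j => algebraMap (RatFunc ℂ) P (C i j)) (fun i j => E.algebraMap_mem _)
      (fun i s => (hQ _).mpr (isAlgebraic_rot ((hQ _).mp (m i s).2) ζ))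
      (fun i => (hm i).symm) hC i s
    intro v hv h0
    have h1 := hu (fun s => rot ζ⁻¹ (v s))
      (fun s => (hQ _).mpr (isAlgebraic_rot ((hQ _).mp (hv s)) _)) (by
        have := congrArg (rot ζ⁻¹) h0
        simpa only [map_sum, map_mul, rot_inv_rot, map_zero] using this)
    funext s
    exact (map_eq_zero_iff (rot ζ⁻¹) (rot ζ⁻¹ : P →+* P).injective).mp (congrFun h1 s)
  choose x hx using hrat
  have hgR : LinearIndependent (RatFunc ℂ) u := by
    rw [← LinearIndependent.iff_fractionRing ℂ[X] (RatFunc ℂ)]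
    have hinj : Function.Injective (IsScalarTower.toAlgHom ℂ[X] ℂ⟦X⟧ P) :=
      IsFractionRing.injective ℂ⟦X⟧ P
    exact hg.map' (IsScalarTower.toAlgHom ℂ[X] ℂ⟦X⟧ P).toLinearMap
      (LinearMap.ker_eq_bot.mpr hinj)
  have hsurj : Function.Surjective a := by
    intro i
    by_contra hi
    have h0 : ∑ j, ((if j = i then (1 : RatFunc ℂ) else 0) - ∑ s, if a s = j then x i s else 0) •
        u j = 0 := by
      simp only [sub_smul, Finset.sum_sub_distrib, ite_smul, one_smul, zero_smul,
        Finset.sum_ite_eq', Finset.mem_univ, if_true, Finset.sum_smul]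
      rw [Finset.sum_comm]
      simp only [Finset.sum_ite_eq, Finset.mem_univ, if_true, Algebra.smul_def, hx]
      rw [sub_eq_zero]
      exact (hm i).symm
    have := Fintype.linearIndependent_iff.mp hgR _ h0 i
    rw [if_pos rfl, Finset.sum_eq_zero (fun s _ => if_neg fun h => hi ⟨s, h⟩), sub_zero] at this
    exact one_ne_zero this
  have hfin := hu (fun s => z (a s)) (fun s => (hQ _).mpr (hz _)) (by
    rw [← h]
    exact (Equiv.ofBijective a ⟨ha, hsurj⟩).sum_comp (fun j => z j * u j))
  funext j
  obtain ⟨s, rfl⟩ := hsurj j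
  exact congrFun hfin s

end Rotation
end Mahler

namespace Mahler
open PowerSeries Finset
open scoped Polynomial

section Rotation
variable {P : Type*} [Field P] [Algebra ℂ⟦X⟧ P] [IsFractionRing ℂ⟦X⟧ P] [Algebra ℂ[X] P]
  [IsScalarTower ℂ[X] ℂ⟦X⟧ P] [Algebra (RatFunc ℂ) P] [IsScalarTower ℂ[X] (RatFunc ℂ) P]
  [Algebra ℂ P] [IsScalarTower ℂ ℂ⟦X⟧ P]

theorem no_integral_relation (q : ℕ) [NeZero q] (hq : 2 ≤ q) {n : ℕ} {g : Fin n → ℂ⟦X⟧}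
    (hg : LinearIndependent ℂ[X] g) {δ : ℂ[X]} (hδ : δ ≠ 0) {A : Matrix (Fin n) (Fin n) ℂ[X]}
    (hA : ∀ i, δ • g i = ∑ j, A i j • sig q (g j)) {P' : Type*} [Field P'] [Algebra P P']
    [FiniteDimensional P P'] (y : Fin n → P') (χ : Fin n → ℂ[X][X]) (hχ : ∀ j, (χ j).Monic)
    (hy : ∀ j, (χ j).eval₂ ((algebraMap P P').comp (algebraMap ℂ[X] P)) (y j) = 0) (j₀ : Fin n)
    (hj₀ : (χ j₀).coeff 0 ≠ 0) (h : ∑ j, algebraMap P P' (algebraMap ℂ⟦X⟧ P (g j)) * y j = 0) :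
    False := by
  let _ : Algebra ℂ[X] P' := ((algebraMap P P').comp (algebraMap ℂ[X] P)).toAlgebra
  have : IsScalarTower ℂ[X] P P' := IsScalarTower.of_algebraMap_eq fun _ => rfl
  have hyint : ∀ j, IsIntegral ℂ[X] (y j) := fun j => ⟨χ j, hχ j, hy j⟩
  let w : P' := -Polynomial.aeval (y j₀) (χ j₀).divX
  have hw : y j₀ * w = algebraMap ℂ[X] P' ((χ j₀).coeff 0) := by
    have h1 : Polynomial.aeval (y j₀) (χ j₀) = 0 := hy j₀
    rw [← Polynomial.divX_mul_X_add (χ j₀)] at h1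
    simp only [map_add, map_mul, Polynomial.aeval_X, Polynomial.aeval_C] at h1
    simp only [w]
    linear_combination -h1
  have hwint : IsIntegral ℂ[X] w := by
    refine IsIntegral.neg ?_
    have : Polynomial.aeval (y j₀) (χ j₀).divX ∈ integralClosure ℂ[X] P' := by
      rw [Polynomial.aeval_eq_sum_range]
      exact sum_mem fun i _ => Subalgebra.smul_mem _ (pow_mem (hyint j₀) _) _
    exact this
  have hz := eq_zero_of_algebraic_relation (P := P) q hq hg hδ hA
    (fun j => Algebra.trace P P' (y j * w)) (fun j => by
      have : IsIntegral ℂ[X] (Algebra.trace P P' (y j * w)) :=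
        Algebra.isIntegral_trace ((hyint j).mul hwint)
      exact (IsFractionRing.isAlgebraic_iff ℂ[X] (RatFunc ℂ) P).mp this.isAlgebraic) (by
      have := congrArg (fun x => Algebra.trace P P' (x * w)) h
      simp only [zero_mul, map_zero, Finset.sum_mul, map_sum] at this
      rw [← this]
      refine Finset.sum_congr rfl fun j _ => ?_
      rw [mul_assoc, ← Algebra.smul_def, map_smul, smul_eq_mul, mul_comm])
  have h0 := congrFun hz j₀
  rw [hw, IsScalarTower.algebraMap_apply ℂ[X] P P', Algebra.trace_algebraMap, Pi.zero_apply,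
    nsmul_eq_mul, mul_eq_zero] at h0
  rcases h0 with h0 | h0
  · have : CharZero P := charZero_of_injective_algebraMap (FaithfulSMul.algebraMap_injective ℂ P)
    exact (Module.finrank_pos (R := P) (M := P')).ne' (Nat.cast_eq_zero.mp h0)
  · rw [algebraMap_poly, map_eq_zero_iff _ (IsFractionRing.injective ℂ⟦X⟧ P)] at h0
    exact hj₀ (by simpa using h0)

open scoped IsMulCommutative in
theorem det_sum_ne_zero_aux (q : ℕ) [NeZero q] (hq : 2 ≤ q) {n : ℕ} {g : Fin n → ℂ⟦X⟧}
    (hg : LinearIndependent ℂ[X] g) {δ : ℂ[X]} (hδ : δ ≠ 0) {A : Matrix (Fin n) (Fin n) ℂ[X]}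
    (hA : ∀ i, δ • g i = ∑ j, A i j • sig q (g j)) {m : ℕ}
    (Y : Fin n → Matrix (Fin m) (Fin m) ℂ[X]) (hcomm : ∀ i j, Y i * Y j = Y j * Y i)
    (j₀ : Fin n) (hdet : (Y j₀).det ≠ 0) :
    (∑ j, algebraMap ℂ⟦X⟧ P (g j) • (Y j).map (algebraMap ℂ[X] P)).det ≠ 0 := by
  intro h0
  let YP : Fin n → Matrix (Fin m) (Fin m) P := fun j => (Y j).map (algebraMap ℂ[X] P)
  have hYP : ∀ a ∈ Set.range YP, ∀ b ∈ Set.range YP, a * b = b * a := by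
    rintro _ ⟨i, rfl⟩ _ ⟨j, rfl⟩
    simp only [YP, ← Matrix.map_mul, hcomm]
  let C := Algebra.adjoin P (Set.range YP)
  have : IsMulCommutative C := Algebra.isMulCommutative_adjoin P hYP
  let yc : Fin n → C := fun j => ⟨YP j, Algebra.subset_adjoin ⟨j, rfl⟩⟩
  let Fc : C := ∑ j, algebraMap ℂ⟦X⟧ P (g j) • yc j
  have hFc : (C.val Fc) = ∑ j, algebraMap ℂ⟦X⟧ P (g j) • YP j := by
    simp only [Fc, map_sum, map_smul]
    rfl
  have hnon : Fc ∈ nonunits C := by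
    intro hu
    have h1 : IsUnit (C.val Fc) := hu.map C.val
    rw [hFc, Matrix.isUnit_iff_isUnit_det] at h1
    exact h1.ne_zero h0
  obtain ⟨M, hM, hFM⟩ := exists_max_ideal_of_mem_nonunits hnon
  let _ : Field (C ⧸ M) := Ideal.Quotient.field M
  have hfin : Module.Finite P (C ⧸ M) :=
    Module.Finite.of_surjective (Ideal.Quotient.mkₐ P M).toLinearMap
      (Ideal.Quotient.mkₐ_surjective P M)
  refine no_integral_relation (P := P) q hq hg hδ hA (P' := C ⧸ M)
    (fun j => Ideal.Quotient.mkₐ P M (yc j)) (fun j => (Y j).charpoly)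
    (fun j => Matrix.charpoly_monic _) ?_ j₀ ?_ ?_
  · intro j
    have h1 : Polynomial.aeval (YP j) ((Y j).charpoly.map (algebraMap ℂ[X] P)) = 0 := by
      rw [← Matrix.charpoly_map]
      exact Matrix.aeval_self_charpoly _
    have h2 : Polynomial.aeval (yc j) ((Y j).charpoly.map (algebraMap ℂ[X] P)) = 0 := by
      have hinj : Function.Injective C.val := Subtype.val_injective
      apply hinj
      rw [map_zero, ← Polynomial.aeval_algHom_apply]
      exact h1
    have h3 := congrArg (Ideal.Quotient.mkₐ P M) h2
    rw [map_zero, ← Polynomial.aeval_algHom_apply, Polynomial.aeval_def, Polynomial.eval₂_map] at h3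
    exact h3
  · intro h
    apply hdet
    rw [Matrix.det_eq_sign_charpoly_coeff, h, mul_zero]
  · have h1 : Ideal.Quotient.mkₐ P M Fc = 0 := Ideal.Quotient.eq_zero_iff_mem.mpr hFM
    simp only [Fc, map_sum, Algebra.smul_def] at h1
    exact h1

end Rotation

/-- A matrix-valued combination of solutions of a Mahler system is invertible. -/
theorem det_sum_ne_zero (q : ℕ) [NeZero q] (hq : 2 ≤ q) {n : ℕ} {g : Fin n → ℂ⟦X⟧}
    (hg : LinearIndependent ℂ[X] g) {δ : ℂ[X]} (hδ : δ ≠ 0) {A : Matrix (Fin n) (Fin n) ℂ[X]}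
    (hA : ∀ i, δ • g i = ∑ j, A i j • sig q (g j)) {m : ℕ}
    (Y : Fin n → Matrix (Fin m) (Fin m) ℂ[X]) (hcomm : ∀ i j, Y i * Y j = Y j * Y i)
    (j₀ : Fin n) (hdet : (Y j₀).det ≠ 0) :
    (∑ j, g j • (Y j).map (algebraMap ℂ[X] ℂ⟦X⟧)).det ≠ 0 := by
  have hinj : Function.Injective (algebraMap ℂ[X] (FractionRing ℂ⟦X⟧)) := by
    rw [IsScalarTower.algebraMap_eq ℂ[X] ℂ⟦X⟧ (FractionRing ℂ⟦X⟧)]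
    exact (IsFractionRing.injective ℂ⟦X⟧ _).comp (Polynomial.coe_injective ℂ)
  let _ : Algebra (RatFunc ℂ) (FractionRing ℂ⟦X⟧) := (IsFractionRing.lift hinj).toAlgebra
  have : IsScalarTower ℂ[X] (RatFunc ℂ) (FractionRing ℂ⟦X⟧) :=
    IsScalarTower.of_algebraMap_eq fun p => (IsFractionRing.lift_algebraMap hinj p).symm
  intro h0
  refine det_sum_ne_zero_aux (P := FractionRing ℂ⟦X⟧) q hq hg hδ hA Y hcomm j₀ hdet ?_
  have := congrArg (algebraMap ℂ⟦X⟧ (FractionRing ℂ⟦X⟧)) h0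
  rw [map_zero, RingHom.map_det] at this
  rw [← this]
  congr 1
  ext a b
  simp only [Matrix.sum_apply, Matrix.smul_apply, Matrix.map_apply, RingHom.mapMatrix_apply,
    smul_eq_mul, map_sum, map_mul]
  rfl

end Mahler

namespace Mahler
open Finset

theorem exists_integral_multiplication {R U : Type*} [CommRing R] [IsDomain R] [Field U]
    [Algebra R U] [FaithfulSMul R U] {n : ℕ} (y : Fin n → U) (hy : ∀ j, IsAlgebraic R (y j)) :
    ∃ (m : ℕ) (b : Fin m → U) (Y : Fin n → Matrix (Fin m) (Fin m) R) (Δ : R),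
      0 < m ∧ Δ ≠ 0 ∧ (∀ i, b i ∈ Submonoid.closure (Set.range y)) ∧ LinearIndependent R b ∧
      ∀ j i, ∑ l, Y j i l • b l = Δ • (y j * b i) := by
  let k := FractionRing R
  let _ : Algebra k U := FractionRing.liftAlgebra R U
  have : IsScalarTower R k U := FractionRing.isScalarTower_liftAlgebra R U
  let S := Algebra.adjoin k (Set.range y)
  have hspan : Subalgebra.toSubmodule S =
      Submodule.span k (Submonoid.closure (Set.range y) : Set U) := Algebra.adjoin_eq_span _ _
  have hfin : FiniteDimensional k (Subalgebra.toSubmodule S) := by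
    have : (Subalgebra.toSubmodule S).FG := by
      refine fg_adjoin_of_finite (Set.finite_range y) ?_
      rintro _ ⟨j, rfl⟩
      exact ((IsFractionRing.isAlgebraic_iff R k U).mp (hy j)).isIntegral
    exact Module.Finite.iff_fg.mpr this
  obtain ⟨s, hs, hsspan, hsind⟩ := exists_linearIndependent k (Submonoid.closure (Set.range y) : Set U)
  have hsS : ∀ x ∈ s, x ∈ Subalgebra.toSubmodule S := fun x hx => by
    rw [hspan]; exact Submodule.subset_span (hs hx)
  have hsfin : Finite s := by
    have h1 : LinearIndependent k (fun x : s => (⟨x, hsS x x.2⟩ : Subalgebra.toSubmodule S)) :=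
      LinearIndependent.of_comp (Subalgebra.toSubmodule S).subtype hsind
    exact h1.finite
  obtain ⟨m, ⟨e⟩⟩ := Finite.exists_equiv_fin s
  let b : Fin m → U := fun i => (e.symm i : U)
  have hbr : Set.range b = s := by
    have : b = ((↑) : s → U) ∘ e.symm := rfl
    rw [this, Set.range_comp, e.symm.surjective.range_eq, Set.image_univ, Subtype.range_coe]
  have hb : ∀ i, b i ∈ Submonoid.closure (Set.range y) := fun i => hs (e.symm i).2
  have hbk : LinearIndependent k b := hsind.comp e.symm e.symm.injective
  have hmem : ∀ j i, ∃ c : Fin m → k, ∑ l, c l • b l = y j * b i := by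
    intro j i
    refine (Submodule.mem_span_range_iff_exists_fun k).mp ?_
    rw [hbr, hsspan]
    exact Submodule.subset_span (mul_mem (Submonoid.subset_closure ⟨j, rfl⟩) (hb i))
  choose c hc using hmem
  obtain ⟨Δ, hΔ⟩ := IsLocalization.exist_integer_multiples_of_finite (nonZeroDivisors R)
    (fun x : Fin n × Fin m × Fin m => c x.1 x.2.1 x.2.2)
  choose d hd using hΔ
  refine ⟨m, b, fun j => Matrix.of fun i l => d (j, i, l), Δ, ?_, nonZeroDivisors.ne_zero Δ.2, hb,
    (LinearIndependent.iff_fractionRing R k).mpr hbk, ?_⟩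
  · rcases Nat.eq_zero_or_pos m with rfl | h
    · exfalso
      have h1 : (1 : U) ∈ Submodule.span k (Set.range b) := by
        rw [hbr, hsspan]; exact Submodule.subset_span (one_mem _)
      rw [Set.range_eq_empty, Submodule.span_empty] at h1
      exact one_ne_zero ((Submodule.mem_bot k).mp h1)
    · exact h
  · intro j i
    rw [← hc, Finset.smul_sum]
    refine Finset.sum_congr rfl fun l _ => ?_
    have h2 := hd (j, i, l)
    simp only [Matrix.of_apply]
    rw [← smul_assoc]
    rw [← algebraMap_smul k (d (j, i, l)) (b l), h2]

theorem exists_regular_representation {D U : Type*} [CommRing D] [IsDomain D] [Field U]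
    [Algebra D U] [FaithfulSMul D U] {n : ℕ} (y : Fin n → U) :
    ∃ (t : ℕ) (w : Fin t → Fin n) (m : ℕ) (b : Fin m → U)
      (Y : Fin n → Matrix (Fin m) (Fin m) (MvPolynomial (Fin t) D)) (Δ : MvPolynomial (Fin t) D),
      0 < m ∧ Δ ≠ 0 ∧ (∀ i, b i ∈ Submonoid.closure (Set.range y)) ∧
      (∀ Q : Fin m → MvPolynomial (Fin t) D,
        ∑ i, MvPolynomial.aeval (y ∘ w) (Q i) * b i = 0 → Q = 0) ∧
      (∀ j i, ∑ l, MvPolynomial.aeval (y ∘ w) (Y j i l) * b l =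
        MvPolynomial.aeval (y ∘ w) Δ * y j * b i) ∧
      (∀ i j, Y i * Y j = Y j * Y i) ∧ ∀ j, y j ≠ 0 → (Y j).det ≠ 0 := by
  classical
  obtain ⟨S, hS⟩ := Set.Finite.exists_maximal
    (Set.toFinite {S : Set (Fin n) | AlgebraicIndepOn D y S}) ⟨∅, by
      exact (algebraicIndependent_empty_type_iff ..).mpr (FaithfulSMul.algebraMap_injective D U)⟩
  have hSind : AlgebraicIndepOn D y S := hS.1
  have hSalg : ∀ j, IsAlgebraic (Algebra.adjoin D (y '' S)) (y j) := by
    intro j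
    by_cases hj : j ∈ S
    · exact isAlgebraic_algebraMap (⟨y j, Algebra.subset_adjoin ⟨j, hj, rfl⟩⟩ : Algebra.adjoin D (y '' S))
    · by_contra hcon
      have h1 : AlgebraicIndepOn D y (insert j S) := (AlgebraicIndepOn.insert_iff hj).mpr ⟨hSind, hcon⟩
      exact hj (hS.2 h1 (Set.subset_insert j S) (Set.mem_insert j S))
  obtain ⟨t, ⟨e⟩⟩ := Finite.exists_equiv_fin S
  let w : Fin t → Fin n := fun i => (e.symm i : Fin n)
  have hw : AlgebraicIndependent D (y ∘ w) := hSind.comp e.symm e.symm.injective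
  have hrange : Set.range (y ∘ w) = y '' S := by
    have : y ∘ w = (y ∘ ((↑) : S → Fin n)) ∘ e.symm := rfl
    rw [this, e.symm.surjective.range_comp, Set.range_comp, Subtype.range_coe]
  rw [← hrange] at hSalg
  let _ : Algebra (MvPolynomial (Fin t) D) U := (MvPolynomial.aeval (R := D) (y ∘ w)).toAlgebra
  have hinj : Function.Injective (algebraMap (MvPolynomial (Fin t) D) U) := hw
  have : FaithfulSMul (MvPolynomial (Fin t) D) U := (faithfulSMul_iff_algebraMap_injective _ _).mpr hinj
  have hyalg : ∀ j, IsAlgebraic (MvPolynomial (Fin t) D) (y j) := by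
    intro j
    refine (hSalg j).ringHom_of_comp_eq (hw.aevalEquiv.symm : _ →+* MvPolynomial (Fin t) D)
      (RingHom.id U) hw.aevalEquiv.symm.injective ?_
    refine RingHom.ext fun x => ?_
    obtain ⟨p, rfl⟩ := hw.aevalEquiv.surjective x
    simp only [RingHom.comp_apply, RingHom.id_apply, RingHom.coe_coe, AlgEquiv.symm_apply_apply]
    exact (hw.algebraMap_aevalEquiv p).symm
  obtain ⟨m, b, Y, Δ, hm, hΔ, hb, hbind, hY⟩ := exists_integral_multiplication y hyalg
  refine ⟨t, w, m, b, Y, Δ, hm, hΔ, hb, ?_, ?_, ?_, ?_⟩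
  · intro Q hQ
    funext i
    exact Fintype.linearIndependent_iff.mp hbind Q hQ i
  · intro j i
    rw [mul_assoc]
    exact hY j i
  · have key : ∀ i j a, ∑ l, (Y i * Y j) a l • b l = (Δ * Δ) • (y i * y j * b a) := by
      intro i j a
      simp only [Matrix.mul_apply, Finset.sum_smul, mul_smul]
      rw [Finset.sum_comm]
      simp only [← Finset.smul_sum, hY]
      calc ∑ c, Y i a c • Δ • (y j * b c) = Δ • (y j * ∑ c, Y i a c • b c) := by
            rw [Finset.mul_sum, Finset.smul_sum]
            refine Finset.sum_congr rfl fun c _ => ?_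
            rw [smul_comm, mul_smul_comm]
        _ = _ := by
            rw [hY, mul_smul_comm]
            congr 2
            ring
    intro i j
    ext1 a l
    have h1 : ∑ l, ((Y i * Y j) a l - (Y j * Y i) a l) • b l = 0 := by
      simp only [sub_smul, Finset.sum_sub_distrib, key]
      rw [mul_comm (y i), sub_self]
    exact sub_eq_zero.mp (Fintype.linearIndependent_iff.mp hbind _ h1 l)
  · intro j hj
    have hu : LinearIndependent (MvPolynomial (Fin t) D) (fun i => y j * b i) := by
      rw [Fintype.linearIndependent_iff] at hbind ⊢
      intro Q hQ
      apply hbind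
      simp only [← mul_smul_comm] at hQ
      rw [← Finset.mul_sum] at hQ
      exact (mul_eq_zero.mp hQ).resolve_left hj
    exact det_ne_zero_of_linearIndependent (u := fun i => y j * b i) (w := b) hu hΔ
      (fun i => (hY j i).symm)

end Mahler

namespace Mahler
open Finset

section Size
variable {L : Type*} [Field L]

/-- `d` bounds both the denominator and the conjugates of `x`. -/
def SizeLe (d : ℕ) (x : L) : Prop :=
  IsIntegral ℤ ((d : L) * x) ∧ ∀ τ : L →+* ℂ, ‖τ x‖ ≤ d

theorem SizeLe.mono {d d' : ℕ} {x : L} (h : SizeLe d x) (hd : d ∣ d') (hd' : 0 < d') :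
    SizeLe d' x := by
  refine ⟨?_, fun τ => (h.2 τ).trans (by exact_mod_cast Nat.le_of_dvd hd' hd)⟩
  obtain ⟨e, rfl⟩ := hd
  have : ((d * e : ℕ) : L) * x = (e : L) * ((d : L) * x) := by push_cast; ring
  rw [this]
  exact (isIntegral_natCast e).mul h.1

theorem SizeLe.mul {d d' : ℕ} {x x' : L} (h : SizeLe d x) (h' : SizeLe d' x') :
    SizeLe (d * d') (x * x') := by
  refine ⟨?_, fun τ => ?_⟩
  · have : ((d * d' : ℕ) : L) * (x * x') = ((d : L) * x) * ((d' : L) * x') := by push_cast; ring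
    rw [this]
    exact h.1.mul h'.1
  · rw [map_mul, norm_mul, Nat.cast_mul]
    exact mul_le_mul (h.2 τ) (h'.2 τ) (norm_nonneg _) (Nat.cast_nonneg _)

theorem SizeLe.one : SizeLe 1 (1 : L) := by
  refine ⟨by simpa using isIntegral_one, fun τ => by simp⟩

theorem SizeLe.pow {d : ℕ} {x : L} (h : SizeLe d x) (k : ℕ) : SizeLe (d ^ k) (x ^ k) := by
  induction k with
  | zero => simpa using SizeLe.one
  | succ k ih => rw [pow_succ, pow_succ]; exact ih.mul h

theorem SizeLe.sum {ι : Type*} {s : Finset ι} {d : ℕ} {x : ι → L} (h : ∀ i ∈ s, SizeLe d (x i)) :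
    SizeLe (s.card * d) (∑ i ∈ s, x i) := by
  refine ⟨?_, fun τ => ?_⟩
  · have : ((s.card * d : ℕ) : L) * ∑ i ∈ s, x i = (s.card : L) * ∑ i ∈ s, (d : L) * x i := by
      rw [← Finset.mul_sum]; push_cast; ring
    rw [this]
    exact (isIntegral_natCast _).mul (IsIntegral.sum _ fun i hi => (h i hi).1)
  · rw [map_sum, Nat.cast_mul, ← nsmul_eq_mul]
    exact norm_sum_le_of_le _ (fun i hi => (h i hi).2 τ) |>.trans (by simp)

variable [NumberField L]

theorem exists_sizeLe (x : L) : ∃ d : ℕ, 0 < d ∧ SizeLe d x := by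
  obtain ⟨y, hy, h⟩ := ((IsFractionRing.isAlgebraic_iff ℤ ℚ L).mpr
    (Algebra.IsAlgebraic.isAlgebraic (R := ℚ) x)).exists_integral_multiple
  obtain ⟨B, hB⟩ := Finite.bddAbove_range (fun τ : L →+* ℂ => ‖τ x‖)
  have h1 : SizeLe (y.natAbs * (⌈B⌉₊ + 1)) x := by
    refine ⟨?_, fun τ => ?_⟩
    · have h2 : IsIntegral ℤ ((y.natAbs : L) * x) := by
        rcases Int.natAbs_eq y with h0 | h0
        · rw [h0] at h
          simpa [zsmul_eq_mul] using h
        · rw [h0] at h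
          have := h.neg
          simpa [zsmul_eq_mul] using this
      have : ((y.natAbs * (⌈B⌉₊ + 1) : ℕ) : L) * x = ((⌈B⌉₊ + 1 : ℕ) : L) * ((y.natAbs : L) * x) := by
        push_cast; ring
      rw [this]
      exact (isIntegral_natCast _).mul h2
    · have h3 : ‖τ x‖ ≤ B := hB ⟨τ, rfl⟩
      have h4 : (1 : ℝ) ≤ y.natAbs := by
        exact_mod_cast Int.natAbs_pos.mpr hy
      have h5 := Nat.le_ceil B
      push_cast at h4 ⊢
      nlinarith [norm_nonneg (τ x)]
  exact ⟨_, Nat.mul_pos (Int.natAbs_pos.mpr hy) (Nat.succ_pos _), h1⟩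

theorem exists_sizeLe_forall {ι : Type*} [Finite ι] (x : ι → L) :
    ∃ d : ℕ, 0 < d ∧ ∀ i, SizeLe d (x i) := by
  have := Fintype.ofFinite ι
  choose d hd h using fun i => exists_sizeLe (x i)
  exact ⟨∏ i, d i, Finset.prod_pos fun i _ => hd i, fun i =>
    (h i).mono (Finset.dvd_prod_of_mem _ (Finset.mem_univ i)) (Finset.prod_pos fun i _ => hd i)⟩

/-- Liouville's inequality. -/
theorem SizeLe.one_le {d : ℕ} {x : L} (h : SizeLe d x) (hx : x ≠ 0) (hd : 0 < d) (ι : L →+* ℂ) :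
    1 ≤ ‖ι x‖ * (d : ℝ) ^ (2 * Module.finrank ℚ L) := by
  classical
  have hd1 : (1 : ℝ) ≤ d := by exact_mod_cast hd
  have hInt : IsIntegral ℤ (Algebra.norm ℚ ((d : L) * x)) := Algebra.isIntegral_norm ℚ h.1
  obtain ⟨a, ha⟩ := IsIntegrallyClosed.isIntegral_iff.mp hInt
  have hdx : (d : L) * x ≠ 0 := mul_ne_zero (by exact_mod_cast hd.ne') hx
  have ha0 : a ≠ 0 := by
    rintro rfl
    rw [map_zero] at ha
    exact hdx (Algebra.norm_eq_zero_iff.mp ha.symm)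
  have hprod := Algebra.norm_eq_prod_embeddings ℚ ℂ ((d : L) * x)
  have h1 : (1 : ℝ) ≤ ∏ σ : L →ₐ[ℚ] ℂ, ‖σ ((d : L) * x)‖ := by
    rw [← norm_prod, ← hprod, ← ha]
    have : (1 : ℝ) ≤ |(a : ℝ)| := by exact_mod_cast Int.one_le_abs ha0
    simpa using this
  have hcard : Fintype.card (L →ₐ[ℚ] ℂ) = Module.finrank ℚ L := AlgHom.card ℚ L ℂ
  let τ : L →ₐ[ℚ] ℂ := ι.toRatAlgHom
  have hτ : ∀ z, τ z = ι z := fun z => rfl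
  have hle : ∀ σ : L →ₐ[ℚ] ℂ, ‖σ ((d : L) * x)‖ ≤ (d : ℝ) ^ 2 := fun σ => by
    rw [map_mul, map_natCast, norm_mul, pow_two, Complex.norm_natCast]
    exact mul_le_mul_of_nonneg_left (h.2 (σ : L →+* ℂ)) (Nat.cast_nonneg d)
  rw [← Finset.mul_prod_erase _ _ (Finset.mem_univ τ)] at h1
  have h2 : ∏ σ ∈ univ.erase τ, ‖σ ((d : L) * x)‖ ≤ ((d : ℝ) ^ 2) ^ (Module.finrank ℚ L - 1) := by
    refine (Finset.prod_le_prod (fun _ _ => norm_nonneg _) (fun σ _ => hle σ)).trans_eq ?_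
    rw [Finset.prod_const, Finset.card_erase_of_mem (Finset.mem_univ _), Finset.card_univ, hcard]
  have h3 : ‖τ ((d : L) * x)‖ = d * ‖ι x‖ := by
    rw [map_mul, map_natCast, norm_mul, hτ, Complex.norm_natCast]
  rw [h3] at h1
  have hN : 0 < Module.finrank ℚ L := Module.finrank_pos
  calc (1 : ℝ) ≤ d * ‖ι x‖ * ((d : ℝ) ^ 2) ^ (Module.finrank ℚ L - 1) :=
        h1.trans (mul_le_mul_of_nonneg_left h2 (by positivity))
    _ ≤ d ^ 2 * ‖ι x‖ * ((d : ℝ) ^ 2) ^ (Module.finrank ℚ L - 1) := by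
        gcongr
        exact le_self_pow₀ hd1 (by norm_num)
    _ = ‖ι x‖ * (d : ℝ) ^ (2 * Module.finrank ℚ L) := by
        obtain ⟨N, hN'⟩ : ∃ N, Module.finrank ℚ L = N + 1 := ⟨_, (Nat.succ_pred_eq_of_pos hN).symm⟩
        rw [hN', Nat.add_sub_cancel, pow_mul, pow_succ]
        ring

/-- Sequences of algebraic numbers whose size at step `k` is at most `e * Λ ^ (S * q ^ k)`. -/
def Growth (q Λ S : ℕ) (x : ℕ → L) : Prop :=
  ∃ e : ℕ, 0 < e ∧ ∀ k, SizeLe (e * Λ ^ (S * q ^ k)) (x k)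

variable {q Λ : ℕ}

theorem Growth.mono {S S' : ℕ} {x : ℕ → L} (h : Growth q Λ S x) (hΛ : 0 < Λ) (hS : S ≤ S') :
    Growth q Λ S' x := by
  obtain ⟨e, he, h⟩ := h
  exact ⟨e, he, fun k => (h k).mono (mul_dvd_mul_left e (pow_dvd_pow Λ (Nat.mul_le_mul_right _ hS)))
    (Nat.mul_pos he (pow_pos hΛ _))⟩

theorem Growth.const (c : L) : Growth q Λ 0 (fun _ => c) := by
  obtain ⟨d, hd, h⟩ := exists_sizeLe c
  exact ⟨d, hd, fun k => by simpa using h⟩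

theorem Growth.mul {S S' : ℕ} {x x' : ℕ → L} (h : Growth q Λ S x) (h' : Growth q Λ S' x') :
    Growth q Λ (S + S') (fun k => x k * x' k) := by
  obtain ⟨e, he, h⟩ := h
  obtain ⟨e', he', h'⟩ := h'
  refine ⟨e * e', Nat.mul_pos he he', fun k => ?_⟩
  have := (h k).mul (h' k)
  rw [add_mul, pow_add]
  convert this using 1
  ring

theorem Growth.pow {S : ℕ} {x : ℕ → L} (h : Growth q Λ S x) (r : ℕ) :
    Growth q Λ (r * S) (fun k => x k ^ r) := by
  induction r with
  | zero => simpa using Growth.const (q := q) (Λ := Λ) (1 : L)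
  | succ r ih =>
    simp only [pow_succ]
    rw [Nat.succ_mul]
    exact ih.mul h

theorem Growth.prod {ι : Type*} {s : Finset ι} {S : ι → ℕ} {x : ι → ℕ → L}
    (h : ∀ i ∈ s, Growth q Λ (S i) (x i)) :
    Growth q Λ (∑ i ∈ s, S i) (fun k => ∏ i ∈ s, x i k) := by
  classical
  induction s using Finset.induction_on with
  | empty => simpa using Growth.const (q := q) (Λ := Λ) (1 : L)
  | insert i s hi ih =>
    simp only [Finset.prod_insert hi, Finset.sum_insert hi]
    exact (h i (mem_insert_self i s)).mul (ih fun j hj => h j (mem_insert_of_mem hj))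

theorem Growth.sum {ι : Type*} {s : Finset ι} {S : ℕ} {x : ι → ℕ → L} (hΛ : 0 < Λ)
    (h : ∀ i ∈ s, Growth q Λ S (x i)) : Growth q Λ S (fun k => ∑ i ∈ s, x i k) := by
  classical
  choose! e he h using h
  have hp : 0 < ∏ i ∈ s, e i := Finset.prod_pos he
  rcases s.eq_empty_or_nonempty with rfl | hs
  · simpa using (Growth.const (q := q) (Λ := Λ) (0 : L)).mono hΛ (Nat.zero_le S)
  refine ⟨s.card * ∏ i ∈ s, e i, Nat.mul_pos hs.card_pos hp, fun k => ?_⟩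
  rw [mul_assoc]
  exact SizeLe.sum fun i hi => (h i hi k).mono
    (Nat.mul_dvd_mul_right (Finset.dvd_prod_of_mem e hi) _) (Nat.mul_pos hp (pow_pos hΛ _))

theorem Growth.polynomial_eval {D : ℕ} (hΛ : 0 < Λ) {x : ℕ → L} (hx : Growth q Λ 1 x)
    (p : Polynomial L) (hp : p.natDegree ≤ D) : Growth q Λ D (fun k => p.eval (x k)) := by
  simp only [Polynomial.eval_eq_sum_range]
  refine Growth.sum hΛ fun i hi => ?_
  have := (Growth.const (q := q) (Λ := Λ) (p.coeff i)).mul (hx.pow i)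
  refine this.mono hΛ ?_
  have := Finset.mem_range.mp hi
  omega

end Size
end Mahler

namespace Mahler
open Finset PowerSeries

section Auxiliary
variable {L : Type*} [Field L] {t m : ℕ}

theorem degreeOf_sum_le' {R ι σ : Type*} [CommSemiring R] (s : Finset ι)
    (f : ι → MvPolynomial σ R) (i : σ) {d : ℕ} (h : ∀ x ∈ s, MvPolynomial.degreeOf i (f x) ≤ d) :
    MvPolynomial.degreeOf i (∑ x ∈ s, f x) ≤ d := by
  exact (MvPolynomial.degreeOf_sum_le i s f).trans (Finset.sup_le h)

theorem degreeOf_vecMul_le {R σ : Type*} [CommSemiring R] {v : Fin m → MvPolynomial σ R}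
    {F : Matrix (Fin m) (Fin m) (MvPolynomial σ R)} {s : σ} {a d : ℕ}
    (hv : ∀ i, (v i).degreeOf s ≤ d) (hF : ∀ i j, (F i j).degreeOf s ≤ a) (i : Fin m) :
    (Matrix.vecMul v F i).degreeOf s ≤ d + a := by
  rw [Matrix.vecMul, dotProduct]
  exact degreeOf_sum_le' _ _ _ fun x _ =>
    (MvPolynomial.degreeOf_mul_le _ _ _).trans (add_le_add (hv x) (hF x i))

theorem degreeOf_vecMul_pow_le {R σ : Type*} [CommSemiring R] {v : Fin m → MvPolynomial σ R}
    {F : Matrix (Fin m) (Fin m) (MvPolynomial σ R)} {s : σ} {a d : ℕ}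
    (hv : ∀ i, (v i).degreeOf s ≤ d) (hF : ∀ i j, (F i j).degreeOf s ≤ a) (r : ℕ) (i : Fin m) :
    (Matrix.vecMul v (F ^ r) i).degreeOf s ≤ d + r * a := by
  induction r generalizing i with
  | zero => simpa using hv i
  | succ r ih =>
    rw [pow_succ, ← Matrix.vecMul_vecMul, Nat.succ_mul, ← add_assoc]
    exact degreeOf_vecMul_le ih hF i

theorem X_pow_dvd_of_coeff {d T : ℕ} {G : MvPolynomial (Fin t) L⟦X⟧}
    (hdeg : ∀ s, G.degreeOf s ≤ d)
    (h : ∀ (e : Fin t → Fin (d + 1)) (r : Fin T),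
      coeff (r : ℕ) (MvPolynomial.coeff (Finsupp.equivFunOnFinite.symm fun s => (e s : ℕ)) G) = 0) :
    MvPolynomial.C (X ^ T) ∣ G := by
  rw [MvPolynomial.C_dvd_iff_dvd_coeff]
  intro e
  rw [X_pow_dvd_iff]
  intro r hr
  by_cases he : ∀ s, e s < d + 1
  · have := h (fun s => ⟨e s, he s⟩) ⟨r, hr⟩
    convert this
    ext s
    simp
  · push Not at he
    obtain ⟨s, hs⟩ := he
    have : MvPolynomial.coeff e G = 0 := by
      by_contra hne
      have := (MvPolynomial.degreeOf_le_iff.mp (hdeg s)) e (MvPolynomial.mem_support_iff.mpr hne)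
      omega
    rw [this, map_zero]

/-- The polynomial with coefficients `u` indexed by bounded exponents. -/
def boxPoly (D D₂ : ℕ) (u : Fin (D₂ + 1) × (Fin t → Fin (D + 1)) → L) :
    MvPolynomial (Fin t) (Polynomial L) :=
  ∑ x, MvPolynomial.monomial (Finsupp.equivFunOnFinite.symm fun s => (x.2 s : ℕ))
    (Polynomial.monomial (x.1 : ℕ) (u x))

theorem coeff_boxPoly (D D₂ : ℕ) (u : Fin (D₂ + 1) × (Fin t → Fin (D + 1)) → L)
    (x : Fin (D₂ + 1) × (Fin t → Fin (D + 1))) :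
    (MvPolynomial.coeff (Finsupp.equivFunOnFinite.symm fun s => (x.2 s : ℕ))
      (boxPoly D D₂ u)).coeff (x.1 : ℕ) = u x := by
  classical
  rw [boxPoly, MvPolynomial.coeff_sum, Polynomial.finsetSum_coeff, Finset.sum_eq_single x]
  · simp
  · intro y _ hy
    rw [MvPolynomial.coeff_monomial]
    split_ifs with h
    · rw [Polynomial.coeff_monomial, if_neg]
      intro h1
      apply hy
      ext s
      · exact h1
      · have := congrArg (fun f => (Finsupp.equivFunOnFinite f) s) h
        simpa using this
    · simp
  · simp

theorem degreeOf_boxPoly_le (D D₂ : ℕ) (u : Fin (D₂ + 1) × (Fin t → Fin (D + 1)) → L) (s : Fin t) :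
    (boxPoly D D₂ u).degreeOf s ≤ D := by
  refine degreeOf_sum_le' _ _ _ fun x _ => ?_
  refine MvPolynomial.degreeOf_le_iff.mpr fun e he => ?_
  have := MvPolynomial.support_monomial_subset he
  rw [Finset.mem_singleton] at this
  subst this
  simpa using Nat.lt_succ_iff.mp (x.2 s).2

theorem natDegree_coeff_boxPoly_le (D D₂ : ℕ) (u : Fin (D₂ + 1) × (Fin t → Fin (D + 1)) → L)
    (e : Fin t →₀ ℕ) : (MvPolynomial.coeff e (boxPoly D D₂ u)).natDegree ≤ D₂ := by
  classical
  rw [boxPoly, MvPolynomial.coeff_sum]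
  refine Polynomial.natDegree_sum_le_of_forall_le _ _ fun x _ => ?_
  rw [MvPolynomial.coeff_monomial]
  split_ifs
  · exact (Polynomial.natDegree_monomial_le _).trans (Nat.lt_succ_iff.mp x.1.2)
  · simp

theorem boxPoly_add (D D₂ : ℕ) (u v : Fin (D₂ + 1) × (Fin t → Fin (D + 1)) → L) :
    boxPoly D D₂ (u + v) = boxPoly D D₂ u + boxPoly D D₂ v := by
  simp [boxPoly, Finset.sum_add_distrib]

theorem boxPoly_smul (D D₂ : ℕ) (c : L) (u : Fin (D₂ + 1) × (Fin t → Fin (D + 1)) → L) :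
    boxPoly D D₂ (c • u) = MvPolynomial.C (Polynomial.C c) * boxPoly D D₂ u := by
  simp [boxPoly, Finset.mul_sum, MvPolynomial.C_mul_monomial, Polynomial.C_mul_monomial]

/-- Coefficient embedding of polynomials into polynomials over power series. -/
abbrev polyMap : MvPolynomial (Fin t) (Polynomial L) →+* MvPolynomial (Fin t) L⟦X⟧ :=
  MvPolynomial.map (algebraMap (Polynomial L) L⟦X⟧)

theorem degreeOf_polyMap_le (p : MvPolynomial (Fin t) (Polynomial L)) (s : Fin t) :
    (polyMap p).degreeOf s ≤ p.degreeOf s := by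
  refine MvPolynomial.degreeOf_le_iff.mpr fun e he => ?_
  exact MvPolynomial.degreeOf_le_iff.mp le_rfl e (MvPolynomial.support_map_subset _ _ he)

theorem exists_row_relation (hm : 0 < m) (F : Matrix (Fin m) (Fin m) (MvPolynomial (Fin t) L⟦X⟧))
    {a : ℕ} (ha : ∀ i j s, (F i j).degreeOf s ≤ a) (M : ℕ) :
    ∃ p : ℕ → Fin m → MvPolynomial (Fin t) (Polynomial L),
      (∃ j ≤ M, p j ≠ 0) ∧ (∀ j i s, (p j i).degreeOf s ≤ M) ∧
      (∀ j i e, (MvPolynomial.coeff e (p j i)).natDegree ≤ (1 + a) ^ t * M) ∧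
      ∀ i, MvPolynomial.C (X ^ (M * (M + 1))) ∣
        ∑ j ∈ range (M + 1), Matrix.vecMul (fun i => polyMap (p j i)) (F ^ j) i := by
  classical
  let D₂ := (1 + a) ^ t * M
  let d := (1 + a) * M
  let T := M * (M + 1)
  let S := Fin (M + 1) × Fin m × Fin (D₂ + 1) × (Fin t → Fin (M + 1))
  let S' := Fin m × Fin T × (Fin t → Fin (d + 1))
  let p : (S → L) → Fin (M + 1) → Fin m → MvPolynomial (Fin t) (Polynomial L) :=
    fun u j i => boxPoly M D₂ (fun x => u (j, i, x))
  let G : (S → L) → Fin m → MvPolynomial (Fin t) L⟦X⟧ :=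
    fun u i => ∑ j, Matrix.vecMul (fun i => polyMap (p u j i)) (F ^ (j : ℕ)) i
  have hGadd : ∀ u v i, G (u + v) i = G u i + G v i := by
    intro u v i
    simp only [G, ← Finset.sum_add_distrib]
    refine Finset.sum_congr rfl fun j _ => ?_
    rw [← Pi.add_apply (Matrix.vecMul _ _), ← Matrix.add_vecMul]
    congr 2
    funext i
    have : (p (u + v) j i) = p u j i + p v j i := boxPoly_add _ _ _ _
    rw [this, map_add, Pi.add_apply]
  have hGsmul : ∀ (c : L) u i, G (c • u) i = MvPolynomial.C (PowerSeries.C c) * G u i := by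
    intro c u i
    simp only [G, Finset.mul_sum]
    refine Finset.sum_congr rfl fun j _ => ?_
    simp only [Matrix.vecMul, dotProduct, Finset.mul_sum]
    refine Finset.sum_congr rfl fun i' _ => ?_
    have : (p (c • u) j i') = MvPolynomial.C (Polynomial.C c) * p u j i' := boxPoly_smul _ _ _ _
    rw [this, map_mul, MvPolynomial.map_C, ← mul_assoc]
    congr 3
    exact Polynomial.coe_C c
  let Φ : (S → L) →ₗ[L] (S' → L) :=
    { toFun := fun u x => coeff (x.2.1 : ℕ) (MvPolynomial.coeff
        (Finsupp.equivFunOnFinite.symm fun s => (x.2.2 s : ℕ)) (G u x.1))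
      map_add' := fun u v => by
        funext x
        simp only [hGadd, MvPolynomial.coeff_add, map_add, Pi.add_apply]
      map_smul' := fun c u => by
        funext x
        simp only [hGsmul, MvPolynomial.coeff_C_mul, PowerSeries.coeff_C_mul, Pi.smul_apply,
          smul_eq_mul, RingHom.id_apply] }
  have hlt : Module.finrank L (S' → L) < Module.finrank L (S → L) := by
    simp only [Module.finrank_fintype_fun_eq_card, S, S', Fintype.card_prod, Fintype.card_fin,
      Fintype.card_fun]
    have h1 : (d + 1) ^ t ≤ (1 + a) ^ t * (M + 1) ^ t := by
      rw [← mul_pow]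
      refine Nat.pow_le_pow_left ?_ t
      simp only [d]
      nlinarith
    have h2 : T * (d + 1) ^ t < (M + 1) * ((D₂ + 1) * (M + 1) ^ t) := by
      calc T * (d + 1) ^ t ≤ T * ((1 + a) ^ t * (M + 1) ^ t) := Nat.mul_le_mul_left _ h1
        _ = (M + 1) * (D₂ * (M + 1) ^ t) := by simp only [T, D₂]; ring
        _ < _ := by
          refine Nat.mul_lt_mul_of_pos_left ?_ (Nat.succ_pos M)
          exact Nat.mul_lt_mul_of_pos_right (Nat.lt_succ_self _) (pow_pos (Nat.succ_pos M) _)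
    calc m * (T * (d + 1) ^ t) < m * ((M + 1) * ((D₂ + 1) * (M + 1) ^ t)) :=
          Nat.mul_lt_mul_of_pos_left h2 hm
      _ = _ := by ring
  obtain ⟨u, hu, hu0⟩ := (Submodule.ne_bot_iff _).mp (LinearMap.ker_ne_bot_of_finrank_lt (f := Φ) hlt)
  refine ⟨fun j => if h : j < M + 1 then p u ⟨j, h⟩ else 0, ?_, ?_, ?_, ?_⟩
  · by_contra hcon
    push Not at hcon
    apply hu0
    funext ⟨j, i, x⟩
    have h1 := hcon j (Nat.lt_succ_iff.mp j.2)
    rw [dif_pos j.2] at h1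
    have h2 : boxPoly M D₂ (fun x => u (j, i, x)) = 0 := congrFun h1 i
    have h3 := coeff_boxPoly M D₂ (fun x => u (j, i, x)) x
    rw [h2] at h3
    simpa using h3.symm
  · intro j i s
    dsimp only
    split_ifs
    · exact degreeOf_boxPoly_le _ _ _ _
    · simp
  · intro j i e
    dsimp only
    split_ifs
    · exact natDegree_coeff_boxPoly_le _ _ _ _
    · simp
  · intro i
    have hG : ∑ j ∈ range (M + 1), Matrix.vecMul (fun i => polyMap
        ((if h : j < M + 1 then p u ⟨j, h⟩ else 0 : Fin m → MvPolynomial (Fin t) (Polynomial L)) i))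
        (F ^ j) i = G u i := by
      rw [Finset.sum_range]
      refine Finset.sum_congr rfl fun j _ => ?_
      simp only [j.2, dif_pos]
    rw [hG]
    refine X_pow_dvd_of_coeff (d := d) (fun s => ?_) (fun e r => ?_)
    · refine degreeOf_sum_le' _ _ _ fun j _ => ?_
      refine (degreeOf_vecMul_pow_le (d := M) (a := a) (fun i => (degreeOf_polyMap_le _ s).trans
        (degreeOf_boxPoly_le _ _ _ _)) (fun i j => ha i j s) j i).trans ?_
      have := Nat.lt_succ_iff.mp j.2
      simp only [d]
      nlinarith
    · exact congrFun (LinearMap.mem_ker.mp hu) (i, r, e)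

theorem prime_C_X : Prime (MvPolynomial.C X : MvPolynomial (Fin t) L⟦X⟧) :=
  (MvPolynomial.prime_C_iff _).mpr X_prime

lemma pow_sub_dvd_of_dvd_mul {R : Type*} [CommRing R] [IsDomain R] {p : R} (hp : Prime p) {s : ℕ} :
    ∀ {a x : R} {T : ℕ}, ¬ p ^ (s + 1) ∣ a → p ^ T ∣ a * x → p ^ (T - s) ∣ x := by
  induction s with
  | zero =>
    intro a x T ha h
    exact hp.pow_dvd_of_dvd_mul_left T (by simpa using ha) h
  | succ s ih =>
    intro a x T ha h
    by_cases hpa : p ∣ a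
    · obtain ⟨a', rfl⟩ := hpa
      rcases T with _ | T
      · simp
      rw [pow_succ' p (s + 1), mul_dvd_mul_iff_left hp.ne_zero] at ha
      rw [pow_succ' p T, mul_assoc, mul_dvd_mul_iff_left hp.ne_zero] at h
      have := ih ha h
      rwa [show T + 1 - (s + 1) = T - s by omega]
    · exact (pow_dvd_pow _ (Nat.sub_le _ _)).trans (hp.pow_dvd_of_dvd_mul_left T hpa h)

/-- Rows of low degree with high order of vanishing, after cancelling powers of `F`. -/
theorem exists_auxiliary_rows (hm : 0 < m)
    (F : Matrix (Fin m) (Fin m) (MvPolynomial (Fin t) L⟦X⟧)) {a : ℕ}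
    (ha : ∀ i j s, (F i j).degreeOf s ≤ a) (hdet : F.det ≠ 0) : ∃ s₀ : ℕ, ∀ M : ℕ,
    ∃ (J : ℕ) (p : ℕ → Fin m → MvPolynomial (Fin t) (Polynomial L)),
      p 0 ≠ 0 ∧ J ≤ M ∧ (∀ j i s, (p j i).degreeOf s ≤ M) ∧
      (∀ j i e, (MvPolynomial.coeff e (p j i)).natDegree ≤ (1 + a) ^ t * M) ∧
      ∀ i, MvPolynomial.C (X ^ (M * (M + 1) - s₀ * M)) ∣
        ∑ j ∈ range (J + 1), Matrix.vecMul (fun i => polyMap (p j i)) (F ^ j) i := by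
  classical
  obtain ⟨s₀, hs₀⟩ : ∃ s₀, ¬ (MvPolynomial.C X : MvPolynomial (Fin t) L⟦X⟧) ^ (s₀ + 1) ∣ F.det := by
    obtain ⟨e, he⟩ := MvPolynomial.ne_zero_iff.mp hdet
    obtain ⟨r, hr⟩ : ∃ r, coeff r (MvPolynomial.coeff e F.det) ≠ 0 := by
      by_contra hcon
      push Not at hcon
      exact he (PowerSeries.ext fun r => by rw [hcon r, map_zero])
    refine ⟨r, fun hdvd => hr ?_⟩
    rw [← map_pow, MvPolynomial.C_dvd_iff_dvd_coeff] at hdvd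
    exact X_pow_dvd_iff.mp (hdvd e) r (Nat.lt_succ_self r)
  refine ⟨s₀, fun M => ?_⟩
  obtain ⟨p, ⟨j₁, hj₁, hpj₁⟩, hdeg, hnat, hdvd⟩ := exists_row_relation hm F ha M
  have hex : ∃ j, p j ≠ 0 := ⟨j₁, hpj₁⟩
  let j₀ := Nat.find hex
  have hj₀ : p j₀ ≠ 0 := Nat.find_spec hex
  have hmin : ∀ j < j₀, p j = 0 := fun j hj => by_contra fun h => Nat.find_min hex hj h
  have hj₀M : j₀ ≤ M := (Nat.find_min' hex hpj₁).trans hj₁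
  refine ⟨M - j₀, fun j => p (j₀ + j), hj₀, Nat.sub_le _ _, fun j => hdeg _, fun j => hnat _, ?_⟩
  let G : Fin m → MvPolynomial (Fin t) L⟦X⟧ := fun i =>
    ∑ j ∈ range (M - j₀ + 1), Matrix.vecMul (fun i => polyMap (p (j₀ + j) i)) (F ^ j) i
  have hsplit : ∀ i, ∑ j ∈ range (M + 1), Matrix.vecMul (fun i => polyMap (p j i)) (F ^ j) i =
      Matrix.vecMul G (F ^ j₀) i := by
    intro i
    have h1 : M + 1 = j₀ + (M - j₀ + 1) := by omega
    rw [h1, Finset.sum_range_add, Finset.sum_eq_zero, zero_add]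
    · have h2 : G = ∑ j ∈ range (M - j₀ + 1),
          Matrix.vecMul (fun i => polyMap (p (j₀ + j) i)) (F ^ j) := by
        funext i; simp [G]
      rw [h2, Matrix.sum_vecMul, Finset.sum_apply]
      refine Finset.sum_congr rfl fun j _ => ?_
      rw [Matrix.vecMul_vecMul, ← pow_add, add_comm]
    · intro j hj
      rw [hmin j (Finset.mem_range.mp hj)]
      have : (fun i : Fin m => polyMap ((0 : Fin m → MvPolynomial (Fin t) (Polynomial L)) i)) = 0 := by
        funext i; simp
      rw [this, Matrix.zero_vecMul, Pi.zero_apply]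
  have hGdet : ∀ i, F.det ^ j₀ * G i =
      Matrix.vecMul (Matrix.vecMul G (F ^ j₀)) (F.adjugate ^ j₀) i := by
    intro i
    have hcomm : Commute F F.adjugate := by
      rw [Commute, SemiconjBy, Matrix.mul_adjugate, Matrix.adjugate_mul]
    rw [Matrix.vecMul_vecMul, ← hcomm.mul_pow, Matrix.mul_adjugate, smul_pow, one_pow,
      Matrix.vecMul_smul, Matrix.vecMul_one]
    rfl
  intro i
  change _ ∣ G i
  have h1 : (MvPolynomial.C X : MvPolynomial (Fin t) L⟦X⟧) ^ (M * (M + 1)) ∣ F.det ^ j₀ * G i := by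
    rw [hGdet, Matrix.vecMul, dotProduct]
    refine Finset.dvd_sum fun l _ => Dvd.dvd.mul_right ?_ _
    rw [← hsplit, ← map_pow]
    exact hdvd l
  have key : ∀ (r T : ℕ) (x : MvPolynomial (Fin t) L⟦X⟧),
      (MvPolynomial.C X : MvPolynomial (Fin t) L⟦X⟧) ^ T ∣ F.det ^ r * x →
      (MvPolynomial.C X : MvPolynomial (Fin t) L⟦X⟧) ^ (T - s₀ * r) ∣ x := by
    intro r
    induction r with
    | zero => intro T x h; simpa using h
    | succ r ih =>
      intro T x h
      have h3 : (MvPolynomial.C X : MvPolynomial (Fin t) L⟦X⟧) ^ (T - s₀) ∣ F.det ^ r * x := by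
        refine pow_sub_dvd_of_dvd_mul prime_C_X hs₀ (h.trans (dvd_of_eq ?_))
        ring
      have := ih _ _ h3
      rwa [Nat.sub_sub, show s₀ + s₀ * r = s₀ * (r + 1) by ring] at this
  have h2 := key j₀ _ _ h1
  rw [map_pow]
  exact (pow_dvd_pow _ (Nat.sub_le_sub_left (Nat.mul_le_mul_left _ hj₀M) _)).trans h2

end Auxiliary
end Mahler

namespace Mahler
open Finset PowerSeries

section Convergence

/-- The power series which converge absolutely at radius `ρ`. -/
def convSubring (ρ : ℝ) (_hρ : 0 ≤ ρ) : Subring ℂ⟦X⟧ where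
  carrier := {x | Summable fun m => ‖coeff m x * (ρ : ℂ) ^ m‖}
  zero_mem' := by simp
  one_mem' := by
    refine summable_of_ne_finset_zero (s := {0}) fun m hm => ?_
    rw [Finset.mem_singleton] at hm
    simp [PowerSeries.coeff_one, hm]
  add_mem' := fun {x y} hx hy => by
    refine Summable.of_nonneg_of_le (fun _ => norm_nonneg _) (fun m => ?_) (hx.add hy)
    rw [map_add, add_mul]
    exact norm_add_le _ _
  neg_mem' := fun {x} hx => by
    simpa using hx
  mul_mem' := fun {x y} hx hy => by
    have := summable_norm_sum_mul_antidiagonal_of_summable_norm hx hy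
    refine this.congr fun m => ?_
    rw [PowerSeries.coeff_mul, Finset.sum_mul]
    refine congrArg _ (Finset.sum_congr rfl fun p hp => ?_)
    rw [← HasAntidiagonal.mem_antidiagonal.mp hp, pow_add]
    ring

variable {ρ : ℝ} {hρ : 0 ≤ ρ}

lemma mem_convSubring {x : ℂ⟦X⟧} :
    x ∈ convSubring ρ hρ ↔ Summable fun m => ‖coeff m x * (ρ : ℂ) ^ m‖ := Iff.rfl

lemma summable_of_mem_convSubring {x : ℂ⟦X⟧} (hx : x ∈ convSubring ρ hρ) {z : ℂ} (hz : ‖z‖ ≤ ρ) :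
    Summable fun m => ‖coeff m x * z ^ m‖ := by
  refine Summable.of_nonneg_of_le (fun _ => norm_nonneg _) (fun m => ?_) hx
  rw [norm_mul, norm_mul, norm_pow, norm_pow, Complex.norm_real, Real.norm_of_nonneg hρ]
  gcongr

lemma coe_mem_convSubring (p : Polynomial ℂ) : (p : ℂ⟦X⟧) ∈ convSubring ρ hρ := by
  refine summable_of_ne_finset_zero (s := p.support) fun m hm => ?_
  rw [Polynomial.notMem_support_iff] at hm
  simp [hm]

/-- Evaluation of a convergent power series. -/
def evConv (z : ℂ) (hz : ‖z‖ ≤ ρ) : convSubring ρ hρ →+* ℂ where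
  toFun x := ∑' m, coeff m (x : ℂ⟦X⟧) * z ^ m
  map_one' := by
    rw [tsum_eq_single 0]
    · simp
    · intro m hm
      simp [PowerSeries.coeff_one, hm]
  map_zero' := by simp
  map_add' x y := by
    rw [← ((summable_of_mem_convSubring x.2 hz).of_norm).tsum_add
      ((summable_of_mem_convSubring y.2 hz).of_norm)]
    refine tsum_congr fun m => ?_
    simp [add_mul]
  map_mul' x y := by
    rw [tsum_mul_tsum_eq_tsum_sum_antidiagonal_of_summable_norm
      (summable_of_mem_convSubring x.2 hz) (summable_of_mem_convSubring y.2 hz)]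
    refine tsum_congr fun m => ?_
    rw [Subring.coe_mul, PowerSeries.coeff_mul, Finset.sum_mul]
    refine Finset.sum_congr rfl fun p hp => ?_
    rw [← HasAntidiagonal.mem_antidiagonal.mp hp, pow_add]
    ring

lemma evConv_apply {z : ℂ} (hz : ‖z‖ ≤ ρ) (x : convSubring ρ hρ) :
    evConv z hz x = ∑' m, coeff m (x : ℂ⟦X⟧) * z ^ m := rfl

lemma evConv_coe {z : ℂ} (hz : ‖z‖ ≤ ρ) (p : Polynomial ℂ) :
    evConv z hz (⟨p, coe_mem_convSubring p⟩ : convSubring ρ hρ) = p.eval z := by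
  rw [evConv_apply, Polynomial.eval_eq_sum, Polynomial.sum, tsum_eq_sum (s := p.support)]
  · simp
  · intro m hm
    rw [Polynomial.notMem_support_iff] at hm
    simp [hm]

lemma norm_evConv_le (hρ0 : 0 < ρ) {z : ℂ} (hz : ‖z‖ ≤ ρ) (x : convSubring ρ hρ) {T : ℕ}
    (hT : (X : ℂ⟦X⟧) ^ T ∣ x) :
    ‖evConv z hz x‖ ≤ (‖z‖ / ρ) ^ T * ∑' m, ‖coeff m (x : ℂ⟦X⟧) * (ρ : ℂ) ^ m‖ := by
  rw [evConv_apply, ← tsum_mul_left]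
  refine tsum_of_norm_bounded ((mem_convSubring.mp x.2).mul_left _).hasSum fun m => ?_
  rcases Nat.lt_or_ge m T with h | h
  · simp [PowerSeries.X_pow_dvd_iff.mp hT m h]
  · have h1 : (‖z‖ / ρ) ^ m ≤ (‖z‖ / ρ) ^ T :=
      pow_le_pow_of_le_one (by positivity) ((div_le_one hρ0).mpr hz) h
    have h2 : ‖z‖ ^ m = (‖z‖ / ρ) ^ m * ρ ^ m := by
      rw [div_pow, div_mul_cancel₀]
      positivity
    rw [norm_mul, norm_mul, norm_pow, norm_pow, Complex.norm_real, Real.norm_of_nonneg hρ, h2]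
    calc _ = (‖z‖ / ρ) ^ m * (‖coeff m (x : ℂ⟦X⟧)‖ * ρ ^ m) := by ring
      _ ≤ _ := by gcongr

variable {t : ℕ}

/-- A bound for the values of polynomials whose coefficients are convergent power series divisible
by a high power of the variable. -/
lemma exists_norm_eval_le {R : Type*} [CommRing R] (hρ0 : 0 < ρ) (φ : R →+* convSubring ρ hρ)
    (G : MvPolynomial (Fin t) R) {T d : ℕ}
    (hG : ∀ e, (X : ℂ⟦X⟧) ^ T ∣ φ (G.coeff e)) (hd : ∀ s, G.degreeOf s ≤ d) :
    ∃ C : ℝ, 0 ≤ C ∧ ∀ (z : ℂ) (hz : ‖z‖ ≤ ρ) (w : Fin t → ℂ) (W : ℝ), 1 ≤ W → (∀ s, ‖w s‖ ≤ W) →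
      ‖MvPolynomial.eval₂ ((evConv z hz).comp φ) w G‖ ≤ C * (‖z‖ / ρ) ^ T * W ^ (t * d) := by
  refine ⟨∑ e ∈ G.support, ∑' m, ‖coeff m (φ (G.coeff e) : ℂ⟦X⟧) * (ρ : ℂ) ^ m‖,
    Finset.sum_nonneg fun e _ => tsum_nonneg fun _ => norm_nonneg _, fun z hz w W hW hw => ?_⟩
  rw [MvPolynomial.eval₂_eq', Finset.sum_mul, Finset.sum_mul]
  refine norm_sum_le_of_le _ fun e he => ?_
  rw [norm_mul, norm_prod]
  have h1 : ∏ s, ‖w s ^ e s‖ ≤ W ^ (t * d) := by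
    calc ∏ s, ‖w s ^ e s‖ ≤ ∏ _s : Fin t, W ^ d := by
          refine Finset.prod_le_prod (fun _ _ => norm_nonneg _) fun s _ => ?_
          rw [norm_pow]
          have h3 : e s ≤ d := (MvPolynomial.le_degreeOf_of_mem_support s he).trans (hd s)
          exact (pow_le_pow_left₀ (norm_nonneg _) (hw s) _).trans (pow_le_pow_right₀ hW h3)
      _ = _ := by simp [← pow_mul, mul_comm]
  have h2 := norm_evConv_le hρ0 hz (φ (G.coeff e)) (hG e)
  have h4 : 0 ≤ ∑' m, ‖coeff m (φ (G.coeff e) : ℂ⟦X⟧) * (ρ : ℂ) ^ m‖ :=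
    tsum_nonneg fun _ => norm_nonneg _
  calc _ ≤ ((‖z‖ / ρ) ^ T * ∑' m, ‖coeff m (φ (G.coeff e) : ℂ⟦X⟧) * (ρ : ℂ) ^ m‖) * W ^ (t * d) := by
        refine mul_le_mul h2 h1 (Finset.prod_nonneg fun _ _ => norm_nonneg _) ?_
        positivity
    _ = _ := by ring

end Convergence
end Mahler

namespace Mahler
open Finset PowerSeries Filter

section Orbit
variable {L : Type*} [Field L] {n : ℕ}

/-- The orbit of a linear form under the cocycle of a Mahler system. -/
def orbit (q : ℕ) (A : Matrix (Fin n) (Fin n) (Polynomial L)) (β : L) (c : Fin n → L) :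
    ℕ → Fin n → L
  | 0 => c
  | k + 1 => Matrix.vecMul (orbit q A β c k) (A.map (Polynomial.eval (β ^ q ^ k)))

theorem orbit_ne_zero {q : ℕ} {A : Matrix (Fin n) (Fin n) (Polynomial L)} {β : L} {c : Fin n → L}
    (hA : ∀ k : ℕ, (A.map (Polynomial.eval (β ^ q ^ k))).det ≠ 0) (hc : c ≠ 0) (k : ℕ) :
    orbit q A β c k ≠ 0 := by
  induction k with
  | zero => exact hc
  | succ k ih => exact fun h => ih (Matrix.eq_zero_of_vecMul_eq_zero (hA k) h)

variable [NumberField L]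

theorem exists_sizeLe_orbit {q : ℕ} (hq : 2 ≤ q) (hn : 0 < n)
    (A : Matrix (Fin n) (Fin n) (Polynomial L)) (β : L) (c : Fin n → L) :
    ∃ Λ : ℕ, 0 < Λ ∧ (∀ k, SizeLe (Λ ^ q ^ k) (β ^ q ^ k)) ∧
      ∀ k j, SizeLe (Λ ^ q ^ k) (orbit q A β c k j) := by
  obtain ⟨d, hd, hβ⟩ := exists_sizeLe β
  have hβ' : Growth q d 1 (fun k => β ^ q ^ k) := ⟨1, one_pos, fun k => by simpa using hβ.pow _⟩
  let D := ∑ i, ∑ j, (A i j).natDegree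
  have hD : ∀ i j, (A i j).natDegree ≤ D := fun i j =>
    (Finset.single_le_sum (f := fun j => (A i j).natDegree) (fun _ _ => Nat.zero_le _)
      (Finset.mem_univ j)).trans (Finset.single_le_sum (f := fun i => ∑ j, (A i j).natDegree)
      (fun _ _ => Nat.zero_le _) (Finset.mem_univ i))
  choose e he hAe using fun i j => Growth.polynomial_eval hd hβ' (A i j) (hD i j)
  let E := ∏ i, ∏ j, e i j
  have hE : 0 < E := Finset.prod_pos fun i _ => Finset.prod_pos fun j _ => he i j
  have hEd : ∀ i j, e i j ∣ E := fun i j =>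
    (Finset.dvd_prod_of_mem (e i) (Finset.mem_univ j)).trans
      (Finset.dvd_prod_of_mem (fun i => ∏ j, e i j) (Finset.mem_univ i))
  obtain ⟨c₀, hc₀, hc⟩ := exists_sizeLe_forall c
  let Λ := c₀ * (n * E * d ^ D) * d
  have hΛ : 0 < Λ := by positivity
  refine ⟨Λ, hΛ, fun k => ?_, fun k => ?_⟩
  · refine (hβ.pow (q ^ k)).mono (pow_dvd_pow_of_dvd (Dvd.intro_left _ rfl) _) (pow_pos hΛ _)
  · induction k with
    | zero =>
      intro j
      refine (hc j).mono ?_ (pow_pos hΛ _)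
      rw [pow_zero, pow_one]
      exact ⟨(n * E * d ^ D) * d, by simp only [Λ]; ring⟩
    | succ k ih =>
      intro j
      have h1 : SizeLe ((Finset.univ : Finset (Fin n)).card * (Λ ^ q ^ k * (E * d ^ (D * q ^ k))))
          (orbit q A β c (k + 1) j) := by
        refine SizeLe.sum fun i _ => (ih i).mul ((hAe i j k).mono ?_ (by positivity))
        exact mul_dvd_mul_right (hEd i j) _
      refine h1.mono ?_ (pow_pos hΛ _)
      have h2 : n * E * d ^ (D * q ^ k) ∣ Λ ^ q ^ k := by
        have h3 : (n * E * d ^ D) ^ q ^ k ∣ Λ ^ q ^ k :=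
          pow_dvd_pow_of_dvd ⟨c₀ * d, by simp only [Λ]; ring⟩ _
        refine dvd_trans ?_ h3
        rw [mul_pow, ← pow_mul]
        exact mul_dvd_mul_right (dvd_pow_self _ (pow_ne_zero _ (by omega))) _
      calc _ = Λ ^ q ^ k * (n * E * d ^ (D * q ^ k)) := by
            rw [Finset.card_univ, Fintype.card_fin]; ring
        _ ∣ Λ ^ q ^ k * Λ ^ q ^ k := mul_dvd_mul_left _ h2
        _ = Λ ^ (2 * q ^ k) := by rw [← pow_add, two_mul]
        _ ∣ Λ ^ q ^ (k + 1) := pow_dvd_pow _ (by rw [pow_succ']; exact Nat.mul_le_mul_right _ hq)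

theorem exists_growth_of_mem_closure {q Λ : ℕ} {ι : Type*} {y : ι → ℕ → L}
    (hy : ∀ j, Growth q Λ 1 (y j)) {x : ℕ → L} (hx : x ∈ Submonoid.closure (Set.range y)) :
    ∃ S, Growth q Λ S x := by
  induction hx using Submonoid.closure_induction with
  | mem x hx =>
    obtain ⟨j, rfl⟩ := hx
    exact ⟨1, hy j⟩
  | one => exact ⟨0, Growth.const 1⟩
  | mul x x' _ _ ih ih' =>
    obtain ⟨S, h⟩ := ih
    obtain ⟨S', h'⟩ := ih'
    exact ⟨S + S', h.mul h'⟩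

theorem Growth.mvPolynomial_eval {q Λ t D M : ℕ} (hΛ : 0 < Λ) {x : ℕ → L} (hx : Growth q Λ 1 x)
    {y : Fin t → ℕ → L} (hy : ∀ s, Growth q Λ 1 (y s)) (P : MvPolynomial (Fin t) (Polynomial L))
    (hD : ∀ e, (P.coeff e).natDegree ≤ D) (hM : ∀ s, P.degreeOf s ≤ M) :
    Growth q Λ (D + t * M)
      (fun k => P.eval₂ (Polynomial.evalRingHom (x k)) (fun s => y s k)) := by
  simp only [MvPolynomial.eval₂_eq']
  refine Growth.sum hΛ fun e he => ((hx.polynomial_eval hΛ _ (hD e)).mul (Growth.prod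
    (S := fun _ => M) fun s _ => ((hy s).pow (e s)).mono hΛ ?_)).mono hΛ (by simp)
  rw [mul_one]
  exact (MvPolynomial.le_degreeOf_of_mem_support s he).trans (hM s)

end Orbit

section Ultrapower
variable {L : Type*} [Field L] {n : ℕ}

/-- Evaluation of the coefficients at `x` and of the variables at `y`. -/
abbrev evBoth {t : ℕ} (x : L) (y : Fin t → L) : MvPolynomial (Fin t) (Polynomial L) →+* L :=
  MvPolynomial.eval₂Hom (Polynomial.evalRingHom x) y

theorem exists_representation_along {x : ℕ → L} (hx : Function.Injective x)
    {y : ℕ → Fin n → L} (hy : ∀ k, y k ≠ 0) :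
    ∃ (t : ℕ) (w : Fin t → Fin n) (m : ℕ) (b : Fin m → ℕ → L)
      (Y : Fin n → Matrix (Fin m) (Fin m) (MvPolynomial (Fin t) (Polynomial L)))
      (Δ : MvPolynomial (Fin t) (Polynomial L)), 0 < m ∧
      (∀ i, b i ∈ Submonoid.closure (Set.range fun j k => y k j)) ∧
      (∀ Q : Fin m → MvPolynomial (Fin t) (Polynomial L), Q ≠ 0 → ∀ᶠ k in (hyperfilter ℕ : Filter ℕ),
        ∑ i, evBoth (x k) (fun s => y k (w s)) (Q i) * b i k ≠ 0) ∧
      (∀ j i, ∀ᶠ k in (hyperfilter ℕ : Filter ℕ),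
        ∑ l, evBoth (x k) (fun s => y k (w s)) (Y j i l) * b l k =
          evBoth (x k) (fun s => y k (w s)) Δ * y k j * b i k) ∧
      (∀ i j, Y i * Y j = Y j * Y i) ∧ ∃ j, (Y j).det ≠ 0 := by
  classical
  let l : Filter ℕ := (hyperfilter ℕ : Filter ℕ)
  let _ : Field (l.Germ L) := Filter.Germ.instField
  let φ : Polynomial L →+* l.Germ L :=
    (Germ.coeRingHom l).comp (RingHom.pi fun k => Polynomial.evalRingHom (x k))
  have hφ : Function.Injective φ := by
    rw [injective_iff_map_eq_zero]
    intro p hp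
    have hp' : ∀ᶠ k in l, p.eval (x k) = 0 := Germ.coe_eq.mp hp
    by_contra hp0
    have hfin : {k | p.eval (x k) = 0}.Finite := by
      refine ((p.roots.toFinset.finite_toSet).preimage hx.injOn).subset fun k hk => ?_
      simpa [hp0] using hk
    exact notMem_hyperfilter_of_finite hfin hp'
  let _ : Algebra (Polynomial L) (l.Germ L) := φ.toAlgebra
  have : FaithfulSMul (Polynomial L) (l.Germ L) :=
    (faithfulSMul_iff_algebraMap_injective _ _).mpr hφ
  let ys : Fin n → l.Germ L := fun j => ((fun k => y k j : ℕ → L) : l.Germ L)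
  obtain ⟨t, w, m, b, Y, Δ, hm, -, hb, hQ, hY, hcomm, hdet⟩ :=
    exists_regular_representation (D := Polynomial L) ys
  have hb' : ∀ i, ∃ b' : ℕ → L, b' ∈ Submonoid.closure (Set.range fun j k => y k j) ∧
      (b' : l.Germ L) = b i := by
    intro i
    have h1 : Set.range ys = (Germ.coeMulHom l : (ℕ → L) →* l.Germ L) ''
        (Set.range fun j k => y k j) := by
      rw [← Set.range_comp]
      rfl
    have h2 := hb i
    rw [h1, ← MonoidHom.map_mclosure] at h2
    obtain ⟨b', h3, h4⟩ := h2
    exact ⟨b', h3, h4⟩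
  choose b' hb'mem hb' using hb'
  have hev : ∀ P : MvPolynomial (Fin t) (Polynomial L), MvPolynomial.aeval (ys ∘ w) P =
      ((fun k => evBoth (x k) (fun s => y k (w s)) P : ℕ → L) : l.Germ L) := by
    intro P
    let ψ : MvPolynomial (Fin t) (Polynomial L) →+* l.Germ L :=
      (Germ.coeRingHom l).comp (RingHom.pi fun k => evBoth (x k) (fun s => y k (w s)))
    have : (MvPolynomial.aeval (ys ∘ w) : _ →ₐ[Polynomial L] l.Germ L).toRingHom = ψ := by
      refine MvPolynomial.ringHom_ext (fun p => ?_) fun s => ?_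
      · have h1 : ψ (MvPolynomial.C p) = φ p := by
          change Germ.coeRingHom l _ = Germ.coeRingHom l _
          congr 1
          funext k
          simp
        rw [h1]
        exact MvPolynomial.aeval_C _ _
      · have h1 : ψ (MvPolynomial.X s) = ys (w s) := by
          change Germ.coeRingHom l _ = Germ.coeRingHom l (fun k => y k (w s))
          congr 1
          funext k
          simp
        rw [h1]
        exact MvPolynomial.aeval_X _ _
    exact congrArg (fun f => f P) this
  have hsum : ∀ Q : Fin m → MvPolynomial (Fin t) (Polynomial L),
      ∑ i, MvPolynomial.aeval (ys ∘ w) (Q i) * b i =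
      ((fun k => ∑ i, evBoth (x k) (fun s => y k (w s)) (Q i) * b' i k : ℕ → L) : l.Germ L) := by
    intro Q
    have h1 : (fun k => ∑ i, evBoth (x k) (fun s => y k (w s)) (Q i) * b' i k : ℕ → L) =
        ∑ i, (fun k => evBoth (x k) (fun s => y k (w s)) (Q i)) * b' i := by
      funext k
      simp
    rw [h1]
    change _ = Germ.coeRingHom l _
    rw [map_sum]
    refine Finset.sum_congr rfl fun i _ => ?_
    rw [map_mul, hev, ← hb' i]
    rfl
  refine ⟨t, w, m, b', Y, Δ, hm, hb'mem, fun Q hQ0 => ?_, fun j i => ?_, hcomm, ?_⟩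
  · have h1 : ¬ ∀ᶠ k in l, ∑ i, evBoth (x k) (fun s => y k (w s)) (Q i) * b' i k = 0 := by
      intro h
      exact hQ0 (hQ Q ((hsum Q).trans (Germ.coe_eq.mpr h)))
    exact Ultrafilter.eventually_not.mpr h1
  · have h1 := hY j i
    rw [hsum, hev, ← hb' i] at h1
    exact Germ.coe_eq.mp h1
  · by_contra hcon
    push Not at hcon
    have h1 : ∀ j, ∀ᶠ k in l, y k j = 0 := by
      intro j
      have : ys j = 0 := by
        by_contra h
        exact hdet j h (hcon j)
      exact Germ.coe_eq.mp this
    obtain ⟨k, hk⟩ := (eventually_all.mpr h1).exists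
    exact hy k (funext hk)

end Ultrapower
end Mahler

namespace Mahler
open Finset PowerSeries Filter

section Core
variable {L : Type*} [Field L] {n m t : ℕ}

theorem map_coe_polynomial {R S : Type*} [CommSemiring R] [CommSemiring S] (ι : R →+* S)
    (p : Polynomial R) : PowerSeries.map ι (p : R⟦X⟧) = ((p.map ι : Polynomial S) : S⟦X⟧) := by
  ext k
  simp

theorem map_polynomial_smul {S : Type*} [Field S] (ι : L →+* S) (p : Polynomial L) (f : L⟦X⟧) :
    PowerSeries.map ι (p • f) = p.map ι • PowerSeries.map ι f := by
  rw [poly_smul_eq, poly_smul_eq, map_mul, map_coe_polynomial]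

theorem map_sig {S : Type*} [Field S] (ι : L →+* S) (q : ℕ) [NeZero q] (f : L⟦X⟧) :
    PowerSeries.map ι (sig q f) = sig q (PowerSeries.map ι f) :=
  PowerSeries.map_expand q (NeZero.ne q) ι f

theorem map_system {S : Type*} [Field S] (ι : L →+* S) {q : ℕ} [NeZero q] {g : Fin n → L⟦X⟧}
    {δ : Polynomial L} {A : Matrix (Fin n) (Fin n) (Polynomial L)}
    (hA : ∀ i, δ • g i = ∑ j, A i j • sig q (g j)) (i : Fin n) :
    δ.map ι • PowerSeries.map ι (g i) =
      ∑ j, (A i j).map ι • sig q (PowerSeries.map ι (g j)) := by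
  rw [← map_polynomial_smul, hA i, map_sum]
  exact Finset.sum_congr rfl fun j _ => by rw [map_polynomial_smul, map_sig]

theorem det_pencil_ne_zero (ι : L →+* ℂ) {q : ℕ} [NeZero q] (hq : 2 ≤ q) {g : Fin n → L⟦X⟧}
    (hg : LinearIndependent (Polynomial ℂ) (fun j => PowerSeries.map ι (g j)))
    {δ : Polynomial L} (hδ : δ ≠ 0) {A : Matrix (Fin n) (Fin n) (Polynomial L)}
    (hA : ∀ i, δ • g i = ∑ j, A i j • sig q (g j))
    {Y : Fin n → Matrix (Fin m) (Fin m) (MvPolynomial (Fin t) (Polynomial L))}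
    (hcomm : ∀ i j, Y i * Y j = Y j * Y i) {j₀ : Fin n} (hdet : (Y j₀).det ≠ 0) :
    (∑ j, (MvPolynomial.C (g j) : MvPolynomial (Fin t) L⟦X⟧) • (Y j).map polyMap).det ≠ 0 := by
  obtain ⟨w, hw⟩ : ∃ w : Fin t → Polynomial L, MvPolynomial.eval w (Y j₀).det ≠ 0 := by
    by_contra! h
    exact hdet (MvPolynomial.funext fun w => by rw [h w, map_zero])
  let ψ : MvPolynomial (Fin t) (Polynomial L) →+* Polynomial ℂ :=
    (Polynomial.mapRingHom ι).comp (MvPolynomial.eval w)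
  let θ : MvPolynomial (Fin t) L⟦X⟧ →+* ℂ⟦X⟧ :=
    MvPolynomial.eval₂Hom (PowerSeries.map ι) (fun s => PowerSeries.map ι (w s : L⟦X⟧))
  have hθψ : ∀ P, θ (polyMap P) = algebraMap (Polynomial ℂ) ℂ⟦X⟧ (ψ P) := by
    intro P
    have : θ.comp polyMap = (algebraMap (Polynomial ℂ) ℂ⟦X⟧).comp ψ := by
      refine MvPolynomial.ringHom_ext (fun p => ?_) fun s => ?_
      · simp only [RingHom.comp_apply, polyMap, MvPolynomial.map_C, θ, ψ,
          MvPolynomial.coe_eval₂Hom, MvPolynomial.eval₂_C, MvPolynomial.eval_C]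
        exact map_coe_polynomial ι p
      · simp only [RingHom.comp_apply, polyMap, MvPolynomial.map_X, θ, ψ,
          MvPolynomial.coe_eval₂Hom, MvPolynomial.eval₂_X, MvPolynomial.eval_X]
        exact map_coe_polynomial ι (w s)
    exact congrArg (fun f => f P) this
  have key := det_sum_ne_zero q hq hg (δ := δ.map ι)
    ((Polynomial.map_ne_zero_iff ι.injective).mpr hδ) (A := fun i j => (A i j).map ι)
    (map_system ι hA) (fun j => ψ.mapMatrix (Y j))
    (fun i j => by rw [← map_mul, ← map_mul, hcomm]) j₀ (by
      rw [← RingHom.map_det]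
      exact (Polynomial.map_ne_zero_iff ι.injective).mpr hw)
  intro h
  apply key
  have h2 := congrArg θ h
  rw [RingHom.map_det, map_zero] at h2
  rw [← h2]
  congr 1
  rw [map_sum]
  refine Finset.sum_congr rfl fun j _ => ?_
  ext1 i l
  simp only [Matrix.smul_apply, Matrix.map_apply, RingHom.mapMatrix_apply, smul_eq_mul, map_mul,
    hθψ]
  simp [θ]

end Core
end Mahler

namespace Mahler
open Finset PowerSeries Filter

section Core

theorem false_of_one_le_mul_pow {q : ℕ} (hq : 2 ≤ q) {C θ : ℝ} (h0 : 0 ≤ θ) (h1 : θ < 1)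
    (h : ∀ᶠ k in (hyperfilter ℕ : Filter ℕ), 1 ≤ C * θ ^ q ^ k) : False := by
  have hlim : Tendsto (fun k : ℕ => C * θ ^ q ^ k) atTop (nhds (C * 0)) :=
    ((tendsto_pow_atTop_nhds_zero_of_lt_one h0 h1).comp
      (tendsto_pow_atTop_atTop_of_one_lt (by omega : 1 < q))).const_mul C
  rw [mul_zero] at hlim
  have h2 := (hlim.eventually_lt_const one_pos).filter_mono Nat.hyperfilter_le_atTop
  obtain ⟨k, hk, hk'⟩ := (h.and h2).exists
  linarith

theorem sum_vecMul_pow_dotProduct {R : Type*} [CommRing R] {m : ℕ} {F : Matrix (Fin m) (Fin m) R}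
    {b : Fin m → R} (hb : Matrix.mulVec F b = 0) (p : ℕ → Fin m → R) (J : ℕ) :
    (∑ j ∈ range (J + 1), Matrix.vecMul (p j) (F ^ j)) ⬝ᵥ b = p 0 ⬝ᵥ b := by
  rw [sum_dotProduct, Finset.sum_eq_single 0]
  · simp
  · intro j _ hj
    obtain ⟨j, rfl⟩ := Nat.exists_eq_succ_of_ne_zero hj
    rw [← Matrix.dotProduct_mulVec, pow_succ, ← Matrix.mulVec_mulVec, hb, Matrix.mulVec_zero,
      dotProduct_zero]
  · simp

variable {L : Type*} [Field L] {n m t : ℕ}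

/-- The power series over `L` whose image under `ι` converges absolutely at radius `ρ`. -/
abbrev convOver (ι : L →+* ℂ) (ρ : ℝ) (hρ : 0 ≤ ρ) : Subring L⟦X⟧ :=
  (convSubring ρ hρ).comap (PowerSeries.map ι)

variable (ι : L →+* ℂ) {ρ : ℝ} (hρ : 0 ≤ ρ)

/-- The base change of a convergent power series along `ι`. -/
def convMap : convOver ι ρ hρ →+* convSubring ρ hρ :=
  (PowerSeries.map ι).restrict _ _ fun _ hx => hx

/-- Polynomials as convergent power series. -/
def polyToConv : Polynomial L →+* convOver ι ρ hρ :=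
  (algebraMap (Polynomial L) L⟦X⟧).codRestrict _ fun p => by
    change PowerSeries.map ι (p : L⟦X⟧) ∈ convSubring ρ hρ
    rw [map_coe_polynomial]
    exact coe_mem_convSubring _

/-- Evaluation of polynomials with convergent coefficients. -/
def evPoint {β : L} (hβ : ‖ι β‖ ≤ ρ) (y : Fin t → L) :
    MvPolynomial (Fin t) (convOver ι ρ hρ) →+* ℂ :=
  MvPolynomial.eval₂Hom ((evConv (ι β) hβ).comp (convMap ι hρ)) fun s => ι (y s)

theorem evPoint_C {β : L} (hβ : ‖ι β‖ ≤ ρ) (y : Fin t → L) (x : convOver ι ρ hρ) :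
    evPoint ι hρ hβ y (MvPolynomial.C x) =
      ∑' k, coeff k (PowerSeries.map ι (x : L⟦X⟧)) * ι β ^ k := by
  simp only [evPoint, MvPolynomial.coe_eval₂Hom, MvPolynomial.eval₂_C]
  rfl

theorem evPoint_map {β : L} (hβ : ‖ι β‖ ≤ ρ) (y : Fin t → L)
    (P : MvPolynomial (Fin t) (Polynomial L)) :
    evPoint ι hρ hβ y (MvPolynomial.map (polyToConv ι hρ) P) = ι (evBoth β y P) := by
  have : (evPoint ι hρ hβ y).comp (MvPolynomial.map (polyToConv ι hρ)) = ι.comp (evBoth β y) := by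
    refine MvPolynomial.ringHom_ext (fun p => ?_) fun s => ?_
    · simp only [RingHom.comp_apply, MvPolynomial.map_C, evPoint, evBoth,
        MvPolynomial.coe_eval₂Hom, MvPolynomial.eval₂_C, Polynomial.coe_evalRingHom]
      have h := evConv_coe (hρ := hρ) hβ (p.map ι)
      rw [Polynomial.eval_map_apply] at h
      rw [← h]
      exact congrArg _ (Subtype.ext (map_coe_polynomial ι p))
    · simp [evPoint]
  exact congrArg (fun f => f P) this

end Core
end Mahler

namespace Mahler
open Finset PowerSeries Filter

section Values

/-- The sum of a power series at a point. -/
def psVal (x : ℂ⟦X⟧) (z : ℂ) : ℂ := ∑' m, coeff m x * z ^ m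

theorem psVal_sig (q : ℕ) [NeZero q] (x : ℂ⟦X⟧) (z : ℂ) :
    psVal (sig q x) z = psVal x (z ^ q) := by
  have hq : q ≠ 0 := NeZero.ne q
  have hinj : Function.Injective fun m : ℕ => q * m := fun a b h => Nat.eq_of_mul_eq_mul_left
    (Nat.pos_of_ne_zero hq) h
  rw [psVal, psVal, ← hinj.tsum_eq]
  · refine tsum_congr fun m => ?_
    rw [coeff_expand_mul, pow_mul]
  · intro m hm
    by_contra h
    apply hm
    have : ¬ q ∣ m := fun ⟨r, hr⟩ => h ⟨r, hr.symm⟩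
    dsimp only
    rw [coeff_expand_of_not_dvd _ _ _ this, zero_mul]

variable {ρ : ℝ} {hρ : 0 ≤ ρ}

theorem sig_mem_convSubring (q : ℕ) [NeZero q] (hρ1 : ρ ≤ 1) {x : ℂ⟦X⟧}
    (hx : x ∈ convSubring ρ hρ) : sig q x ∈ convSubring ρ hρ := by
  have hq : q ≠ 0 := NeZero.ne q
  have hinj : Function.Injective fun m : ℕ => q * m := fun a b h => Nat.eq_of_mul_eq_mul_left
    (Nat.pos_of_ne_zero hq) h
  rw [mem_convSubring, ← hinj.summable_iff]
  · refine Summable.of_nonneg_of_le (fun _ => norm_nonneg _) (fun m => ?_) hx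
    simp only [Function.comp_apply]
    rw [coeff_expand_mul, norm_mul, norm_mul, norm_pow, norm_pow, Complex.norm_real,
      Real.norm_of_nonneg hρ]
    refine mul_le_mul_of_nonneg_left ?_ (norm_nonneg _)
    exact pow_le_pow_of_le_one hρ hρ1 (Nat.le_mul_of_pos_left m (Nat.pos_of_ne_zero hq))
  · intro m h
    have : ¬ q ∣ m := fun ⟨r, hr⟩ => h ⟨r, hr.symm⟩
    rw [coeff_expand_of_not_dvd _ _ _ this, zero_mul, norm_zero]

theorem psVal_sum_smul {n : ℕ} {g : Fin n → ℂ⟦X⟧} (hg : ∀ j, g j ∈ convSubring ρ hρ)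
    (p : Fin n → Polynomial ℂ) {z : ℂ} (hz : ‖z‖ ≤ ρ) :
    psVal (∑ j, p j • g j) z = ∑ j, (p j).eval z * psVal (g j) z := by
  have h := map_sum (evConv (hρ := hρ) z hz)
    (fun j => (⟨p j, coe_mem_convSubring (p j)⟩ * ⟨g j, hg j⟩ : convSubring ρ hρ)) Finset.univ
  simp only [map_mul, evConv_coe] at h
  rw [evConv_apply] at h
  simp only [evConv_apply] at h
  refine Eq.trans ?_ h
  rw [psVal]
  refine tsum_congr fun m => ?_
  congr 2
  simp only [AddSubmonoidClass.coe_finsetSum, Subring.coe_mul, poly_smul_eq]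

theorem psVal_smul {g : ℂ⟦X⟧} (hg : g ∈ convSubring ρ hρ) (p : Polynomial ℂ) {z : ℂ}
    (hz : ‖z‖ ≤ ρ) : psVal (p • g) z = p.eval z * psVal g z := by
  have := psVal_sum_smul (n := 1) (fun _ => hg) (fun _ => p) hz
  simpa using this

end Values

section Core
variable {L : Type*} [Field L] {n m t : ℕ} (ι : L →+* ℂ) {ρ : ℝ} {hρ : 0 ≤ ρ}

theorem sum_orbit_mul_psVal {q : ℕ} [NeZero q] {g : Fin n → L⟦X⟧}
    {δ : Polynomial L} {A : Matrix (Fin n) (Fin n) (Polynomial L)}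
    (hA : ∀ i, δ • g i = ∑ j, A i j • sig q (g j)) (hρ1 : ρ ≤ 1)
    (hg : ∀ j, PowerSeries.map ι (g j) ∈ convSubring ρ hρ) {β : L} (hβ : ‖ι β‖ ≤ ρ)
    {c : Fin n → L} (hc : ∑ j, ι (c j) * psVal (PowerSeries.map ι (g j)) (ι β) = 0) (k : ℕ) :
    ∑ j, ι (orbit q A β c k j) * psVal (PowerSeries.map ι (g j)) (ι (β ^ q ^ k)) = 0 := by
  induction k with
  | zero => simpa [orbit] using hc
  | succ k ih =>
    have hz : ‖ι (β ^ q ^ k)‖ ≤ ρ := by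
      rw [map_pow, norm_pow]
      exact (pow_le_of_le_one (norm_nonneg _) (hβ.trans hρ1)
        (pow_ne_zero _ (NeZero.ne q))).trans hβ
    have key : ∀ i, ι (δ.eval (β ^ q ^ k)) * psVal (PowerSeries.map ι (g i)) (ι (β ^ q ^ k)) =
        ∑ j, ι ((A i j).eval (β ^ q ^ k)) *
          psVal (PowerSeries.map ι (g j)) (ι (β ^ q ^ (k + 1))) := by
      intro i
      rw [← Polynomial.eval_map_apply, ← psVal_smul (hg i) _ hz, map_system ι hA i,
        psVal_sum_smul (fun j => sig_mem_convSubring q hρ1 (hg j)) _ hz]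
      refine Finset.sum_congr rfl fun j _ => ?_
      rw [Polynomial.eval_map_apply, psVal_sig, ← map_pow, ← pow_mul, ← pow_succ]
    calc _ = ∑ j, ∑ i, ι (orbit q A β c k i) * (ι ((A i j).eval (β ^ q ^ k)) *
          psVal (PowerSeries.map ι (g j)) (ι (β ^ q ^ (k + 1)))) := by
          refine Finset.sum_congr rfl fun j _ => ?_
          simp only [orbit, Matrix.vecMul, dotProduct, map_sum, map_mul, Finset.sum_mul,
            Matrix.map_apply, mul_assoc]
      _ = ∑ i, ι (orbit q A β c k i) * (ι (δ.eval (β ^ q ^ k)) *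
          psVal (PowerSeries.map ι (g i)) (ι (β ^ q ^ k))) := by
          rw [Finset.sum_comm]
          refine Finset.sum_congr rfl fun i _ => ?_
          rw [key i, Finset.mul_sum]
      _ = ι (δ.eval (β ^ q ^ k)) * ∑ i, ι (orbit q A β c k i) *
          psVal (PowerSeries.map ι (g i)) (ι (β ^ q ^ k)) := by
          rw [Finset.mul_sum]
          exact Finset.sum_congr rfl fun i _ => by ring
      _ = 0 := by rw [ih, mul_zero]

/-- If a linear combination `p 0 + p 1 * F + ⋯` of powers of a pencil vanishes to high order, its
product with a vector killed by the pencil is small. -/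
theorem exists_upper_bound (hρ0 : 0 < ρ) {Λ q a M T J : ℕ} (hΛ : 0 < Λ)
    {β : L} (hβ : ∀ k, ‖ι (β ^ q ^ k)‖ ≤ ρ) {y : ℕ → Fin t → L}
    (hy : ∀ k s, ‖ι (y k s)‖ ≤ (Λ : ℝ) ^ q ^ k)
    (F : Matrix (Fin m) (Fin m) (MvPolynomial (Fin t) (convOver ι ρ hρ)))
    (ha : ∀ i j s, (F i j).degreeOf s ≤ a)
    (p : ℕ → Fin m → MvPolynomial (Fin t) (Polynomial L)) (hJ : J ≤ M)
    (hp : ∀ j i s, (p j i).degreeOf s ≤ M)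
    (hT : ∀ i, MvPolynomial.C (X ^ T) ∣
        ∑ j ∈ range (J + 1), Matrix.vecMul (fun i => polyMap (p j i))
          ((MvPolynomial.map (convOver ι ρ hρ).subtype).mapMatrix F ^ j) i)
    {b : ℕ → Fin m → L} {S e : ℕ} (hb : ∀ k i, ‖ι (b k i)‖ ≤ e * (Λ : ℝ) ^ (S * q ^ k)) :
    ∃ C : ℝ, 0 ≤ C ∧ ∀ k,
      (∀ i, ∑ l, evPoint ι hρ (hβ k) (y k) (F i l) * ι (b k l) = 0) →
      ‖ι (∑ i, evBoth (β ^ q ^ k) (y k) (p 0 i) * b k i)‖ ≤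
        C * (‖ι β‖ ^ T * (Λ : ℝ) ^ (t * (M * (1 + a)) + S)) ^ q ^ k := by
  classical
  let P : ℕ → Fin m → MvPolynomial (Fin t) (convOver ι ρ hρ) :=
    fun j i => MvPolynomial.map (polyToConv ι hρ) (p j i)
  let G : Fin m → MvPolynomial (Fin t) (convOver ι ρ hρ) :=
    ∑ j ∈ range (J + 1), Matrix.vecMul (P j) (F ^ j)
  have hPmap : ∀ j i, MvPolynomial.map (convOver ι ρ hρ).subtype (P j i) = polyMap (p j i) := by
    intro j i
    simp only [P, polyMap, MvPolynomial.map_map]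
    rfl
  have hGmap : ∀ i, MvPolynomial.map (convOver ι ρ hρ).subtype (G i) =
      ∑ j ∈ range (J + 1), Matrix.vecMul (fun i => polyMap (p j i))
        ((MvPolynomial.map (convOver ι ρ hρ).subtype).mapMatrix F ^ j) i := by
    intro i
    simp only [G, Finset.sum_apply, map_sum]
    refine Finset.sum_congr rfl fun j _ => ?_
    rw [← map_pow]
    simp only [Matrix.vecMul, dotProduct, map_sum, map_mul, hPmap, RingHom.mapMatrix_apply,
      Matrix.map_apply]
  have hGdvd : ∀ i e, (X : ℂ⟦X⟧) ^ T ∣ (convMap ι hρ ((G i).coeff e) : ℂ⟦X⟧) := by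
    intro i e
    have h1 := hT i
    rw [← hGmap i, MvPolynomial.C_dvd_iff_dvd_coeff] at h1
    have h2 := map_dvd (PowerSeries.map ι) (h1 e)
    rw [map_pow, PowerSeries.map_X, MvPolynomial.coeff_map] at h2
    exact h2
  have hGdeg : ∀ i s, (G i).degreeOf s ≤ M * (1 + a) := by
    intro i s
    simp only [G, Finset.sum_apply]
    refine degreeOf_sum_le' _ _ _ fun j hj => ?_
    have hPdeg : ∀ i, (P j i).degreeOf s ≤ M := fun i =>
      (MvPolynomial.degreeOf_le_iff.mpr fun e he => MvPolynomial.degreeOf_le_iff.mp le_rfl e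
        (MvPolynomial.support_map_subset _ _ he)).trans (hp j i s)
    refine (degreeOf_vecMul_pow_le hPdeg (fun i l => ha i l s) j i).trans ?_
    have := Nat.lt_succ_iff.mp (Finset.mem_range.mp hj)
    nlinarith [Nat.mul_le_mul_right a (this.trans hJ)]
  choose C hC0 hC using fun i => exists_norm_eval_le hρ0 (convMap ι hρ) (G i) (hGdvd i) (hGdeg i)
  refine ⟨∑ i, C i * e / ρ ^ T, Finset.sum_nonneg fun i _ => ?_, fun k hk => ?_⟩
  · have := hC0 i
    positivity
  have h1 : ι (∑ i, evBoth (β ^ q ^ k) (y k) (p 0 i) * b k i) =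
      ∑ i, evPoint ι hρ (hβ k) (y k) (G i) * ι (b k i) := by
    have h2 := sum_vecMul_pow_dotProduct (F := (evPoint ι hρ (hβ k) (y k)).mapMatrix F)
      (b := fun l => ι (b k l)) (funext hk) (fun j i => evPoint ι hρ (hβ k) (y k) (P j i)) J
    simp only [dotProduct] at h2
    rw [map_sum]
    refine Eq.trans ?_ (h2.symm.trans ?_)
    · refine Finset.sum_congr rfl fun i _ => ?_
      rw [map_mul, evPoint_map]
    · refine Finset.sum_congr rfl fun i _ => ?_
      congr 1
      simp only [G, Finset.sum_apply, map_sum]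
      refine Finset.sum_congr rfl fun j _ => ?_
      rw [← map_pow]
      simp only [Matrix.vecMul, dotProduct, map_sum, map_mul, RingHom.mapMatrix_apply,
        Matrix.map_apply]
  rw [h1, Finset.sum_mul]
  refine norm_sum_le_of_le _ fun i _ => ?_
  have hΛ1 : (1 : ℝ) ≤ (Λ : ℝ) ^ q ^ k := one_le_pow₀ (by exact_mod_cast hΛ)
  have h3 := hC i (ι (β ^ q ^ k)) (hβ k) (fun s => ι (y k s)) _ hΛ1 (hy k)
  rw [norm_mul]
  calc _ ≤ (C i * (‖ι (β ^ q ^ k)‖ / ρ) ^ T * ((Λ : ℝ) ^ q ^ k) ^ (t * (M * (1 + a)))) *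
        (e * (Λ : ℝ) ^ (S * q ^ k)) := by
        refine mul_le_mul h3 (hb k i) (norm_nonneg _) ?_
        have := hC0 i
        positivity
    _ = _ := by
        rw [map_pow, norm_pow, div_pow, mul_pow, ← pow_mul, ← pow_mul, ← pow_mul, ← pow_mul,
          add_mul, pow_add, mul_comm (q ^ k) T, mul_comm (q ^ k) (t * _)]
        ring

end Core
end Mahler

namespace Mahler
open Finset PowerSeries Filter

section Core
variable {L : Type*} [Field L] [NumberField L] {n : ℕ}

/-- Linear relations between the values at a regular point of the solutions of a Mahler system come
from linear relations between the functions. -/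
theorem eq_zero_of_sum_psVal_eq_zero (ι : L →+* ℂ) {q : ℕ} [NeZero q] (hq : 2 ≤ q)
    {g : Fin n → L⟦X⟧}
    (hg : LinearIndependent (Polynomial ℂ) (fun j => PowerSeries.map ι (g j)))
    {δ : Polynomial L} (hδ : δ ≠ 0) {A : Matrix (Fin n) (Fin n) (Polynomial L)}
    (hA : ∀ i, δ • g i = ∑ j, A i j • sig q (g j)) {ρ : ℝ} {hρ : 0 ≤ ρ} (hρ0 : 0 < ρ) (hρ1 : ρ < 1)
    (hconv : ∀ j, PowerSeries.map ι (g j) ∈ convSubring ρ hρ) {β : L} (hβ0 : β ≠ 0)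
    (hβ : ‖ι β‖ ≤ ρ) (hdetA : ∀ k : ℕ, (A.map (Polynomial.eval (β ^ q ^ k))).det ≠ 0)
    {c : Fin n → L} (hc : ∑ j, ι (c j) * psVal (PowerSeries.map ι (g j)) (ι β) = 0) : c = 0 := by
  classical
  by_contra hc0
  have hn : 0 < n := by
    rcases Nat.eq_zero_or_pos n with rfl | h
    · exact absurd (Subsingleton.elim c 0) hc0
    · exact h
  have hβn0 : 0 < ‖ι β‖ := norm_pos_iff.mpr ((map_ne_zero ι).mpr hβ0)
  have hβ1 : ‖ι β‖ < 1 := hβ.trans_lt hρ1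
  have hβk : ∀ k : ℕ, ‖ι (β ^ q ^ k)‖ ≤ ρ := fun k => by
    rw [map_pow, norm_pow]
    exact (pow_le_of_le_one (norm_nonneg _) hβ1.le (pow_ne_zero _ (NeZero.ne q))).trans hβ
  have hβinj : Function.Injective fun k : ℕ => β ^ q ^ k := by
    intro k l hkl
    have h1 : ‖ι β‖ ^ q ^ k = ‖ι β‖ ^ q ^ l := by
      rw [← norm_pow, ← norm_pow, ← map_pow, ← map_pow]
      exact congrArg (fun x => ‖ι x‖) hkl
    exact Nat.pow_right_injective hq (pow_right_injective₀ hβn0 hβ1.ne h1)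
  obtain ⟨Λ, hΛ, hΛβ, hΛy⟩ := exists_sizeLe_orbit hq hn A β c
  set y : ℕ → Fin n → L := orbit q A β c with hy
  have hrel := sum_orbit_mul_psVal ι hA hρ1.le hconv hβ hc
  rw [← hy] at hrel
  obtain ⟨t, w, m, b, Y, Δ, hm, hbmem, hQ, hY, hcomm, j₀, hj₀⟩ :=
    exists_representation_along hβinj (orbit_ne_zero hdetA hc0)
  rw [← hy] at hbmem hQ hY
  have hgrowβ : Growth q Λ 1 fun k => β ^ q ^ k := ⟨1, one_pos, fun k => by simpa using hΛβ k⟩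
  have hgrowy : ∀ j, Growth q Λ 1 fun k => y k j :=
    fun j => ⟨1, one_pos, fun k => by simpa using hΛy k j⟩
  obtain ⟨S, hS⟩ : ∃ S, ∀ i, Growth q Λ S (b i) := by
    choose S hS using fun i => exists_growth_of_mem_closure hgrowy (hbmem i)
    exact ⟨∑ i, S i, fun i => (hS i).mono hΛ (Finset.single_le_sum (fun _ _ => Nat.zero_le _)
      (Finset.mem_univ i))⟩
  obtain ⟨e, hbe⟩ : ∃ e : ℕ, ∀ k i, ‖ι (b i k)‖ ≤ e * (Λ : ℝ) ^ (S * q ^ k) := by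
    choose e he hb using hS
    refine ⟨∑ i, e i, fun k i => ((hb i k).2 ι).trans ?_⟩
    push_cast
    refine mul_le_mul_of_nonneg_right ?_ (by positivity)
    exact Finset.single_le_sum (f := fun i => (e i : ℝ)) (fun _ _ => Nat.cast_nonneg _)
      (Finset.mem_univ i)
  let F : Matrix (Fin m) (Fin m) (MvPolynomial (Fin t) (convOver ι ρ hρ)) :=
    ∑ j, (MvPolynomial.C (⟨g j, hconv j⟩ : convOver ι ρ hρ) :
      MvPolynomial (Fin t) (convOver ι ρ hρ)) • (MvPolynomial.map (polyToConv ι hρ)).mapMatrix (Y j)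
  let F' := (MvPolynomial.map (σ := Fin t) (convOver ι ρ hρ).subtype).mapMatrix F
  have hF' : F' = ∑ j, (MvPolynomial.C (g j) : MvPolynomial (Fin t) L⟦X⟧) • (Y j).map polyMap := by
    simp only [F', F]
    rw [map_sum]
    refine Finset.sum_congr rfl fun j _ => ?_
    ext1 i l
    simp only [RingHom.mapMatrix_apply, Matrix.map_apply, Matrix.smul_apply, smul_eq_mul, map_mul,
      MvPolynomial.map_C, polyMap, MvPolynomial.map_map]
    rfl
  have hF'det : F'.det ≠ 0 := by
    rw [hF']
    exact det_pencil_ne_zero ι hq hg hδ hA hcomm hj₀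
  let a := ∑ i, ∑ l, ∑ s, (F i l).degreeOf s
  have ha : ∀ i l s, (F i l).degreeOf s ≤ a := fun i l s =>
    (Finset.single_le_sum (f := fun s => (F i l).degreeOf s) (fun _ _ => Nat.zero_le _)
      (Finset.mem_univ s)).trans ((Finset.single_le_sum
      (f := fun l => ∑ s, (F i l).degreeOf s) (fun _ _ => Nat.zero_le _)
      (Finset.mem_univ l)).trans (Finset.single_le_sum
      (f := fun i => ∑ l, ∑ s, (F i l).degreeOf s) (fun _ _ => Nat.zero_le _) (Finset.mem_univ i)))
  have ha' : ∀ i l s, (F' i l).degreeOf s ≤ a := fun i l s =>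
    (MvPolynomial.degreeOf_le_iff.mpr fun e he => MvPolynomial.degreeOf_le_iff.mp le_rfl e
      (MvPolynomial.support_map_subset _ _ he)).trans (ha i l s)
  obtain ⟨s₀, haux⟩ := exists_auxiliary_rows hm F' ha' hF'det
  have hkill : ∀ᶠ k in (hyperfilter ℕ : Filter ℕ),
      ∀ i, ∑ l, evPoint ι hρ (hβk k) (fun s => y k (w s)) (F i l) * ι (b l k) = 0 := by
    have h1 := eventually_all.mpr fun j => eventually_all.mpr fun i => hY j i
    filter_upwards [h1] with k hk i
    have h2 : ∀ l, evPoint ι hρ (hβk k) (fun s => y k (w s)) (F i l) =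
        ∑ j, psVal (PowerSeries.map ι (g j)) (ι (β ^ q ^ k)) *
          ι (evBoth (β ^ q ^ k) (fun s => y k (w s)) (Y j i l)) := by
      intro l
      simp only [F, Matrix.sum_apply, Matrix.smul_apply, smul_eq_mul, map_sum, map_mul,
        RingHom.mapMatrix_apply, Matrix.map_apply, evPoint_map, evPoint_C, psVal]
    simp only [h2, Finset.sum_mul]
    rw [Finset.sum_comm]
    calc _ = ∑ j, psVal (PowerSeries.map ι (g j)) (ι (β ^ q ^ k)) *
          ι (∑ l, evBoth (β ^ q ^ k) (fun s => y k (w s)) (Y j i l) * b l k) := by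
          refine Finset.sum_congr rfl fun j _ => ?_
          rw [map_sum, Finset.mul_sum]
          exact Finset.sum_congr rfl fun l _ => by rw [map_mul, mul_assoc]
      _ = ι (evBoth (β ^ q ^ k) (fun s => y k (w s)) Δ * b i k) *
          ∑ j, ι (y k j) * psVal (PowerSeries.map ι (g j)) (ι (β ^ q ^ k)) := by
          rw [Finset.mul_sum]
          refine Finset.sum_congr rfl fun j _ => ?_
          rw [hk j i, map_mul, map_mul, map_mul]
          ring
      _ = 0 := by rw [hrel k, mul_zero]
  let N := 2 * Module.finrank ℚ L
  let κ := t * (1 + a) + S + N * ((1 + a) ^ t + t + S)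
  have hΛ1 : (1 : ℝ) ≤ Λ := by exact_mod_cast hΛ
  obtain ⟨r, hr⟩ : ∃ r : ℕ, ‖ι β‖ ^ r * (Λ : ℝ) ^ κ < 1 := by
    have hpos : 0 < (Λ : ℝ) ^ κ := by positivity
    obtain ⟨r, hr⟩ := exists_pow_lt_of_lt_one (inv_pos.mpr hpos) hβ1
    exact ⟨r, by rwa [← lt_inv_mul_iff₀' hpos, mul_one]⟩
  let M := s₀ + r + 1
  obtain ⟨J, p, hp0, hJ, hpdeg, hpnat, hdvd⟩ := haux M
  obtain ⟨C, hC0, hC⟩ := exists_upper_bound ι hρ0 hΛ hβk (y := fun k s => y k (w s))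
    (fun k s => by simpa using (hΛy k (w s)).2 ι) F ha p hJ hpdeg hdvd (b := fun k i => b i k) hbe
  obtain ⟨e', he', hx⟩ : Growth q Λ ((1 + a) ^ t * M + t * M + S) fun k =>
      ∑ i, evBoth (β ^ q ^ k) (fun s => y k (w s)) (p 0 i) * b i k :=
    Growth.sum hΛ fun i _ => (Growth.mvPolynomial_eval hΛ hgrowβ (fun s => hgrowy (w s)) (p 0 i)
      (hpnat 0 i) (hpdeg 0 i)).mul (hS i)
  have hT : M * (M + 1) - s₀ * M = M * (r + 2) := by
    rw [mul_comm s₀ M, ← Nat.mul_sub]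
    congr 1
    omega
  rw [hT] at hC
  refine false_of_one_le_mul_pow hq (C := C * (e' : ℝ) ^ N)
    (θ := (‖ι β‖ ^ r * (Λ : ℝ) ^ κ) ^ M) (by positivity)
    (pow_lt_one₀ (by positivity) hr (by omega)) ?_
  filter_upwards [hkill, hQ (p 0) hp0] with k hk hk0
  have h1 := (hx k).one_le hk0 (by positivity) ι
  refine h1.trans ((mul_le_mul_of_nonneg_right (hC k hk) (by positivity)).trans ?_)
  have h2 : ‖ι β‖ ^ (M * (r + 2)) * (Λ : ℝ) ^ (t * (M * (1 + a)) + S) *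
      (Λ : ℝ) ^ (N * ((1 + a) ^ t * M + t * M + S)) ≤ (‖ι β‖ ^ r * (Λ : ℝ) ^ κ) ^ M := by
    rw [mul_pow, ← pow_mul, ← pow_mul, mul_assoc, ← pow_add]
    refine mul_le_mul (pow_le_pow_of_le_one (norm_nonneg _) hβ1.le ?_)
      (pow_le_pow_right₀ hΛ1 ?_) (by positivity) (by positivity)
    · rw [mul_comm r M]
      exact Nat.mul_le_mul_left _ (by omega)
    · have h3 : S ≤ S * M := Nat.le_mul_of_pos_right S (by omega)
      have h4 := Nat.mul_le_mul_left N h3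
      simp only [κ]
      nlinarith
  calc _ = C * (e' : ℝ) ^ N * (‖ι β‖ ^ (M * (r + 2)) * (Λ : ℝ) ^ (t * (M * (1 + a)) + S) *
      (Λ : ℝ) ^ (N * ((1 + a) ^ t * M + t * M + S))) ^ q ^ k := by
        push_cast
        simp only [N, mul_pow, ← pow_mul]
        ring
    _ ≤ _ := by gcongr

end Core
end Mahler

namespace Mahler
open Finset PowerSeries

section Descent
variable {n : ℕ}

/-- The coefficients of a solution of a Mahler system are determined by finitely many of them. -/
theorem coeff_mem_of_system {q : ℕ} [NeZero q] (hq : 2 ≤ q) {g : Fin n → ℂ⟦X⟧}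
    {δ : Polynomial ℂ} (hδ : δ ≠ 0) {A : Matrix (Fin n) (Fin n) (Polynomial ℂ)}
    (hA : ∀ i, δ • g i = ∑ j, A i j • sig q (g j)) {E : IntermediateField ℚ ℂ}
    (hEδ : ∀ k, δ.coeff k ∈ E) (hEA : ∀ i j k, (A i j).coeff k ∈ E)
    (hEg : ∀ j, ∀ k ≤ δ.natTrailingDegree, coeff k (g j) ∈ E) (k : ℕ) :
    ∀ i, coeff k (g i) ∈ E := by
  induction k using Nat.strong_induction_on with
  | _ k ih =>
    intro i
    set v := δ.natTrailingDegree with hv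
    rcases Nat.lt_or_ge v k with hk | hk
    · have hδv : δ.coeff v ≠ 0 := Polynomial.trailingCoeff_nonzero_iff_nonzero.mpr hδ
      have h1 : coeff (k + v) (δ • g i) ∈ E := by
        rw [hA i, map_sum]
        refine sum_mem fun j _ => ?_
        rw [poly_smul_eq, PowerSeries.coeff_mul]
        refine sum_mem fun x hx => mul_mem ?_ ?_
        · rw [Polynomial.coeff_coe]
          exact hEA i j _
        · rw [coeff_expand]
          split_ifs with hd
          · refine ih _ ?_ j
            have h2 : x.1 + x.2 = k + v := HasAntidiagonal.mem_antidiagonal.mp hx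
            rw [Nat.div_lt_iff_lt_mul (by omega)]
            nlinarith
          · exact zero_mem _
      have h2 : coeff (k + v) (δ • g i) = δ.coeff v * coeff k (g i) +
          ∑ x ∈ (antidiagonal (k + v)).erase (v, k), δ.coeff x.1 * coeff x.2 (g i) := by
        rw [poly_smul_eq, PowerSeries.coeff_mul, ← Finset.add_sum_erase _ _
          (HasAntidiagonal.mem_antidiagonal.mpr (add_comm v k) : (v, k) ∈ antidiagonal (k + v))]
        simp only [Polynomial.coeff_coe]
      have h3 : ∑ x ∈ (antidiagonal (k + v)).erase (v, k), δ.coeff x.1 * coeff x.2 (g i) ∈ E := by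
        refine sum_mem fun x hx => ?_
        obtain ⟨hne, hx⟩ := Finset.mem_erase.mp hx
        have h4 : x.1 + x.2 = k + v := HasAntidiagonal.mem_antidiagonal.mp hx
        rcases lt_trichotomy x.1 v with h5 | h5 | h5
        · rw [Polynomial.coeff_eq_zero_of_lt_natTrailingDegree h5, zero_mul]
          exact zero_mem _
        · exact absurd (Prod.ext h5 (by dsimp only; omega)) hne
        · exact mul_mem (hEδ _) (ih _ (by omega) i)
      rw [h2] at h1
      have h6 := (add_mem_cancel_right h3).mp h1
      have h7 := mul_mem (inv_mem (hEδ v)) h6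
      rwa [inv_mul_cancel_left₀ hδv] at h7
    · exact hEg i k hk

theorem exists_map_eq_of_coeff_mem {E : IntermediateField ℚ ℂ} {f : ℂ⟦X⟧}
    (hf : ∀ k, coeff k f ∈ E) : ∃ f' : E⟦X⟧, PowerSeries.map (algebraMap E ℂ) f' = f :=
  ⟨PowerSeries.mk fun k => ⟨coeff k f, hf k⟩, by ext k; simp⟩

theorem exists_polynomial_map_eq_of_coeff_mem {E : IntermediateField ℚ ℂ} {f : Polynomial ℂ}
    (hf : ∀ k, f.coeff k ∈ E) : ∃ f' : Polynomial E, f'.map (algebraMap E ℂ) = f := by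
  have : f ∈ Polynomial.lifts (algebraMap E ℂ) := by
    rw [Polynomial.lifts_iff_coeff_lifts]
    exact fun k => ⟨⟨f.coeff k, hf k⟩, rfl⟩
  exact (Polynomial.mem_lifts _).mp this

theorem eq_zero_of_algebraic_sum_psVal_eq_zero {q : ℕ} [NeZero q] (hq : 2 ≤ q) {g : Fin n → ℂ⟦X⟧}
    (hg : LinearIndependent (Polynomial ℂ) g) (hgalg : ∀ j k, IsAlgebraic ℚ (coeff k (g j)))
    {δ : Polynomial ℂ} (hδ : δ ≠ 0) (hδalg : ∀ k, IsAlgebraic ℚ (δ.coeff k))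
    {A : Matrix (Fin n) (Fin n) (Polynomial ℂ)} (hAalg : ∀ i j k, IsAlgebraic ℚ ((A i j).coeff k))
    (hA : ∀ i, δ • g i = ∑ j, A i j • sig q (g j)) {ρ : ℝ} {hρ : 0 ≤ ρ} (hρ0 : 0 < ρ) (hρ1 : ρ < 1)
    (hconv : ∀ j, g j ∈ convSubring ρ hρ) {β : ℂ} (hβalg : IsAlgebraic ℚ β) (hβ0 : β ≠ 0)
    (hβ : ‖β‖ ≤ ρ) (hdetA : ∀ k : ℕ, (A.map (Polynomial.eval (β ^ q ^ k))).det ≠ 0)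
    {c : Fin n → ℂ} (hcalg : ∀ j, IsAlgebraic ℚ (c j)) (hc : ∑ j, c j * psVal (g j) β = 0) :
    c = 0 := by
  classical
  let s : Set ℂ := δ.coeffs ∪ (⋃ i, ⋃ j, ((A i j).coeffs : Set ℂ)) ∪
    (Set.range fun x : Fin n × Fin (δ.natTrailingDegree + 1) => coeff (x.2 : ℕ) (g x.1)) ∪
    {β} ∪ Set.range c
  have hs : s.Finite := by
    refine ((((Finset.finite_toSet _).union (Set.finite_iUnion fun i => Set.finite_iUnion fun j =>
      Finset.finite_toSet _)).union (Set.finite_range _)).union (Set.finite_singleton _)).union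
      (Set.finite_range _)
  have hsalg : ∀ x ∈ s, IsIntegral ℚ x := by
    rintro x ((((hx | hx) | ⟨y, rfl⟩) | rfl) | ⟨j, rfl⟩)
    · obtain ⟨k, -, rfl⟩ := Polynomial.mem_coeffs_iff.mp hx
      exact (hδalg k).isIntegral
    · obtain ⟨i, hx⟩ := Set.mem_iUnion.mp hx
      obtain ⟨j, hx⟩ := Set.mem_iUnion.mp hx
      obtain ⟨k, -, rfl⟩ := Polynomial.mem_coeffs_iff.mp hx
      exact (hAalg i j k).isIntegral
    · exact (hgalg _ _).isIntegral
    · exact hβalg.isIntegral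
    · exact (hcalg j).isIntegral
  let E := IntermediateField.adjoin ℚ s
  have : Finite s := hs
  have : FiniteDimensional ℚ E := IntermediateField.finiteDimensional_adjoin hsalg
  have : NumberField E := { to_charZero := inferInstance, to_finiteDimensional := this }
  have hsE : s ⊆ E := IntermediateField.subset_adjoin ℚ s
  have hEδ : ∀ k, δ.coeff k ∈ E := fun k => by
    by_cases h : δ.coeff k = 0
    · rw [h]
      exact zero_mem _
    · exact hsE (Or.inl (Or.inl (Or.inl (Or.inl (Polynomial.coeff_mem_coeffs h)))))
  have hEA : ∀ i j k, (A i j).coeff k ∈ E := fun i j k => by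
    by_cases h : (A i j).coeff k = 0
    · rw [h]
      exact zero_mem _
    · exact hsE (Or.inl (Or.inl (Or.inl (Or.inr (Set.mem_iUnion.mpr ⟨i, Set.mem_iUnion.mpr
        ⟨j, Polynomial.coeff_mem_coeffs h⟩⟩)))))
  have hEg := coeff_mem_of_system hq hδ hA hEδ hEA fun j k hk =>
    hsE (Or.inl (Or.inl (Or.inr ⟨(j, ⟨k, Nat.lt_succ_of_le hk⟩), rfl⟩)))
  have hEβ : β ∈ E := hsE (Or.inl (Or.inr rfl))
  have hEc : ∀ j, c j ∈ E := fun j => hsE (Or.inr ⟨j, rfl⟩)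
  let ι : E →+* ℂ := algebraMap E ℂ
  choose g' hg' using fun j => exists_map_eq_of_coeff_mem (E := E) (f := g j) fun k => hEg k j
  obtain ⟨δ', hδ'⟩ := exists_polynomial_map_eq_of_coeff_mem hEδ
  choose A' hA' using fun i j => exists_polynomial_map_eq_of_coeff_mem (hEA i j)
  have hgfun : (fun j => PowerSeries.map ι (g' j)) = g := funext hg'
  have key := eq_zero_of_sum_psVal_eq_zero (L := E) ι hq (g := g') (by rwa [hgfun])
    (δ := δ') (by rintro rfl; exact hδ (by rw [← hδ', Polynomial.map_zero]))
    (A := Matrix.of A') (fun i => by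
      apply PowerSeries.map_injective ι ι.injective
      rw [map_polynomial_smul, map_sum, hg', hδ', hA i]
      refine Finset.sum_congr rfl fun j _ => ?_
      rw [map_polynomial_smul, map_sig, hg', Matrix.of_apply, hA'])
    (ρ := ρ) (hρ := hρ) hρ0 hρ1 (fun j => by rw [hg']; exact hconv j) (β := ⟨β, hEβ⟩)
    (fun h => hβ0 (congrArg Subtype.val h)) hβ (fun k h => hdetA k (by
      have h2 := congrArg ι h
      rw [RingHom.map_det, map_zero] at h2
      rw [← h2]
      congr 1
      ext1 i j
      simp only [Matrix.map_apply, RingHom.mapMatrix_apply, Matrix.of_apply, ← hA' i j]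
      have h3 := Polynomial.eval_map_apply (p := A' i j) ι (⟨β, hEβ⟩ ^ q ^ k)
      rw [map_pow] at h3
      exact h3))
    (c := fun j => ⟨c j, hEc j⟩) (by
      refine (Finset.sum_congr rfl fun j _ => ?_).trans hc
      exact congrArg (fun f => c j * psVal f β) (hg' j))
  funext j
  exact congrArg Subtype.val (congrFun key j)

end Descent
end Mahler

namespace Mahler
open Finset PowerSeries

section BaseChange
variable {K F : Type*} [Field K] [Field F] [Algebra K F]

theorem exists_functional_eq_one {x : F} (hx : x ≠ 0) : ∃ φ : F →ₗ[K] K, φ x = 1 :=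
  Module.Projective.exists_dual_eq_one K hx

/-- A linear functional applied to the coefficients of a polynomial. -/
def polyFunctional (φ : F →ₗ[K] K) (p : Polynomial F) : Polynomial K :=
  ∑ k ∈ p.support, Polynomial.monomial k (φ (p.coeff k))

theorem coeff_polyFunctional (φ : F →ₗ[K] K) (p : Polynomial F) (k : ℕ) :
    (polyFunctional φ p).coeff k = φ (p.coeff k) := by
  rw [polyFunctional, Polynomial.finsetSum_coeff]
  simp only [Polynomial.coeff_monomial, Finset.sum_ite_eq', Polynomial.mem_support_iff]
  split_ifs with h
  · rfl
  · rw [Polynomial.notMem_support_iff.mp h, map_zero]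

theorem sum_polyFunctional_smul (φ : F →ₗ[K] K) {ι : Type*} (s : Finset ι) (p : ι → Polynomial F)
    (f : ι → K⟦X⟧) (h : ∑ i ∈ s, p i • PowerSeries.map (algebraMap K F) (f i) = 0) :
    ∑ i ∈ s, polyFunctional φ (p i) • f i = 0 := by
  ext m
  have h1 := congrArg (fun x => φ (coeff m x)) h
  simp only [map_zero, map_sum, poly_smul_eq, PowerSeries.coeff_mul, Polynomial.coeff_coe,
    PowerSeries.coeff_map] at h1 ⊢
  rw [← h1]
  refine Finset.sum_congr rfl fun i _ => Finset.sum_congr rfl fun x _ => ?_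
  rw [coeff_polyFunctional, mul_comm ((p i).coeff x.1), ← Algebra.smul_def, map_smul, smul_eq_mul,
    mul_comm]

theorem exists_polyFunctional_ne_zero {p : Polynomial F} (hp : p ≠ 0) :
    ∃ φ : F →ₗ[K] K, polyFunctional φ p ≠ 0 := by
  obtain ⟨φ, hφ⟩ := exists_functional_eq_one (K := K) (Polynomial.leadingCoeff_ne_zero.mpr hp)
  refine ⟨φ, fun h => ?_⟩
  have h1 := coeff_polyFunctional φ p p.natDegree
  rw [h, Polynomial.coeff_zero, Polynomial.coeff_natDegree, hφ] at h1
  exact zero_ne_one h1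

theorem linearIndependent_map {n : ℕ} {g : Fin n → K⟦X⟧} (hg : LinearIndependent (Polynomial K) g) :
    LinearIndependent (Polynomial F) (fun j => PowerSeries.map (algebraMap K F) (g j)) := by
  rw [Fintype.linearIndependent_iff]
  intro p hp i
  by_contra hi
  obtain ⟨φ, hφ⟩ := exists_polyFunctional_ne_zero (K := K) hi
  exact hφ (Fintype.linearIndependent_iff.mp hg _ (sum_polyFunctional_smul φ _ p g hp) i)

theorem exists_mahler_equation (q : ℕ) [NeZero q] (f : K⟦X⟧) {m : ℕ} {p : ℕ → Polynomial F}
    (hp : ∃ i, i ≤ m ∧ p i ≠ 0)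
    (h : ∑ i ∈ range (m + 1), p i • (sig q)^[i] (PowerSeries.map (algebraMap K F) f) = 0) :
    ∃ (m : ℕ) (p : ℕ → Polynomial K), p m ≠ 0 ∧
      ∑ l ∈ range (m + 1), p l • (sig q)^[l] f = 0 := by
  classical
  induction m with
  | zero =>
    obtain ⟨i, hi, hpi⟩ := hp
    obtain rfl : i = 0 := by omega
    obtain ⟨φ, hφ⟩ := exists_polyFunctional_ne_zero (K := K) hpi
    refine ⟨0, fun i => polyFunctional φ (p i), hφ, ?_⟩
    exact sum_polyFunctional_smul φ (range 1) p (fun l => (sig q)^[l] f) (by simpa using h)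
  | succ m ih =>
    by_cases hm : p (m + 1) = 0
    · obtain ⟨i, hi, hpi⟩ := hp
      rw [Finset.sum_range_succ, hm, zero_smul, add_zero] at h
      refine ih ⟨i, ?_, hpi⟩ h
      rcases Nat.lt_or_ge i (m + 1) with h1 | h1
      · omega
      · obtain rfl : i = m + 1 := by omega
        exact absurd hm hpi
    · obtain ⟨φ, hφ⟩ := exists_polyFunctional_ne_zero (K := K) hm
      refine ⟨m + 1, fun i => polyFunctional φ (p i), hφ, ?_⟩
      refine sum_polyFunctional_smul φ (range (m + 2)) p (fun l => (sig q)^[l] f) ?_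
      refine Eq.trans (Finset.sum_congr rfl fun l _ => ?_) h
      congr 1
      exact Function.Semiconj.iterate_right (fun x => map_sig (algebraMap K F) q x) l f

end BaseChange
end Mahler

namespace Mahler
open Finset PowerSeries Filter

theorem analyticAt_psVal {x : ℂ⟦X⟧} {ρ : ℝ} {hρ : 0 ≤ ρ} (hx : x ∈ convSubring ρ hρ) {z : ℂ}
    (hz : ‖z‖ < ρ) : AnalyticAt ℂ (psVal x) z := by
  have hd : DifferentiableOn ℂ (psVal x) (Metric.ball 0 ρ) := by
    refine Complex.differentiableOn_tsum_of_summable_norm (mem_convSubring.mp hx)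
      (fun i => by fun_prop) Metric.isOpen_ball fun i w hw => ?_
    rw [norm_mul, norm_mul, norm_pow, norm_pow, Complex.norm_real, Real.norm_of_nonneg hρ]
    have : ‖w‖ ≤ ρ := (mem_ball_zero_iff.mp hw).le
    gcongr
  exact hd.analyticAt (Metric.isOpen_ball.mem_nhds (mem_ball_zero_iff.mpr hz))

theorem sig_iterate_mem_convSubring (q : ℕ) [NeZero q] {x : ℂ⟦X⟧} {ρ : ℝ} {hρ : 0 ≤ ρ}
    (hρ1 : ρ ≤ 1) (hx : x ∈ convSubring ρ hρ) (N : ℕ) : (sig q)^[N] x ∈ convSubring ρ hρ := by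
  induction N with
  | zero => exact hx
  | succ N ih =>
    rw [Function.iterate_succ_apply']
    exact sig_mem_convSubring q hρ1 ih

theorem psVal_sig_iterate (q : ℕ) [NeZero q] (x : ℂ⟦X⟧) (z : ℂ) (N : ℕ) :
    psVal ((sig q)^[N] x) z = psVal x (z ^ q ^ N) := by
  induction N generalizing z with
  | zero => simp
  | succ N ih => rw [Function.iterate_succ_apply', psVal_sig, ih, ← pow_mul, pow_succ, mul_comm]

theorem convSubring_mono {x : ℂ⟦X⟧} {ρ ρ' : ℝ} {hρ : 0 ≤ ρ} (hρ' : 0 ≤ ρ') (h : ρ' ≤ ρ)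
    (hx : x ∈ convSubring ρ hρ) : x ∈ convSubring ρ' hρ' :=
  summable_of_mem_convSubring hx (by rwa [Complex.norm_real, Real.norm_of_nonneg hρ'])

theorem eventually_mem_convSubring {f : ℂ⟦X⟧} {F : ℂ → ℂ}
    (hF : ∀ᶠ z in nhds (0 : ℂ), HasSum (fun n => coeff n f * z ^ n) (F z)) :
    ∃ ρ : ℝ, 0 < ρ ∧ ∃ hρ : 0 ≤ ρ, f ∈ convSubring ρ hρ := by
  obtain ⟨ε, hε, h⟩ := Metric.eventually_nhds_iff.mp hF
  refine ⟨ε / 2, by positivity, by positivity, ?_⟩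
  have h1 := @h ((ε / 2 : ℝ) : ℂ) (by
    rw [dist_zero_right, Complex.norm_real, Real.norm_of_nonneg (by positivity)]; linarith)
  exact h1.summable.norm

/-- Analytic continuation of a linear relation between power series, one of which is only
meromorphic on the disc. -/
theorem eval_mul_eq_sum_of_meromorphicOn {q : ℕ} [NeZero q] {f : ℂ⟦X⟧} {F : ℂ → ℂ}
    (hFm : MeromorphicOn F (Metric.ball (0 : ℂ) 1))
    (hF : ∀ᶠ z in nhds (0 : ℂ), HasSum (fun n => coeff n f * z ^ n) (F z))
    {α : ℂ} (hFα : AnalyticAt ℂ F α) {n N : ℕ} {g : Fin n → ℂ⟦X⟧} {ρ : ℝ} {hρ : 0 ≤ ρ}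
    (hρ0 : 0 < ρ) (hρ1 : ρ < 1) (hg : ∀ j, g j ∈ convSubring ρ hρ) {d : Polynomial ℂ}
    {B : Fin n → Polynomial ℂ} (h : d • f = ∑ j, B j • (sig q)^[N] (g j))
    (hα : ‖α ^ q ^ N‖ < ρ) :
    d.eval α * F α = ∑ j, (B j).eval α * psVal (g j) (α ^ q ^ N) := by
  have hQ : q ^ N ≠ 0 := pow_ne_zero _ (NeZero.ne q)
  set R : ℝ := ρ ^ ((q ^ N : ℕ) : ℝ)⁻¹ with hR
  have hRpow : R ^ (q ^ N) = ρ := Real.rpow_inv_natCast_pow hρ hQ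
  have hR0 : 0 ≤ R := Real.rpow_nonneg hρ _
  have hR1 : R < 1 := by
    by_contra! hcon
    have := one_le_pow₀ (n := q ^ N) hcon
    linarith
  have hmem : ∀ z : ℂ, ‖z ^ q ^ N‖ < ρ ↔ z ∈ Metric.ball (0 : ℂ) R := fun z => by
    rw [norm_pow, ← hRpow, mem_ball_zero_iff, pow_lt_pow_iff_left₀ (norm_nonneg _) hR0 hQ]
  set D : ℂ → ℂ := fun z =>
    d.eval z * F z - ∑ j, (B j).eval z * psVal (g j) (z ^ q ^ N) with hD
  have hsum : ∀ z ∈ Metric.ball (0 : ℂ) R, AnalyticAt ℂ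
      (fun z => ∑ j, (B j).eval z * psVal (g j) (z ^ q ^ N)) z := fun z hz => by
    refine Finset.analyticAt_fun_sum _ fun j _ => ?_
    refine AnalyticAt.mul (AnalyticOnNhd.eval_polynomial (B j) z (Set.mem_univ z)) ?_
    exact AnalyticAt.fun_comp (analyticAt_psVal (hg j) ((hmem z).mpr hz)) (analyticAt_id.pow _)
  have hdan : ∀ z : ℂ, AnalyticAt ℂ (fun z => d.eval z) z := fun z =>
    AnalyticOnNhd.eval_polynomial d z (Set.mem_univ z)
  have hDm : MeromorphicOn D (Metric.ball (0 : ℂ) R) := fun z hz =>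
    ((hdan z).meromorphicAt.mul (hFm z (Metric.ball_subset_ball hR1.le hz))).sub
      (hsum z hz).meromorphicAt
  have hαR : α ∈ Metric.ball (0 : ℂ) R := (hmem α).mp hα
  have hRpos : 0 < R := (norm_nonneg α).trans_lt (mem_ball_zero_iff.mp hαR)
  have hD0 : ∀ᶠ z in nhds (0 : ℂ), D z = 0 := by
    obtain ⟨r, hr0, hr, hfr⟩ := eventually_mem_convSubring hF
    have hr' : 0 < min r ρ := lt_min hr0 hρ0
    filter_upwards [hF, Metric.ball_mem_nhds (0 : ℂ) hr'] with z hz hzr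
    have hz1 : ‖z‖ ≤ min r ρ := (mem_ball_zero_iff.mp hzr).le
    have e1 := psVal_smul hfr d (hz1.trans (min_le_left _ _))
    rw [h, psVal_sum_smul (fun j => sig_iterate_mem_convSubring q hρ1.le (hg j) N) B
      (hz1.trans (min_le_right _ _))] at e1
    simp only [psVal_sig_iterate] at e1
    have e2 : psVal f z = F z := hz.tsum_eq
    simp only [hD]
    rw [e1, e2, sub_self]
  have hDα : ∀ᶠ z in nhdsWithin α {α}ᶜ, D z = 0 := by
    rw [← meromorphicOrderAt_eq_top_iff]
    by_contra hcon
    exact hDm.meromorphicOrderAt_ne_top_of_isPreconnected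
      (convex_ball (0 : ℂ) R).isPreconnected hαR (Metric.mem_ball_self hRpos) hcon
      (meromorphicOrderAt_eq_top_iff.mpr (hD0.filter_mono nhdsWithin_le_nhds))
  have hcont : ContinuousAt D α :=
    (((hdan α).mul hFα).sub (hsum α hαR)).continuousAt
  have hfin : D =ᶠ[nhds α] fun _ => 0 :=
    (hcont.eventuallyEq_nhds_iff_eventuallyEq_nhdsNE continuousAt_const).mp hDα
  exact sub_eq_zero.mp hfin.eq_of_nhds

end Mahler

namespace Mahler
open Finset PowerSeries Filter

theorem psSigma_eq_sig (q : ℕ) [NeZero q] : psSigma q = sig q := by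
  funext f
  ext n
  have := coeff_sig_iterate q 1 f n
  simp only [Function.iterate_one, pow_one] at this
  rw [this, psSigma, coeff_mk]

theorem polyPS_mul_eq_smul (p : Polynomial ℂ) (f : ℂ⟦X⟧) : polyPS p * f = p • f :=
  (poly_smul_eq p f).symm

theorem exists_pow_lt_and_eval_ne_zero {q : ℕ} (hq : 2 ≤ q) {α : ℂ} (hα0 : α ≠ 0) (hα1 : ‖α‖ < 1)
    {p : Polynomial ℂ} (hp : p ≠ 0) {ρ : ℝ} (hρ : 0 < ρ) :
    ∃ N : ℕ, ‖α ^ q ^ N‖ < ρ ∧ ∀ k, N ≤ k → p.eval (α ^ q ^ k) ≠ 0 := by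
  have hinj : Function.Injective fun k : ℕ => α ^ q ^ k := by
    intro a b hab
    have h1 : ‖α‖ ^ q ^ a = ‖α‖ ^ q ^ b := by rw [← norm_pow, ← norm_pow]; exact congrArg _ hab
    exact Nat.pow_right_injective hq
      (pow_right_injective₀ (norm_pos_iff.mpr hα0) hα1.ne h1)
  have hfin : {k : ℕ | α ^ q ^ k ∈ p.roots.toFinset}.Finite :=
    Set.Finite.preimage hinj.injOn p.roots.toFinset.finite_toSet
  have h1 : ∀ᶠ k in atTop, α ^ q ^ k ∉ p.roots.toFinset := by
    rw [← Nat.cofinite_eq_atTop]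
    exact hfin.eventually_cofinite_notMem
  have h2 : ∀ᶠ k in atTop, ‖α‖ ^ q ^ k < ρ :=
    ((tendsto_pow_atTop_nhds_zero_of_lt_one (norm_nonneg α) hα1).comp
      (tendsto_pow_atTop_atTop_of_one_lt hq)).eventually_lt_const hρ
  obtain ⟨N, hN⟩ := eventually_atTop.mp (h1.and h2)
  refine ⟨N, by rw [norm_pow]; exact (hN N le_rfl).2, fun k hk h => (hN k hk).1 ?_⟩
  rw [Multiset.mem_toFinset, Polynomial.mem_roots hp]
  exact h

theorem exists_denominator_eval_ne_zero {k : Type*} [Field k] {n : ℕ} {a : k} {f : k⟦X⟧}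
    {h : Fin n → k⟦X⟧}
    (hspec : ∀ (d : Polynomial k) (B : Fin n → Polynomial k), d • f = ∑ j, B j • h j →
      d.eval a = 0 → ∀ j, (B j).eval a = 0)
    (d : Polynomial k) (hd : d ≠ 0) (B : Fin n → Polynomial k) (hB : d • f = ∑ j, B j • h j) :
    ∃ d : Polynomial k, d.eval a ≠ 0 ∧ ∃ B : Fin n → Polynomial k, d • f = ∑ j, B j • h j := by
  induction hm : d.natDegree using Nat.strong_induction_on generalizing d B with
  | _ m ih =>
    by_cases hda : d.eval a = 0
    · have hBa := hspec d B hB hda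
      obtain ⟨d', rfl⟩ := Polynomial.dvd_iff_isRoot.mpr hda
      choose B' hB' using fun j => Polynomial.dvd_iff_isRoot.mpr (hBa j)
      have hd' : d' ≠ 0 := right_ne_zero_of_mul hd
      refine ih d'.natDegree ?_ d' hd' B' ?_ rfl
      · rw [← hm, Polynomial.natDegree_mul (Polynomial.X_sub_C_ne_zero a) hd',
          Polynomial.natDegree_X_sub_C]
        omega
      · have h0 : (Polynomial.X - Polynomial.C a) • d' • f =
            (Polynomial.X - Polynomial.C a) • ∑ j, B' j • h j := by
          rw [smul_smul, hB, Finset.smul_sum]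
          refine Finset.sum_congr rfl fun j _ => ?_
          rw [hB' j, mul_smul]
        rw [poly_smul_eq _ (d' • f), poly_smul_eq _ (∑ j, B' j • h j)] at h0
        exact mul_left_cancel₀
          (Polynomial.coe_eq_zero_iff.not.mpr (Polynomial.X_sub_C_ne_zero a)) h0
    · exact ⟨d, hda, B, hB⟩

end Mahler

open Mahler

/-- For a subfield `K` of `ℚ̄` and `α ∈ K` with `0 < |α| < 1`, elements of
`M_{q,α,K}` that are linearly dependent over `ℚ̄` are linearly dependent over `K`. -/
theorem M_linear_descent
    (q : ℕ) (hq : 2 ≤ q)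
    (K : Subfield ℂ) (hKalg : ∀ x ∈ K, IsAlgebraic ℚ x)
    (α : ℂ) (hαK : α ∈ K) (hα0 : 0 < ‖α‖) (hα1 : ‖α‖ < 1)
    (r : ℕ) (ξ : Fin r → ℂ) (hξ : ∀ i, ξ i ∈ Mset q α (K : Set ℂ))
    (c : Fin r → ℂ) (hcalg : ∀ i, IsAlgebraic ℚ (c i)) (hc0 : c ≠ 0)
    (hrel : ∑ i, c i * ξ i = 0) :
    ∃ c' : Fin r → ℂ, (∀ i, c' i ∈ K) ∧ c' ≠ 0 ∧ ∑ i, c' i * ξ i = 0 := by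
  classical
  have hq0 : NeZero q := ⟨by omega⟩
  have hα : α ≠ 0 := norm_pos_iff.mp hα0
  choose f hfM hfK F hFm hF hFα hFv using hξ
  let ι : K →+* ℂ := algebraMap K ℂ
  have hιalg : ∀ x : K, IsAlgebraic ℚ (ι x) := fun x => hKalg _ x.2
  let f' : Fin r → PowerSeries K := fun i => PowerSeries.mk fun n => ⟨_, hfK i n⟩
  have hf' : ∀ i, PowerSeries.map ι (f' i) = f i := fun i => by
    ext n
    rw [PowerSeries.coeff_map, PowerSeries.coeff_mk]
    rfl
  have hmahler : ∀ i, ∃ (m : ℕ) (p : ℕ → Polynomial K), p m ≠ 0 ∧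
      ∑ l ∈ Finset.range (m + 1), p l • (sig q)^[l] (f' i) = 0 := fun i => by
    obtain ⟨-, m, p, -, hp, h⟩ := hfM i
    refine exists_mahler_equation (F := ℂ) q (f' i) (m := m) (p := p) hp ?_
    rw [← h]
    refine Finset.sum_congr rfl fun l _ => ?_
    rw [polyPS_mul_eq_smul, psSigma_eq_sig, ← hf']
  obtain ⟨n, g', hg'ind, hg'f, ⟨δ, hδ, A, hA⟩, hdB⟩ := exists_system q f' hmahler
  have hdet : (A.map (Polynomial.map ι)).det ≠ 0 := by
    have h1 : (A.map (Polynomial.map ι)).det = A.det.map ι :=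
      (RingHom.map_det (Polynomial.mapRingHom ι) A).symm
    rw [h1]
    exact (Polynomial.map_ne_zero_iff ι.injective).mpr (det_ne_zero_of_linearIndependent hg'ind hδ hA)
  have hrad : ∃ ρ : ℝ, 0 < ρ ∧ ρ < 1 ∧ ∃ hρ : 0 ≤ ρ, ∀ i, f i ∈ convSubring ρ hρ := by
    choose s hs0 hs hfs using fun i => eventually_mem_convSubring (hF i)
    obtain ⟨ρ, hρ0, hρs, hρ1⟩ : ∃ ρ : ℝ, 0 < ρ ∧ (∀ i, ρ ≤ s i) ∧ ρ < 1 := by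
      have e1 : ∀ᶠ ρ in nhdsWithin (0 : ℝ) (Set.Ioi 0), ∀ i, ρ ≤ s i :=
        Filter.eventually_all.mpr fun i =>
          ((eventually_le_nhds (hs0 i)).filter_mono nhdsWithin_le_nhds)
      have e2 : ∀ᶠ ρ in nhdsWithin (0 : ℝ) (Set.Ioi 0), ρ < 1 :=
        (eventually_lt_nhds one_pos).filter_mono nhdsWithin_le_nhds
      have e3 : ∀ᶠ ρ in nhdsWithin (0 : ℝ) (Set.Ioi 0), 0 < ρ := self_mem_nhdsWithin
      obtain ⟨ρ, h1, h2, h3⟩ := (e1.and (e2.and e3)).exists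
      exact ⟨ρ, h3, h1, h2⟩
    exact ⟨ρ, hρ0, hρ1, hρ0.le, fun i => convSubring_mono hρ0.le (hρs i) (hfs i)⟩
  obtain ⟨ρ, hρ0, hρ1, hρ, hfρ⟩ := hrad
  let g : Fin n → PowerSeries ℂ := fun j => PowerSeries.map ι (g' j)
  have hsig : ∀ (N : ℕ) (x : PowerSeries K),
      PowerSeries.map ι ((sig q)^[N] x) = (sig q)^[N] (PowerSeries.map ι x) := fun N x =>
    Function.Semiconj.iterate_right (fun y => map_sig ι q y) N x
  have hgρ : ∀ j, g j ∈ convSubring ρ hρ := fun j => by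
    obtain ⟨i, l, hj⟩ := hg'f j
    have : g j = (sig q)^[l] (f i) := by rw [← hf', ← hsig, ← hj]
    rw [this]
    exact sig_iterate_mem_convSubring q hρ1.le (hfρ i) l
  obtain ⟨N, hNρ, hN⟩ := exists_pow_lt_and_eval_ne_zero hq hα hα1 hdet hρ0
  have hαalg : IsAlgebraic ℚ α := hKalg α hαK
  have hindep : ∀ c : Fin n → ℂ, (∀ j, IsAlgebraic ℚ (c j)) →
      ∑ j, c j * psVal (g j) (α ^ q ^ N) = 0 → c = 0 := fun c hcalg hc => by
    refine eq_zero_of_algebraic_sum_psVal_eq_zero hq (linearIndependent_map (F := ℂ) hg'ind)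
      (fun j k => ?_) (δ := δ.map ι) ((Polynomial.map_ne_zero_iff ι.injective).mpr hδ)
      (fun k => ?_) (A := A.map (Polynomial.map ι)) (fun i j k => ?_)
      (fun i => map_system ι hA i) hρ0 hρ1 hgρ (hαalg.pow _) (pow_ne_zero _ hα) hNρ.le
      (fun k => ?_) hcalg hc
    · rw [PowerSeries.coeff_map]
      exact hιalg _
    · rw [Polynomial.coeff_map]
      exact hιalg _
    · rw [Matrix.map_apply, Polynomial.coeff_map]
      exact hιalg _
    · rw [← pow_mul, ← pow_add]
      have h1 := hN (N + k) (Nat.le_add_right _ _)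
      have h2 := RingHom.map_det (Polynomial.evalRingHom (α ^ q ^ (N + k)))
        (A.map (Polynomial.map ι))
      rw [Polynomial.coe_evalRingHom] at h2
      rw [h2] at h1
      exact h1
  let a : K := ⟨α, hαK⟩
  have heval : ∀ p : Polynomial K, (p.map ι).eval α = ι (p.eval a) := fun p =>
    Polynomial.eval_map_apply ι a
  have hval : ∀ i (d : Polynomial K) (B : Fin n → Polynomial K),
      d • f' i = ∑ j, B j • (sig q)^[N] (g' j) →
      ι (d.eval a) * ξ i = ∑ j, ι ((B j).eval a) * psVal (g j) (α ^ q ^ N) := fun i d B h => by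
    have h1 : d.map ι • f i = ∑ j, (B j).map ι • (sig q)^[N] (g j) := by
      rw [← hf', ← map_polynomial_smul, h, map_sum]
      refine Finset.sum_congr rfl fun j _ => ?_
      rw [map_polynomial_smul, hsig]
    have h2 := eval_mul_eq_sum_of_meromorphicOn (hFm i) (hF i) (hFα i) hρ0 hρ1 hgρ h1 hNρ
    simpa only [heval, hFv] using h2
  have hden : ∀ i, ∃ d : Polynomial K, d.eval a ≠ 0 ∧ ∃ B : Fin n → Polynomial K,
      d • f' i = ∑ j, B j • (sig q)^[N] (g' j) := fun i => by
    obtain ⟨d, hd, B, hB⟩ := hdB N i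
    refine exists_denominator_eval_ne_zero (fun d B h hd j => ?_) d hd B hB
    have h1 := hval i d B h
    rw [hd, map_zero, zero_mul] at h1
    have h2 := congrFun (hindep (fun j => ι ((B j).eval a)) (fun j => hιalg _) h1.symm) j
    exact ι.injective (h2.trans (map_zero ι).symm)
  choose d hda B hB using hden
  let b : Fin r → Fin n → K := fun i j => (B i j).eval a / (d i).eval a
  have hb : ∀ i, ξ i = ∑ j, ι (b i j) * psVal (g j) (α ^ q ^ N) := fun i => by
    have h0 : ι ((d i).eval a) ≠ 0 := (map_ne_zero ι).mpr (hda i)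
    refine mul_left_cancel₀ h0 ?_
    rw [hval i (d i) (B i) (hB i), Finset.mul_sum]
    refine Finset.sum_congr rfl fun j _ => ?_
    rw [map_div₀, ← mul_assoc, mul_div_cancel₀ _ h0]
  have hswap : ∀ e : Fin r → ℂ, ∑ i, e i * ξ i =
      ∑ j, (∑ i, e i * ι (b i j)) * psVal (g j) (α ^ q ^ N) := fun e => by
    simp only [Finset.sum_mul]
    rw [Finset.sum_comm]
    refine Finset.sum_congr rfl fun i _ => ?_
    rw [hb i, Finset.mul_sum]
    exact Finset.sum_congr rfl fun j _ => (mul_assoc _ _ _).symm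
  have hcb : ∀ j, ∑ i, c i * ι (b i j) = 0 := fun j =>
    congrFun (hindep (fun j => ∑ i, c i * ι (b i j))
      (fun j => (IsIntegral.sum _ fun i _ =>
        ((hcalg i).mul (hιalg (b i j))).isIntegral).isAlgebraic)
      ((hswap c).symm.trans hrel)) j
  obtain ⟨i₀, hi₀⟩ := Function.ne_iff.mp hc0
  obtain ⟨φ, hφ⟩ := exists_functional_eq_one (K := K) hi₀
  refine ⟨fun i => ι (φ (c i)), fun i => (φ (c i)).2, fun h => ?_, ?_⟩
  · have h1 := congrFun h i₀
    simp [hφ] at h1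
  · rw [hswap]
    refine Finset.sum_eq_zero fun j _ => ?_
    have h1 : ∑ i, φ (c i) * b i j = 0 := by
      have h2 := congrArg φ (hcb j)
      rw [map_zero, map_sum] at h2
      rw [← h2]
      refine Finset.sum_congr rfl fun i _ => ?_
      rw [mul_comm (c i), ← Algebra.smul_def, map_smul, smul_eq_mul, mul_comm]
    have h3 := congrArg ι h1
    rw [map_sum, map_zero] at h3
    simp only [map_mul] at h3
    rw [h3, zero_mul]
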